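/- arXiv:1411.2133 — 9 statements merged into one kernel-verified Lean document; each statement's English description precedes it below -/
import Mathlib

section
/- Let n₁ ≥ 1 be an integer, and let (λ_j)_{j∈ℕ} be a sequence of reals with λ_j > 1 for all j whose counting function N_λ(τ) = #{j : λ_j < τ} is finite for every τ and satisfies, for some constants C₁ > 0 and κ > 0, |N_λ(t) − (C₁/n₁)·t^{n₁}| ≤ κ·t^{n₁−1} for all t > 1. Let (μ_k)_{k∈ℕ} be a sequence of reals with μ_k > 1 for all k and {k : μ_k < τ} finite for every τ. Then there exists C > 0 such that for every τ > 1, letting N_A(τ) = #{(j,k) ∈ ℕ² : λ_j·μ_k < τ}, one has |N_A(τ) − (C₁/n₁)·τ^{n₁}·Σ_{k : μ_k < τ} μ_k^{−n₁}| ≤ C·τ^{n₁−1}·Σ_{k : μ_k < τ} μ_k^{−(n₁−1)}. -/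
open Filter Topology

theorem two_factor_counting_with_uniform_remainder (n₁ : ℕ) (hn₁ : 1 ≤ n₁)
    (lam mu : ℕ → ℝ) (C₁ κ : ℝ) (hC₁ : 0 < C₁) (hκ : 0 < κ)
    (hlam : ∀ j, 1 < lam j) (hmu : ∀ k, 1 < mu k)
    (hlfin : ∀ τ : ℝ, {j : ℕ | lam j < τ}.Finite)
    (hmfin : ∀ τ : ℝ, {k : ℕ | mu k < τ}.Finite)
    (hweyl : ∀ t : ℝ, 1 < t →
      |(Nat.card {j : ℕ | lam j < t} : ℝ) - C₁ / n₁ * t ^ (n₁ : ℝ)| ≤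
        κ * t ^ ((n₁ : ℝ) - 1)) :
    ∃ C : ℝ, 0 < C ∧ ∀ τ : ℝ, 1 < τ →
      |(Nat.card {p : ℕ × ℕ | lam p.1 * mu p.2 < τ} : ℝ) -
          C₁ / n₁ * τ ^ (n₁ : ℝ) *
            ∑' k : {k : ℕ | mu k < τ}, mu (k : ℕ) ^ (-(n₁ : ℝ))| ≤
        C * τ ^ ((n₁ : ℝ) - 1) *
          ∑' k : {k : ℕ | mu k < τ}, mu (k : ℕ) ^ (-((n₁ : ℝ) - 1)) := by
  refine ⟨κ, hκ, fun τ hτ => ?_⟩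
  have hmpos : ∀ k, 0 < mu k := fun k => lt_trans one_pos (hmu k)
  haveI : Fintype {k : ℕ | mu k < τ} := (hmfin τ).fintype
  haveI : ∀ t : ℝ, Finite {j : ℕ | lam j < t} := fun t => (hlfin t).to_subtype
  have hkey : ∀ p : ℕ × ℕ, lam p.1 * mu p.2 < τ → mu p.2 < τ := by
    intro p hp
    nlinarith [hlam p.1, hmpos p.2]
  let e : {p : ℕ × ℕ | lam p.1 * mu p.2 < τ} ≃
      (Σ k : {k : ℕ | mu k < τ}, {j : ℕ | lam j < τ / mu (k : ℕ)}) :=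
    { toFun := fun p => ⟨⟨p.1.2, hkey p.1 p.2⟩, ⟨p.1.1, (lt_div_iff₀ (hmpos _)).2 p.2⟩⟩
      invFun := fun q => ⟨(q.2.1, q.1.1), (lt_div_iff₀ (hmpos _)).1 q.2.2⟩
      left_inv := fun p => rfl
      right_inv := fun q => rfl }
  have hcard : (Nat.card {p : ℕ × ℕ | lam p.1 * mu p.2 < τ} : ℝ) =
      ∑ k : {k : ℕ | mu k < τ}, (Nat.card {j : ℕ | lam j < τ / mu (k : ℕ)} : ℝ) := by
    rw [Nat.card_congr e, Nat.card_sigma]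
    push_cast
    rfl
  have hτ0 : 0 ≤ τ := by linarith
  rw [hcard, tsum_fintype, tsum_fintype, Finset.mul_sum, Finset.mul_sum,
    ← Finset.sum_sub_distrib]
  refine (Finset.abs_sum_le_sum_abs _ _).trans (Finset.sum_le_sum fun k _ => ?_)
  have h := hweyl (τ / mu (k : ℕ)) ((one_lt_div (hmpos _)).2 k.2)
  have hd : ∀ a : ℝ, (τ / mu (k : ℕ)) ^ a = τ ^ a * mu (k : ℕ) ^ (-a) := by
    intro a
    rw [Real.div_rpow hτ0 (hmpos _).le, Real.rpow_neg (hmpos _).le, div_eq_mul_inv]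
  rw [hd, hd, ← mul_assoc, ← mul_assoc] at h
  exact h
end

section
/- Let n₁, n₂ ≥ 1 be integers and m₁, m₂ > 0 reals with n₁/m₁ > n₂/m₂ and n₂/m₂ < (n₁−1)/m₁. Let (λ_j)_{j∈ℕ} satisfy a sharp Weyl law with dimension n₁, order m₁ and leading constant C₁ > 0, and let (μ_k)_{k∈ℕ} have Weyl counting data (n₂, m₂) with μ_k > 1 for all k. Then the series Z = Σ_{k∈ℕ} μ_k^{−n₁/m₁} converges, and N(τ) = #{(j,k) ∈ ℕ² : λ_j·μ_k < τ} satisfies N(τ) = (C₁/n₁)·Z·τ^{n₁/m₁} + O(τ^{(n₁−1)/m₁}) as τ → +∞. -/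
open Filter Topology Asymptotics

/-- A sequence `μ` has Weyl counting data `(n, m)` if `μ k ≥ 1` for every `k` and there is
`K > 0` such that for every `λ ≥ 1` the set of indices `k` with `λ ≤ μ k ^ (1/m) ≤ λ + 1`
is finite, with at most `K * λ ^ (n - 1)` elements. -/
def WeylData (n : ℕ) (m : ℝ) (μ : ℕ → ℝ) : Prop :=
  (∀ k, 1 ≤ μ k) ∧
  ∃ K : ℝ, 0 < K ∧ ∀ lam : ℝ, 1 ≤ lam →
    {k : ℕ | lam ≤ μ k ^ (1 / m) ∧ μ k ^ (1 / m) ≤ lam + 1}.Finite ∧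
    (Nat.card {k : ℕ | lam ≤ μ k ^ (1 / m) ∧ μ k ^ (1 / m) ≤ lam + 1} : ℝ) ≤
      K * lam ^ ((n : ℝ) - 1)

/-- A sequence `lam` satisfies a sharp Weyl law with dimension `n`, order `m` and leading
constant `C` if `lam j > 1` for all `j`, the counting function is finite, and
`|N(τ) - (C/n) τ^(n/m)| ≤ κ τ^((n-1)/m)` for all `τ > 1`, for some `κ > 0`. -/
def SharpWeyl (n : ℕ) (m C : ℝ) (lam : ℕ → ℝ) : Prop :=
  (∀ j, 1 < lam j) ∧ (∀ τ : ℝ, {j : ℕ | lam j < τ}.Finite) ∧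
  ∃ κ : ℝ, 0 < κ ∧ ∀ τ : ℝ, 1 < τ →
    |(Nat.card {j : ℕ | lam j < τ} : ℝ) - C / n * τ ^ ((n : ℝ) / m)| ≤
      κ * τ ^ (((n : ℝ) - 1) / m)

lemma weyl_summable (n : ℕ) (m r : ℝ) (mu : ℕ → ℝ) (hm : 0 < m)
    (hr : (n : ℝ) / m < r) (hmu : WeylData n m mu) :
    Summable (fun k : ℕ => mu k ^ (-r)) := by
  obtain ⟨h1, K, hK, hW⟩ := hmu
  have hr0 : 0 < r := lt_of_le_of_lt (by positivity) hr
  have hmr : (n : ℝ) < r * m := by rwa [div_lt_iff₀ hm] at hr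
  have hS : Summable (fun l : ℕ => K * (l : ℝ) ^ ((n : ℝ) - 1 - r * m)) := by
    apply Summable.mul_left
    exact Real.summable_nat_rpow.2 (by linarith)
  have hnn : ∀ l : ℕ, 0 ≤ K * (l : ℝ) ^ ((n : ℝ) - 1 - r * m) := fun l => by positivity
  have hx : ∀ k, 1 ≤ mu k ^ (1 / m) := fun k => Real.one_le_rpow (h1 k) (by positivity)
  set f : ℕ → ℕ := fun k => ⌊mu k ^ (1 / m)⌋₊ with hf
  have hf1 : ∀ k, 1 ≤ f k := fun k => by
    rw [hf]; exact Nat.one_le_floor_iff _ |>.2 (hx k)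
  have hle : ∀ k, (f k : ℝ) ≤ mu k ^ (1 / m) := fun k =>
    Nat.floor_le (by linarith [hx k])
  have hlt : ∀ k, mu k ^ (1 / m) ≤ (f k : ℝ) + 1 := fun k => (Nat.lt_floor_add_one _).le
  have hterm : ∀ k, mu k ^ (-r) ≤ (f k : ℝ) ^ (-(r * m)) := fun k => by
    have hpos : (0 : ℝ) < mu k := by linarith [h1 k]
    have e : mu k ^ (-r) = (mu k ^ (1 / m)) ^ (-(r * m)) := by
      rw [← Real.rpow_mul hpos.le]
      congr 1
      field_simp
    rw [e]
    apply Real.rpow_le_rpow_of_nonpos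
    · exact_mod_cast hf1 k
    · exact hle k
    · have : 0 < r * m := by positivity
      linarith
  refine summable_of_sum_le (c := ∑' l : ℕ, K * (l : ℝ) ^ ((n : ℝ) - 1 - r * m))
    (fun k => Real.rpow_nonneg (by linarith [h1 k]) _) (fun u => ?_)
  rw [← Finset.sum_fiberwise_of_maps_to (s := u) (t := u.image f) (g := f)
    (fun k hk => Finset.mem_image_of_mem f hk)]
  refine le_trans (Finset.sum_le_sum (fun l hl => ?_)) (hS.sum_le_tsum (u.image f) (fun l _ => hnn l))
  obtain ⟨k0, -, rfl⟩ := Finset.mem_image.1 hl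
  set l := f k0 with hldef
  have hl1 : (1 : ℝ) ≤ (l : ℝ) := by exact_mod_cast hf1 k0
  obtain ⟨hfin, hcard⟩ := hW l hl1
  have hc : (((u.filter (fun k => f k = l)).card : ℕ) : ℝ) ≤ K * (l : ℝ) ^ ((n : ℝ) - 1) := by
    refine le_trans ?_ hcard
    rw [Nat.card_coe_set_eq, ← Set.ncard_coe_finset]
    refine Nat.cast_le.2 (Set.ncard_le_ncard (fun k hk => ?_) hfin)
    simp only [Finset.coe_filter, Set.mem_ofPred_eq] at hk
    have a := hle k
    have b := hlt k
    rw [hk.2] at a b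
    exact ⟨a, b⟩
  calc ∑ k ∈ u.filter (fun k => f k = l), mu k ^ (-r)
      ≤ ∑ k ∈ u.filter (fun k => f k = l), (l : ℝ) ^ (-(r * m)) := by
        refine Finset.sum_le_sum (fun k hk => ?_)
        have := hterm k
        rwa [(Finset.mem_filter.1 hk).2] at this
    _ = ((u.filter (fun k => f k = l)).card : ℝ) * (l : ℝ) ^ (-(r * m)) := by
        rw [Finset.sum_const, nsmul_eq_mul]
    _ ≤ K * (l : ℝ) ^ ((n : ℝ) - 1) * (l : ℝ) ^ (-(r * m)) := by
        gcongr
    _ = K * (l : ℝ) ^ ((n : ℝ) - 1 - r * m) := by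
        rw [mul_assoc, ← Real.rpow_add (by linarith)]
        rfl

lemma card_hasSum (lam mu : ℕ → ℝ) (τ : ℝ) (h1 : ∀ j, 1 < lam j) (hmu1 : ∀ k, 1 < mu k)
    (hfl : ∀ τ : ℝ, {j : ℕ | lam j < τ}.Finite) (hfm : {k : ℕ | mu k < τ}.Finite) :
    HasSum (fun k => (Nat.card {j : ℕ | lam j < τ / mu k} : ℝ))
      (Nat.card {p : ℕ × ℕ | lam p.1 * mu p.2 < τ} : ℝ) := by
  classical
  have hpos : ∀ k, 0 < mu k := fun k => by linarith [hmu1 k]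
  have hfin : {p : ℕ × ℕ | lam p.1 * mu p.2 < τ}.Finite := by
    refine ((hfl τ).prod hfm).subset (fun p hp => ?_)
    simp only [Set.mem_ofPred_eq] at hp
    have a := h1 p.1
    have b := hmu1 p.2
    constructor
    · show lam p.1 < τ
      nlinarith
    · show mu p.2 < τ
      nlinarith
  have key : (Nat.card {p : ℕ × ℕ | lam p.1 * mu p.2 < τ} : ℝ) =
      ∑ k ∈ hfm.toFinset, (Nat.card {j : ℕ | lam j < τ / mu k} : ℝ) := by
    rw [Nat.card_coe_set_eq, Set.ncard_eq_toFinset_card _ hfin,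
      Finset.card_eq_sum_card_fiberwise (f := Prod.snd) (t := hfm.toFinset)]
    · push_cast
      refine Finset.sum_congr rfl (fun k _ => ?_)
      congr 1
      rw [Nat.card_coe_set_eq, Set.ncard_eq_toFinset_card _ (hfl _)]
      refine Finset.card_bij' (fun p _ => p.1) (fun j _ => (j, k)) ?_ ?_ ?_ ?_
      · rintro ⟨a, b⟩ hp
        simp only [Finset.mem_filter, Set.Finite.mem_toFinset, Set.mem_ofPred_eq] at hp ⊢
        obtain ⟨hp, rfl⟩ := hp
        rwa [lt_div_iff₀ (hpos _)]
      · intro j hj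
        simp only [Finset.mem_filter, Set.Finite.mem_toFinset, Set.mem_ofPred_eq] at hj ⊢
        rw [lt_div_iff₀ (hpos _)] at hj
        exact ⟨hj, trivial⟩
      · rintro ⟨a, b⟩ hp
        simp only [Finset.mem_filter] at hp
        simp [hp.2]
      · intro j hj
        rfl
    · intro p hp
      simp only [Set.Finite.coe_toFinset, Set.mem_ofPred_eq] at hp ⊢
      have a := h1 p.1
      have b := hmu1 p.2
      nlinarith
  rw [key]
  refine hasSum_sum_of_ne_finset_zero (fun k hk => ?_)
  simp only [Set.Finite.mem_toFinset, Set.mem_ofPred_eq, not_lt] at hk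
  have : {j : ℕ | lam j < τ / mu k} = ∅ := by
    ext j
    simp only [Set.mem_ofPred_eq, Set.mem_empty_iff_false, iff_false, not_lt]
    have : τ / mu k ≤ 1 := (div_le_one (hpos k)).2 hk
    linarith [h1 j]
  rw [this]
  simp


theorem tensor_weyl_case_one (n₁ n₂ : ℕ) (m₁ m₂ C₁ : ℝ) (lam mu : ℕ → ℝ)
    (hn₁ : 1 ≤ n₁) (hn₂ : 1 ≤ n₂) (hm₁ : 0 < m₁) (hm₂ : 0 < m₂) (hC₁ : 0 < C₁)
    (hord : (n₂ : ℝ) / m₂ < (n₁ : ℝ) / m₁)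
    (hcase : (n₂ : ℝ) / m₂ < ((n₁ : ℝ) - 1) / m₁)
    (hlam : SharpWeyl n₁ m₁ C₁ lam)
    (hmu : WeylData n₂ m₂ mu) (hmu1 : ∀ k, 1 < mu k) :
    Summable (fun k : ℕ => mu k ^ (-((n₁ : ℝ) / m₁))) ∧
    (fun τ : ℝ => (Nat.card {p : ℕ × ℕ | lam p.1 * mu p.2 < τ} : ℝ) -
        C₁ / n₁ * (∑' k : ℕ, mu k ^ (-((n₁ : ℝ) / m₁))) * τ ^ ((n₁ : ℝ) / m₁)) =O[atTop]
      (fun τ : ℝ => τ ^ (((n₁ : ℝ) - 1) / m₁)) := by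
  obtain ⟨hl1, hfl, κ, hκ, hW⟩ := hlam
  have hsumR := weyl_summable n₂ m₂ _ mu hm₂ hcase hmu
  have hsumS := weyl_summable n₂ m₂ _ mu hm₂ hord hmu
  refine ⟨hsumS, ?_⟩
  have hn : (0 : ℝ) < n₁ := by exact_mod_cast hn₁
  have hr0 : 0 < ((n₁ : ℝ) - 1) / m₁ := lt_of_le_of_lt (by positivity) hcase
  have hrs : ((n₁ : ℝ) - 1) / m₁ ≤ (n₁ : ℝ) / m₁ := by gcongr; linarith
  set r := ((n₁ : ℝ) - 1) / m₁ with hr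
  set s := (n₁ : ℝ) / m₁ with hs
  have hpos : ∀ k, 0 < mu k := fun k => by linarith [hmu1 k]
  have hfm : ∀ τ : ℝ, 0 < τ → {k : ℕ | mu k < τ}.Finite := fun τ hτ => by
    have h := hsumR.tendsto_cofinite_zero.eventually
      (gt_mem_nhds (show (0 : ℝ) < τ ^ (-r) by positivity))
    rw [Filter.eventually_cofinite] at h
    refine h.subset (fun k hk => ?_)
    simp only [Set.mem_ofPred_eq, not_lt] at hk ⊢
    exact Real.rpow_le_rpow_of_nonpos (hpos k) hk.le (by linarith)
  have hD : 0 < C₁ / n₁ := by positivity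
  have hterm : ∀ x : ℝ, 0 < x → |(Nat.card {j : ℕ | lam j < x} : ℝ) - C₁ / n₁ * x ^ s| ≤
      (κ + C₁ / n₁) * x ^ r := fun x hx => by
    have hxr : 0 < x ^ r := by positivity
    rcases lt_or_ge 1 x with h | h
    · refine (hW x h).trans ?_
      nlinarith
    · have he : {j : ℕ | lam j < x} = ∅ := by
        ext j
        simp only [Set.mem_ofPred_eq, Set.mem_empty_iff_false, iff_false, not_lt]
        linarith [hl1 j]
      rw [he]
      have h2 : x ^ s ≤ x ^ r := Real.rpow_le_rpow_of_exponent_ge hx h hrs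
      have h3 : 0 < x ^ s := by positivity
      simp only [Nat.card_of_isEmpty, Nat.cast_zero, zero_sub, abs_neg]
      rw [abs_of_pos (by positivity)]
      nlinarith
  refine IsBigO.of_bound ((κ + C₁ / n₁) * ∑' k : ℕ, mu k ^ (-r)) ?_
  filter_upwards [eventually_gt_atTop (1 : ℝ)] with τ hτ
  have hτ0 : 0 < τ := by linarith
  have hsplit : ∀ (a : ℝ) (k : ℕ), (τ / mu k) ^ a = mu k ^ (-a) * τ ^ a := fun a k => by
    rw [Real.div_rpow hτ0.le (hpos k).le, Real.rpow_neg (hpos k).le]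
    field_simp
  have hA := card_hasSum lam mu τ hl1 hmu1 hfl (hfm τ hτ0)
  have hB : HasSum (fun k => C₁ / n₁ * (τ / mu k) ^ s)
      (C₁ / n₁ * (∑' k : ℕ, mu k ^ (-s)) * τ ^ s) := by
    simp only [hsplit, mul_assoc]
    exact (hsumS.hasSum.mul_right _).mul_left _
  have hE : HasSum (fun k => (κ + C₁ / n₁) * (τ / mu k) ^ r)
      ((κ + C₁ / n₁) * (∑' k : ℕ, mu k ^ (-r)) * τ ^ r) := by
    simp only [hsplit, mul_assoc]
    exact (hsumR.hasSum.mul_right _).mul_left _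
  have hAB := hA.sub hB
  rw [Real.norm_eq_abs, Real.norm_eq_abs, abs_of_pos (show 0 < τ ^ r by positivity),
    ← hAB.tsum_eq, ← Real.norm_eq_abs]
  exact tsum_of_norm_bounded hE (fun k => by
    rw [Real.norm_eq_abs]
    exact hterm _ (div_pos hτ0 (hpos k)))
end

section
/- Let n₁, n₂ ≥ 1 be integers and m₁, m₂ > 0 reals with n₁/m₁ > n₂/m₂ and n₂/m₂ = (n₁−1)/m₁. Let (λ_j)_{j∈ℕ} satisfy a sharp Weyl law with dimension n₁, order m₁ and leading constant C₁ > 0, and let (μ_k)_{k∈ℕ} have Weyl counting data (n₂, m₂) with μ_k > 1 for all k. Then the series Z = Σ_{k∈ℕ} μ_k^{−n₁/m₁} converges, and N(τ) = #{(j,k) ∈ ℕ² : λ_j·μ_k < τ} satisfies N(τ) = (C₁/n₁)·Z·τ^{n₁/m₁} + O(τ^{(n₁−1)/m₁}·log τ) as τ → +∞. -/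
open Filter Topology Asymptotics

lemma tw_sum_le {n : ℕ} {m : ℝ} {mu : ℕ → ℝ} {K : ℝ} (hm : 0 < m) (h1 : ∀ k, 1 ≤ mu k)
    (hK : ∀ lam : ℝ, 1 ≤ lam →
    {k : ℕ | lam ≤ mu k ^ (1 / m) ∧ mu k ^ (1 / m) ≤ lam + 1}.Finite ∧
    (Nat.card {k : ℕ | lam ≤ mu k ^ (1 / m) ∧ mu k ^ (1 / m) ≤ lam + 1} : ℝ) ≤
      K * lam ^ ((n : ℝ) - 1)) (s : ℝ) (hs : 0 ≤ s) (F : Finset ℕ) (T M : ℕ) (hT : 1 ≤ T)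
    (hF : ∀ k ∈ F, (T : ℝ) ≤ mu k ^ (1 / m) ∧ mu k ^ (1 / m) < M + 1) :
    ∑ k ∈ F, mu k ^ (-(s / m)) ≤ K * ∑ i ∈ Finset.Icc T M, (i : ℝ) ^ ((n : ℝ) - 1 - s) := by
  have hmaps : ∀ k ∈ F, ⌊mu k ^ (1 / m)⌋₊ ∈ Finset.Icc T M := by
    intro k hk
    obtain ⟨h2, h3⟩ := hF k hk
    rw [Finset.mem_Icc]
    refine ⟨Nat.le_floor h2, ?_⟩
    rw [← Nat.lt_succ_iff, Nat.floor_lt (by have := h1 k; positivity)]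
    push_cast; exact h3
  rw [← Finset.sum_fiberwise_of_maps_to hmaps, Finset.mul_sum]
  apply Finset.sum_le_sum
  intro i hi
  have hi1 : 1 ≤ i := hT.trans (Finset.mem_Icc.1 hi).1
  have hi1' : (1 : ℝ) ≤ i := by exact_mod_cast hi1
  have hi0 : (0 : ℝ) < i := by linarith
  obtain ⟨hfin, hcard⟩ := hK i hi1'
  have hsub : ∀ k ∈ F.filter (fun k => ⌊mu k ^ (1 / m)⌋₊ = i),
      (i : ℝ) ≤ mu k ^ (1 / m) ∧ mu k ^ (1 / m) ≤ i + 1 := by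
    intro k hk
    have h2 := (Finset.mem_filter.1 hk).2
    have h0 : 0 ≤ mu k ^ (1 / m) := by have := h1 k; positivity
    have := (Nat.floor_eq_iff h0).1 h2
    exact ⟨this.1, this.2.le⟩
  have hterm : ∀ k ∈ F.filter (fun k => ⌊mu k ^ (1 / m)⌋₊ = i),
      mu k ^ (-(s / m)) ≤ (i : ℝ) ^ (-s) := by
    intro k hk
    have h2 := (hsub k hk).1
    have h0 : 0 ≤ mu k := by have := h1 k; linarith
    have : mu k ^ (-(s / m)) = (mu k ^ (1 / m)) ^ (-s) := by
      rw [← Real.rpow_mul h0]; congr 1; ring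
    rw [this]
    exact Real.rpow_le_rpow_of_nonpos hi0 h2 (by linarith)
  have hc : ((F.filter (fun k => ⌊mu k ^ (1 / m)⌋₊ = i)).card : ℝ) ≤ K * (i : ℝ) ^ ((n : ℝ) - 1) := by
    refine le_trans ?_ hcard
    rw [Nat.card_coe_set_eq]
    rw [← Set.ncard_coe_finset]
    exact_mod_cast Set.ncard_le_ncard (fun k hk => hsub k hk) hfin
  calc _ ≤ _ := Finset.sum_le_card_nsmul _ _ _ hterm
    _ = ((F.filter (fun k => ⌊mu k ^ (1 / m)⌋₊ = i)).card : ℝ) * (i : ℝ) ^ (-s) := by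
      rw [nsmul_eq_mul]
    _ ≤ K * (i : ℝ) ^ ((n : ℝ) - 1) * (i : ℝ) ^ (-s) := by gcongr
    _ = _ := by rw [mul_assoc, ← Real.rpow_add hi0]; rfl

lemma tw_tail (p : ℝ) (hp : 1 < p) (T M : ℕ) (hT : 1 ≤ T) :
    ∑ i ∈ Finset.Icc T M, (i : ℝ) ^ (-p) ≤ (1 + 1 / (p - 1)) * (T : ℝ) ^ (1 - p) := by
  have hT' : (1 : ℝ) ≤ T := by exact_mod_cast hT
  have hT0 : (0 : ℝ) < T := by linarith
  have hp1 : 0 < p - 1 := by linarith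
  rcases lt_or_ge M T with h | h
  · rw [Finset.Icc_eq_empty (by omega)]; simp; positivity
  have hanti : AntitoneOn (fun x : ℝ => x ^ (-p)) (Set.Icc (T : ℝ) M) := by
    intro x hx y hy hxy
    exact Real.rpow_le_rpow_of_nonpos (lt_of_lt_of_le hT0 hx.1) hxy (by linarith)
  have h1 := hanti.sum_le_integral_Ico h
  have hM : (T : ℝ) ≤ M := by exact_mod_cast h
  have hint : ∫ x in (T : ℝ)..M, x ^ (-p) = ((M : ℝ) ^ (-p + 1) - (T : ℝ) ^ (-p + 1)) / (-p + 1) := by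
    apply integral_rpow
    right
    refine ⟨by linarith, ?_⟩
    rw [Set.uIcc_of_le hM]
    intro h; have := h.1; linarith
  rw [hint] at h1
  have h2 : ((M : ℝ) ^ (-p + 1) - (T : ℝ) ^ (-p + 1)) / (-p + 1) ≤ 1 / (p - 1) * (T : ℝ) ^ (1 - p) := by
    have e : -p + 1 = -(p - 1) := by ring
    have e2 : 1 - p = -(p - 1) := by ring
    rw [e, e2, div_neg, ← neg_div, div_le_iff₀ hp1]
    have : 0 ≤ (M : ℝ) ^ (-(p-1)) := by positivity
    field_simp
    linarith
  have h3 : ∑ i ∈ Finset.Icc T M, (i : ℝ) ^ (-p)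
      = (T : ℝ) ^ (-p) + ∑ i ∈ Finset.Ico T M, ((i + 1 : ℕ) : ℝ) ^ (-p) := by
    rw [← Finset.add_sum_Ioc_eq_sum_Icc h]
    congr 1
    rw [Finset.sum_Ico_add' (fun i : ℕ => (i : ℝ) ^ (-p)) T M 1]
    apply Finset.sum_congr _ (fun _ _ => rfl)
    ext i
    simp only [Finset.mem_Ioc, Finset.mem_Ico]
    omega
  have h4 : (T : ℝ) ^ (-p) ≤ (T : ℝ) ^ (1 - p) :=
    Real.rpow_le_rpow_of_exponent_le hT' (by linarith)
  rw [h3]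
  linarith

lemma tw_card (lam mu : ℕ → ℝ) (h1 : ∀ j, 1 < lam j) (h2 : ∀ k, 1 < mu k)
    (hfin : ∀ τ : ℝ, {j : ℕ | lam j < τ}.Finite) (τ : ℝ) (F : Finset ℕ)
    (hF : ∀ k, k ∈ F ↔ mu k < τ) :
    Nat.card {p : ℕ × ℕ | lam p.1 * mu p.2 < τ} =
      ∑ k ∈ F, Nat.card {j : ℕ | lam j < τ / mu k} := by
  have key : ∀ j k, lam j < τ / mu k ↔ lam j * mu k < τ := fun j k =>
    lt_div_iff₀ (by have := h2 k; linarith)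
  have e : {p : ℕ × ℕ | lam p.1 * mu p.2 < τ} ≃ Σ k : F, {j : ℕ | lam j < τ / mu k} :=
    { toFun := fun p => ⟨⟨p.1.2, (hF _).2 (by
        have h := p.2
        simp only [Set.mem_setOf_eq] at h
        nlinarith [h1 p.1.1, h2 p.1.2])⟩, ⟨p.1.1, (key _ _).2 p.2⟩⟩
      invFun := fun q => ⟨(q.2.1, q.1.1), (key _ _).1 q.2.2⟩
      left_inv := fun p => rfl
      right_inv := fun q => rfl }
  rw [Nat.card_congr e]
  haveI : ∀ k : F, Finite {j : ℕ | lam j < τ / mu k} := fun k => hfin _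
  rw [Nat.card_sigma]
  exact Finset.sum_coe_sort F (fun k => Nat.card {j : ℕ | lam j < τ / mu k})

theorem tensor_weyl_case_two (n₁ n₂ : ℕ) (m₁ m₂ C₁ : ℝ) (lam mu : ℕ → ℝ)
    (hn₁ : 1 ≤ n₁) (hn₂ : 1 ≤ n₂) (hm₁ : 0 < m₁) (hm₂ : 0 < m₂) (hC₁ : 0 < C₁)
    (hord : (n₂ : ℝ) / m₂ < (n₁ : ℝ) / m₁)
    (hcase : (n₂ : ℝ) / m₂ = ((n₁ : ℝ) - 1) / m₁)
    (hlam : SharpWeyl n₁ m₁ C₁ lam)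
    (hmu : WeylData n₂ m₂ mu) (hmu1 : ∀ k, 1 < mu k) :
    Summable (fun k : ℕ => mu k ^ (-((n₁ : ℝ) / m₁))) ∧
    (fun τ : ℝ => (Nat.card {p : ℕ × ℕ | lam p.1 * mu p.2 < τ} : ℝ) -
        C₁ / n₁ * (∑' k : ℕ, mu k ^ (-((n₁ : ℝ) / m₁))) * τ ^ ((n₁ : ℝ) / m₁)) =O[atTop]
      (fun τ : ℝ => τ ^ (((n₁ : ℝ) - 1) / m₁) * Real.log τ) := by
  obtain ⟨hl1, hlfin, κ, hκ, hW⟩ := hlam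
  obtain ⟨hmu0, K, hK, hKb⟩ := hmu
  set a : ℝ := (n₁ : ℝ) / m₁ with ha
  set b : ℝ := ((n₁ : ℝ) - 1) / m₁ with hb
  have hn₂' : (1 : ℝ) ≤ n₂ := by exact_mod_cast hn₂
  have hn₁' : (1 : ℝ) ≤ n₁ := by exact_mod_cast hn₁
  have hbpos : 0 < b := by rw [← hcase]; positivity
  have hba : b < a := by rw [← hcase]; exact hord
  have hapos : 0 < a := hbpos.trans hba
  have hn₂b : (n₂ : ℝ) = b * m₂ := by rw [← hcase]; field_simp
  have ham : a * m₂ / m₂ = a := by field_simp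
  have hbm : b * m₂ / m₂ = b := by field_simp
  have hmpos : ∀ k, 0 < mu k := fun k => by linarith [hmu1 k]
  set p : ℝ := 1 + (a - b) * m₂ with hp
  have hp1 : 1 < p := by
    have : 0 < (a - b) * m₂ := mul_pos (by linarith) hm₂
    linarith
  set D : ℝ := K * (1 + 1 / (p - 1)) with hD
  have hDpos : 0 < D := by
    have : 0 < p - 1 := by linarith
    positivity
  -- tail bound
  have tail : ∀ (T : ℕ), 1 ≤ T → ∀ G : Finset ℕ, (∀ k ∈ G, (T : ℝ) ≤ mu k ^ (1 / m₂)) →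
      ∑ k ∈ G, mu k ^ (-a) ≤ D * (T : ℝ) ^ (1 - p) := by
    intro T hT G hG
    obtain ⟨M, hM⟩ : ∃ M : ℕ, ∀ k ∈ G, ⌊mu k ^ (1 / m₂)⌋₊ ≤ M :=
      ⟨G.sup (fun k => ⌊mu k ^ (1 / m₂)⌋₊), fun k hk =>
        Finset.le_sup (f := fun k => ⌊mu k ^ (1 / m₂)⌋₊) hk⟩
    have h := tw_sum_le hm₂ hmu0 hKb (a * m₂) (by positivity) G T M hT (fun k hk =>
      ⟨hG k hk, lt_of_lt_of_le (Nat.lt_floor_add_one _) (by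
        have : ((⌊mu k ^ (1 / m₂)⌋₊ : ℕ) : ℝ) ≤ M := by exact_mod_cast hM k hk
        linarith)⟩)
    rw [ham] at h
    have e : (n₂ : ℝ) - 1 - a * m₂ = -p := by rw [hn₂b, hp]; ring
    rw [e] at h
    refine h.trans ?_
    rw [hD, mul_assoc]
    exact mul_le_mul_of_nonneg_left (tw_tail p hp1 T M hT) hK.le
  have hnn : ∀ k, 0 ≤ mu k ^ (-a) := fun k => (Real.rpow_pos_of_pos (hmpos k) _).le
  have hsum : Summable (fun k : ℕ => mu k ^ (-a)) := by
    apply summable_of_sum_le hnn (c := D * ((1 : ℕ) : ℝ) ^ (1 - p))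
    intro G
    apply tail 1 le_rfl
    intro k _
    push_cast
    exact Real.one_le_rpow (hmu0 k) (by positivity)
  refine ⟨hsum, ?_⟩
  set Z := ∑' k : ℕ, mu k ^ (-a) with hZ
  have hFfin : ∀ τ : ℝ, 1 < τ → {k : ℕ | mu k < τ}.Finite := by
    intro τ hτ
    have h := hsum.tendsto_cofinite_zero.eventually_lt_const
      (show (0 : ℝ) < τ ^ (-a) from Real.rpow_pos_of_pos (by linarith) _)
    rw [Filter.eventually_cofinite] at h
    refine h.subset ?_
    intro k hk
    simp only [Set.mem_setOf_eq, not_lt] at hk ⊢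
    exact Real.rpow_le_rpow_of_nonpos (hmpos k) hk.le (by linarith)
  set c : ℝ := C₁ / n₁ with hc
  have hcpos : 0 < c := by positivity
  set E : ℝ := D * 2 ^ (p - 1) with hE
  have hEpos : 0 < E := by positivity
  apply IsBigO.of_bound (κ * (K * (1 + 1 / m₂)) + c * E)
  filter_upwards [eventually_ge_atTop (Real.exp 1)] with τ hτ
  have hτ1 : 1 < τ := lt_of_lt_of_le (by simp) hτ
  have hτ0 : 0 < τ := by linarith
  have hlog : 1 ≤ Real.log τ := (Real.le_log_iff_exp_le hτ0).2 hτ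
  have hτb : 0 < τ ^ b := Real.rpow_pos_of_pos hτ0 _
  set F := (hFfin τ hτ1).toFinset with hFdef
  have hF : ∀ k, k ∈ F ↔ mu k < τ := by intro k; simp [hFdef]
  set x : ℝ := τ ^ (1 / m₂) with hx
  have hx1 : 1 ≤ x := Real.one_le_rpow hτ1.le (by positivity)
  have hx0 : 0 < x := by linarith
  -- tail
  have hT1 : 1 ≤ ⌊x⌋₊ := Nat.le_floor (by simpa using hx1)
  have hxp : (⌊x⌋₊ : ℝ) ^ (1 - p) ≤ 2 ^ (p - 1) * τ ^ (b - a) := by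
    have h2 : x / 2 ≤ (⌊x⌋₊ : ℝ) := by
      have h3 := Nat.lt_floor_add_one x
      have h4 : (1 : ℝ) ≤ (⌊x⌋₊ : ℝ) := by exact_mod_cast hT1
      linarith
    have h5 := Real.rpow_le_rpow_of_nonpos (show 0 < x / 2 by positivity) h2
      (show 1 - p ≤ 0 by linarith)
    refine h5.trans (le_of_eq ?_)
    rw [Real.div_rpow hx0.le (by norm_num), div_eq_inv_mul, ← Real.rpow_neg (by norm_num)]
    congr 1
    · congr 1; ring
    · rw [hx, ← Real.rpow_mul hτ0.le]; congr 1; rw [hp]; field_simp; ring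
  have hZle : Z ≤ ∑ k ∈ F, mu k ^ (-a) + E * τ ^ (b - a) := by
    apply Real.tsum_le_of_sum_le hnn
    intro G
    have h1 : ∑ k ∈ G \ F, mu k ^ (-a) ≤ E * τ ^ (b - a) := by
      refine (tail ⌊x⌋₊ hT1 (G \ F) ?_).trans ?_
      · intro k hk
        have h2 := (Finset.mem_sdiff.1 hk).2
        rw [hF, not_lt] at h2
        exact (Nat.floor_le hx0.le).trans (Real.rpow_le_rpow hτ0.le h2 (by positivity))
      · have h3 := mul_le_mul_of_nonneg_left hxp hDpos.le
        rw [← mul_assoc] at h3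
        exact h3
    calc ∑ k ∈ G, mu k ^ (-a) ≤ ∑ k ∈ F ∪ (G \ F), mu k ^ (-a) :=
          Finset.sum_le_sum_of_subset_of_nonneg (by intro k hk; simp [hk, em])
            (fun k _ _ => hnn k)
      _ = ∑ k ∈ F, mu k ^ (-a) + ∑ k ∈ G \ F, mu k ^ (-a) :=
          Finset.sum_union Finset.disjoint_sdiff
      _ ≤ _ := by linarith
  have hZge : ∑ k ∈ F, mu k ^ (-a) ≤ Z := hsum.sum_le_tsum F (fun k _ => hnn k)
  -- log sum
  have hlogsum : ∑ k ∈ F, mu k ^ (-b) ≤ K * (1 + 1 / m₂) * Real.log τ := by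
    have h := tw_sum_le hm₂ hmu0 hKb (b * m₂) (by positivity) F 1 ⌊x⌋₊ le_rfl (fun k hk =>
      ⟨by push_cast; exact Real.one_le_rpow (hmu0 k) (by positivity),
       lt_of_le_of_lt (Real.rpow_le_rpow (hmpos k).le ((hF k).1 hk).le (by positivity))
         (Nat.lt_floor_add_one x)⟩)
    rw [hbm] at h
    have e : (n₂ : ℝ) - 1 - b * m₂ = -1 := by rw [hn₂b]; ring
    rw [e] at h
    have hh : ∑ i ∈ Finset.Icc 1 ⌊x⌋₊, (i : ℝ) ^ (-1 : ℝ) ≤ 1 + Real.log x := by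
      refine le_trans (le_of_eq ?_) (harmonic_floor_le_one_add_log x hx1)
      rw [harmonic_eq_sum_Icc]
      push_cast
      apply Finset.sum_congr rfl
      intro i _
      rw [Real.rpow_neg_one]
    have hlx : Real.log x = 1 / m₂ * Real.log τ := by rw [hx, Real.log_rpow hτ0]
    refine h.trans ?_
    rw [mul_assoc]
    apply mul_le_mul_of_nonneg_left _ hK.le
    rw [hlx] at hh
    linarith
  -- main
  rw [tw_card lam mu hl1 hmu1 hlfin τ F hF]
  push_cast
  have hsplit : ∑ k ∈ F, (Nat.card {j : ℕ | lam j < τ / mu k} : ℝ) - c * Z * τ ^ a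
      = ∑ k ∈ F, ((Nat.card {j : ℕ | lam j < τ / mu k} : ℝ) - c * (τ / mu k) ^ a)
        - c * τ ^ a * (Z - ∑ k ∈ F, mu k ^ (-a)) := by
    have : ∀ k ∈ F, c * (τ / mu k) ^ a = c * τ ^ a * mu k ^ (-a) := by
      intro k _
      rw [Real.div_rpow hτ0.le (hmpos k).le, Real.rpow_neg (hmpos k).le]; ring
    rw [Finset.sum_sub_distrib, Finset.sum_congr rfl this, ← Finset.mul_sum]
    ring
  have hA : |∑ k ∈ F, ((Nat.card {j : ℕ | lam j < τ / mu k} : ℝ) - c * (τ / mu k) ^ a)|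
      ≤ κ * τ ^ b * (K * (1 + 1 / m₂) * Real.log τ) := by
    refine (Finset.abs_sum_le_sum_abs _ _).trans ?_
    calc _ ≤ ∑ k ∈ F, κ * τ ^ b * mu k ^ (-b) := by
          apply Finset.sum_le_sum
          intro k hk
          refine (hW (τ / mu k) ((one_lt_div (hmpos k)).2 ((hF k).1 hk))).trans (le_of_eq ?_)
          rw [Real.div_rpow hτ0.le (hmpos k).le, Real.rpow_neg (hmpos k).le]; ring
      _ = κ * τ ^ b * ∑ k ∈ F, mu k ^ (-b) := by rw [Finset.mul_sum]
      _ ≤ _ := mul_le_mul_of_nonneg_left hlogsum (by positivity)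
  have hB : |c * τ ^ a * (Z - ∑ k ∈ F, mu k ^ (-a))| ≤ c * E * τ ^ b := by
    rw [abs_of_nonneg (mul_nonneg (by positivity) (by linarith))]
    calc _ ≤ c * τ ^ a * (E * τ ^ (b - a)) :=
          mul_le_mul_of_nonneg_left (by linarith) (by positivity)
      _ = c * E * (τ ^ a * τ ^ (b - a)) := by ring
      _ = _ := by rw [← Real.rpow_add hτ0]; congr 2; ring
  rw [hsplit, Real.norm_eq_abs, Real.norm_eq_abs,
    abs_of_nonneg (show 0 ≤ τ ^ b * Real.log τ by positivity)]
  have hC : c * E * τ ^ b ≤ c * E * τ ^ b * Real.log τ :=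
    le_mul_of_one_le_right (by positivity) hlog
  have := abs_sub (∑ k ∈ F, ((Nat.card {j : ℕ | lam j < τ / mu k} : ℝ) - c * (τ / mu k) ^ a))
    (c * τ ^ a * (Z - ∑ k ∈ F, mu k ^ (-a)))
  nlinarith [this, hA, hB, hC]
end

section
/- Let n₁, n₂ ≥ 1 be integers and m₁, m₂ > 0 reals with n₁/m₁ > n₂/m₂ and n₂/m₂ > (n₁−1)/m₁. Let (λ_j)_{j∈ℕ} satisfy a sharp Weyl law with dimension n₁, order m₁ and leading constant C₁ > 0, and let (μ_k)_{k∈ℕ} have Weyl counting data (n₂, m₂) with μ_k > 1 for all k. Then the series Z = Σ_{k∈ℕ} μ_k^{−n₁/m₁} converges, and N(τ) = #{(j,k) ∈ ℕ² : λ_j·μ_k < τ} satisfies N(τ) = (C₁/n₁)·Z·τ^{n₁/m₁} + O(τ^{n₂/m₂}) as τ → +∞. -/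
open Filter Topology Asymptotics

lemma weyl_count (n : ℕ) (m : ℝ) (mu : ℕ → ℝ) (hn : 1 ≤ n) (hm : 0 < m)
    (hmu : WeylData n m mu) :
    ∃ D : ℝ, 0 < D ∧ ∀ t : ℝ, 0 < t → ∀ s : Finset ℕ, (∀ k ∈ s, mu k < t) →
      (s.card : ℝ) ≤ D * t ^ ((n : ℝ) / m) := by
  obtain ⟨h1, K, hK, h⟩ := hmu
  refine ⟨K, hK, fun t ht s hs => ?_⟩
  set T := t ^ (1 / m) with hT
  have hTpos : 0 < T := Real.rpow_pos_of_pos ht _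
  have hn' : (0 : ℝ) ≤ (n : ℝ) - 1 := by
    have : (1 : ℝ) ≤ n := by exact_mod_cast hn
    linarith
  have hlt : ∀ k ∈ s, mu k ^ (1 / m) ≤ T := fun k hk =>
    Real.rpow_le_rpow (by linarith [h1 k]) (hs k hk).le (by positivity)
  have hge : ∀ k, 1 ≤ mu k ^ (1 / m) := fun k =>
    Real.one_le_rpow (h1 k) (by positivity)
  have hmaps : ∀ k ∈ s, ⌊mu k ^ (1 / m)⌋₊ ∈ Finset.Icc 1 ⌊T⌋₊ := by
    intro k hk
    rw [Finset.mem_Icc]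
    exact ⟨by rw [Nat.one_le_floor_iff]; exact hge k, Nat.floor_le_floor (hlt k hk)⟩
  rw [Finset.card_eq_sum_card_fiberwise hmaps]
  push_cast
  have hb : ∀ i ∈ Finset.Icc 1 ⌊T⌋₊,
      (({a ∈ s | ⌊mu a ^ (1 / m)⌋₊ = i} : Finset ℕ).card : ℝ) ≤ K * T ^ ((n : ℝ) - 1) := by
    intro i hi
    rw [Finset.mem_Icc] at hi
    have hi1 : (1 : ℝ) ≤ i := by exact_mod_cast hi.1
    obtain ⟨hf, hc⟩ := h i hi1
    have hiT : (i : ℝ) ≤ T := le_trans (by exact_mod_cast hi.2) (Nat.floor_le hTpos.le)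
    have h2 : (({a ∈ s | ⌊mu a ^ (1 / m)⌋₊ = i} : Finset ℕ).card) ≤
        Nat.card {k : ℕ | (i : ℝ) ≤ mu k ^ (1 / m) ∧ mu k ^ (1 / m) ≤ i + 1} := by
      rw [Nat.card_coe_set_eq, ← Set.ncard_coe_finset]
      refine Set.ncard_le_ncard ?_ hf
      intro k hk
      simp only [Finset.coe_filter, Set.mem_setOf_eq] at hk ⊢
      have h0 : 0 ≤ mu k ^ (1 / m) := by linarith [hge k]
      have := hk.2
      rw [Nat.floor_eq_iff h0] at this
      exact ⟨this.1, this.2.le⟩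
    calc _ ≤ (Nat.card {k : ℕ | (i : ℝ) ≤ mu k ^ (1 / m) ∧ mu k ^ (1 / m) ≤ i + 1} : ℝ) := by
          exact_mod_cast h2
      _ ≤ _ := hc
      _ ≤ _ := by gcongr
  calc _ ≤ ∑ i ∈ Finset.Icc 1 ⌊T⌋₊, K * T ^ ((n : ℝ) - 1) := Finset.sum_le_sum hb
    _ = (⌊T⌋₊ : ℝ) * (K * T ^ ((n : ℝ) - 1)) := by simp
    _ ≤ T * (K * T ^ ((n : ℝ) - 1)) := by
      gcongr
      exact Nat.floor_le hTpos.le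
    _ = K * (T ^ ((n : ℝ) - 1) * T ^ (1 : ℝ)) := by rw [Real.rpow_one]; ring
    _ = K * T ^ (n : ℝ) := by rw [← Real.rpow_add hTpos]; ring_nf
    _ = K * t ^ ((n : ℝ) / m) := by
      rw [hT, ← Real.rpow_mul ht.le]; congr 2; ring

lemma low_sum (mu : ℕ → ℝ) (hmu1 : ∀ k, 1 < mu k) (D b c : ℝ) (hD : 0 < D) (hb : 0 ≤ b)
    (hbc : b < c)
    (hcount : ∀ t : ℝ, 0 < t → ∀ s : Finset ℕ, (∀ k ∈ s, mu k < t) →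
      (s.card : ℝ) ≤ D * t ^ c) :
    ∃ A : ℝ, 0 < A ∧ ∀ t : ℝ, 0 < t → ∀ s : Finset ℕ, (∀ k ∈ s, mu k < t) →
      ∑ k ∈ s, mu k ^ (-b) ≤ A * t ^ (c - b) := by
  set q : ℝ := (1 / 2 : ℝ) ^ (c - b) with hq
  have hq1 : q < 1 := Real.rpow_lt_one (by norm_num) (by norm_num) (by linarith)
  set E : ℝ := D * (1 / 2 : ℝ) ^ (-b) with hE
  have hEp : 0 < E := by positivity
  have h1q : 0 < 1 - q := by linarith
  set A := E / (1 - q) with hA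
  have hAp : 0 < A := by positivity
  have hAE : A * q + E = A := by
    rw [hA]; field_simp; ring
  refine ⟨A, hAp, ?_⟩
  have key : ∀ N : ℕ, ∀ t : ℝ, 0 < t → t ≤ 2 ^ N → ∀ s : Finset ℕ, (∀ k ∈ s, mu k < t) →
      ∑ k ∈ s, mu k ^ (-b) ≤ A * t ^ (c - b) := by
    intro N
    induction N with
    | zero =>
      intro t ht ht1 s hs
      have : s = ∅ := by
        rw [Finset.eq_empty_iff_forall_notMem]
        intro k hk
        have := hs k hk
        have := hmu1 k
        norm_num at ht1
        linarith
      subst this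
      simp only [Finset.sum_empty]
      positivity
    | succ N ih =>
      intro t ht htN s hs
      rw [← Finset.sum_filter_add_sum_filter_not s (fun k => mu k < t * (1 / 2))]
      have e1 := ih (t * (1 / 2)) (by positivity) (by rw [pow_succ] at htN; linarith)
        {k ∈ s | mu k < t * (1 / 2)} (by intro k hk; exact (Finset.mem_filter.1 hk).2)
      have e2 : ∑ k ∈ s with ¬ mu k < t * (1 / 2), mu k ^ (-b) ≤ E * t ^ (c - b) := by
        calc _ ≤ ∑ k ∈ s with ¬ mu k < t * (1 / 2), (t * (1 / 2)) ^ (-b) := by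
              refine Finset.sum_le_sum fun k hk => ?_
              have := (Finset.mem_filter.1 hk).2
              exact Real.rpow_le_rpow_of_nonpos (by positivity) (not_lt.1 this) (by linarith)
          _ = (({k ∈ s | ¬ mu k < t * (1 / 2)} : Finset ℕ).card : ℝ) * (t * (1 / 2)) ^ (-b) := by
              simp
          _ ≤ (D * t ^ c) * (t * (1 / 2)) ^ (-b) := by
              gcongr
              exact hcount t ht _ (fun k hk => hs k (Finset.mem_filter.1 hk).1)
          _ = E * t ^ (c - b) := by
              rw [Real.mul_rpow ht.le (by norm_num), sub_eq_add_neg, Real.rpow_add ht]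
              ring
      rw [Real.mul_rpow ht.le (by norm_num)] at e1
      calc _ ≤ A * (t ^ (c - b) * q) + E * t ^ (c - b) := add_le_add e1 e2
        _ = (A * q + E) * t ^ (c - b) := by ring
        _ = _ := by rw [hAE]
  intro t ht s hs
  obtain ⟨N, hN⟩ := pow_unbounded_of_one_lt t (by norm_num : (1 : ℝ) < 2)
  exact key N t ht hN.le s hs

lemma high_sum (mu : ℕ → ℝ) (D a c : ℝ) (hD : 0 < D) (ha : 0 ≤ a)
    (hca : c < a)
    (hcount : ∀ t : ℝ, 0 < t → ∀ s : Finset ℕ, (∀ k ∈ s, mu k < t) →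
      (s.card : ℝ) ≤ D * t ^ c) :
    ∃ B : ℝ, 0 < B ∧ ∀ t : ℝ, 0 < t → ∀ s : Finset ℕ, (∀ k ∈ s, t ≤ mu k) →
      ∑ k ∈ s, mu k ^ (-a) ≤ B * t ^ (c - a) := by
  set q : ℝ := (2 : ℝ) ^ (c - a) with hq
  have hq1 : q < 1 := Real.rpow_lt_one_of_one_lt_of_neg (by norm_num) (by linarith)
  set E : ℝ := D * (2 : ℝ) ^ c with hE
  have hEp : 0 < E := by positivity
  have h1q : 0 < 1 - q := by linarith
  set A := E / (1 - q) with hA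
  have hAp : 0 < A := by positivity
  have hAE : A * q + E = A := by
    rw [hA]; field_simp; ring
  refine ⟨A, hAp, ?_⟩
  have key : ∀ N : ℕ, ∀ t : ℝ, 0 < t → ∀ s : Finset ℕ,
      (∀ k ∈ s, t ≤ mu k) → (∀ k ∈ s, mu k < t * 2 ^ N) →
      ∑ k ∈ s, mu k ^ (-a) ≤ A * t ^ (c - a) := by
    intro N
    induction N with
    | zero =>
      intro t ht s hs hs2
      have : s = ∅ := by
        rw [Finset.eq_empty_iff_forall_notMem]
        intro k hk
        have := hs k hk
        have h2 := hs2 k hk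
        norm_num at h2
        linarith
      subst this
      simp only [Finset.sum_empty]
      positivity
    | succ N ih =>
      intro t ht s hs hs2
      rw [← Finset.sum_filter_not_add_sum_filter s (fun k => mu k < t * 2)]
      have e1 := ih (t * 2) (by positivity)
        {k ∈ s | ¬ mu k < t * 2} (by intro k hk; exact not_lt.1 (Finset.mem_filter.1 hk).2)
        (by
          intro k hk
          have := hs2 k (Finset.mem_filter.1 hk).1
          rw [pow_succ] at this
          linarith)
      have e2 : ∑ k ∈ s with mu k < t * 2, mu k ^ (-a) ≤ E * t ^ (c - a) := by
        calc _ ≤ ∑ k ∈ s with mu k < t * 2, t ^ (-a) := by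
              refine Finset.sum_le_sum fun k hk => ?_
              exact Real.rpow_le_rpow_of_nonpos ht (hs k (Finset.mem_filter.1 hk).1) (by linarith)
          _ = (({k ∈ s | mu k < t * 2} : Finset ℕ).card : ℝ) * t ^ (-a) := by
              simp
          _ ≤ (D * (t * 2) ^ c) * t ^ (-a) := by
              gcongr
              exact hcount (t * 2) (by positivity) _ (fun k hk => (Finset.mem_filter.1 hk).2)
          _ = E * t ^ (c - a) := by
              rw [Real.mul_rpow ht.le (by norm_num), sub_eq_add_neg, Real.rpow_add ht]
              ring
      rw [Real.mul_rpow ht.le (by norm_num)] at e1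
      calc _ ≤ A * (t ^ (c - a) * q) + E * t ^ (c - a) := add_le_add e1 e2
        _ = (A * q + E) * t ^ (c - a) := by ring
        _ = _ := by rw [hAE]
  intro t ht s hs
  obtain ⟨N, hN⟩ := pow_unbounded_of_one_lt ((∑ k ∈ s, |mu k|) / t) (by norm_num : (1 : ℝ) < 2)
  refine key N t ht s hs fun k hk => ?_
  rw [div_lt_iff₀ ht] at hN
  have := Finset.single_le_sum (f := fun k => |mu k|) (fun i _ => abs_nonneg _) hk
  have h3 := le_abs_self (mu k)
  linarith

lemma pair_count (lam mu : ℕ → ℝ) (hl : ∀ j, 1 < lam j) (hmu1 : ∀ k, 1 < mu k)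
    (hfin : ∀ τ : ℝ, {j : ℕ | lam j < τ}.Finite) (τ : ℝ) (S : Finset ℕ)
    (hS : ∀ k, k ∈ S ↔ mu k < τ) :
    Nat.card {p : ℕ × ℕ | lam p.1 * mu p.2 < τ} =
      ∑ k ∈ S, Nat.card {j : ℕ | lam j < τ / mu k} := by
  have hiff : ∀ j k, lam j * mu k < τ ↔ lam j < τ / mu k := fun j k => by
    rw [lt_div_iff₀ (by linarith [hmu1 k])]
  have hmem : ∀ j k, lam j * mu k < τ → k ∈ S := fun j k h => by
    rw [hS]
    nlinarith [hl j, hmu1 k]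
  let e : {p : ℕ × ℕ | lam p.1 * mu p.2 < τ} ≃
      (Σ k : S, {j : ℕ | lam j < τ / mu k}) :=
    { toFun := fun p => ⟨⟨p.1.2, hmem _ _ p.2⟩, ⟨p.1.1, (hiff _ _).1 p.2⟩⟩
      invFun := fun x => ⟨(x.2.1, x.1.1), (hiff _ _).2 x.2.2⟩
      left_inv := fun _ => rfl
      right_inv := fun _ => rfl }
  have : ∀ k : S, Finite {j : ℕ | lam j < τ / mu k} := fun k => (hfin _).to_subtype
  rw [Nat.card_congr e, Nat.card_sigma]
  exact Finset.sum_coe_sort S (fun k => Nat.card {j : ℕ | lam j < τ / mu k})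

theorem tensor_weyl_case_three (n₁ n₂ : ℕ) (m₁ m₂ C₁ : ℝ) (lam mu : ℕ → ℝ)
    (hn₁ : 1 ≤ n₁) (hn₂ : 1 ≤ n₂) (hm₁ : 0 < m₁) (hm₂ : 0 < m₂) (hC₁ : 0 < C₁)
    (hord : (n₂ : ℝ) / m₂ < (n₁ : ℝ) / m₁)
    (hcase : ((n₁ : ℝ) - 1) / m₁ < (n₂ : ℝ) / m₂)
    (hlam : SharpWeyl n₁ m₁ C₁ lam)
    (hmu : WeylData n₂ m₂ mu) (hmu1 : ∀ k, 1 < mu k) :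
    Summable (fun k : ℕ => mu k ^ (-((n₁ : ℝ) / m₁))) ∧
    (fun τ : ℝ => (Nat.card {p : ℕ × ℕ | lam p.1 * mu p.2 < τ} : ℝ) -
        C₁ / n₁ * (∑' k : ℕ, mu k ^ (-((n₁ : ℝ) / m₁))) * τ ^ ((n₁ : ℝ) / m₁)) =O[atTop]
      (fun τ : ℝ => τ ^ ((n₂ : ℝ) / m₂)) := by
  obtain ⟨hl, hfin, κ, hκ, hw⟩ := hlam
  obtain ⟨D, hD, hcount⟩ := weyl_count n₂ m₂ mu hn₂ hm₂ hmu
  set a := (n₁ : ℝ) / m₁ with ha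
  set b := ((n₁ : ℝ) - 1) / m₁ with hb
  set c := (n₂ : ℝ) / m₂ with hc
  have hn₁' : (1 : ℝ) ≤ n₁ := by exact_mod_cast hn₁
  have hb0 : 0 ≤ b := div_nonneg (by linarith) hm₁.le
  have ha0 : 0 ≤ a := by positivity
  obtain ⟨A, hA, hlow⟩ := low_sum mu hmu1 D b c hD hb0 hcase hcount
  obtain ⟨B, hB, hhigh⟩ := high_sum mu D a c hD ha0 hord hcount
  have hpos : ∀ k, 0 < mu k := fun k => by linarith [hmu1 k]
  have hsum : Summable (fun k : ℕ => mu k ^ (-a)) :=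
    summable_of_sum_le (c := B * 1 ^ (c - a)) (fun k => (Real.rpow_pos_of_pos (hpos k) _).le)
      (fun u => hhigh 1 one_pos u (fun k _ => (hmu1 k).le))
  refine ⟨hsum, ?_⟩
  have hmufin : ∀ τ : ℝ, 0 < τ → {k : ℕ | mu k < τ}.Finite := by
    intro τ hτ
    by_contra hinf
    obtain ⟨N, hN⟩ := exists_nat_gt (D * τ ^ c)
    obtain ⟨s, hs, hcard⟩ := Set.Infinite.exists_subset_card_eq hinf N
    have := hcount τ hτ s (fun k hk => hs hk)
    rw [hcard] at this
    linarith
  refine IsBigO.of_bound (κ * A + C₁ / n₁ * B) ?_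
  filter_upwards [eventually_gt_atTop 0] with τ hτ
  set S := (hmufin τ hτ).toFinset with hSdef
  have hS : ∀ k, k ∈ S ↔ mu k < τ := fun k => by simp [hSdef]
  rw [pair_count lam mu hl hmu1 hfin τ S hS]
  have hC : 0 < C₁ / n₁ := by positivity
  have htail : ∑' k : ((S : Set ℕ)ᶜ : Set ℕ), mu k ^ (-a) ≤ B * τ ^ (c - a) := by
    refine Real.tsum_le_of_sum_le (fun k => (Real.rpow_pos_of_pos (hpos k) _).le) fun u => ?_
    have := hhigh τ hτ (u.map (Function.Embedding.subtype _)) (by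
      intro k hk
      obtain ⟨x, hx, rfl⟩ := Finset.mem_map.1 hk
      have := x.2
      simp only [Set.mem_compl_iff, Finset.mem_coe, hS, not_lt] at this
      exact this)
    rw [Finset.sum_map] at this
    exact this
  have htail0 : 0 ≤ ∑' k : ((S : Set ℕ)ᶜ : Set ℕ), mu k ^ (-a) :=
    tsum_nonneg fun k => (Real.rpow_pos_of_pos (hpos k) _).le
  rw [← hsum.sum_add_tsum_compl (s := S)]
  have hx : τ ^ (c - a) * τ ^ a = τ ^ c := by
    rw [← Real.rpow_add hτ]; ring_nf
  have hy : τ ^ (c - b) * τ ^ b = τ ^ c := by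
    rw [← Real.rpow_add hτ]; ring_nf
  have hτa : 0 < τ ^ a := Real.rpow_pos_of_pos hτ _
  have hτb : 0 < τ ^ b := Real.rpow_pos_of_pos hτ _
  have hdiv : ∀ k (r : ℝ), (τ / mu k) ^ r = τ ^ r * mu k ^ (-r) := fun k r => by
    rw [Real.div_rpow hτ.le (hpos k).le, Real.rpow_neg (hpos k).le]; rfl
  have hmain : |∑ k ∈ S, ((Nat.card {j : ℕ | lam j < τ / mu k} : ℝ) -
      C₁ / n₁ * (τ / mu k) ^ a)| ≤ κ * A * τ ^ c := by
    calc _ ≤ ∑ k ∈ S, κ * (τ / mu k) ^ b := by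
          refine (Finset.abs_sum_le_sum_abs _ _).trans (Finset.sum_le_sum fun k hk => ?_)
          refine hw _ ?_
          rw [one_lt_div (hpos k)]
          exact (hS k).1 hk
      _ = κ * τ ^ b * ∑ k ∈ S, mu k ^ (-b) := by
          rw [Finset.mul_sum]
          exact Finset.sum_congr rfl fun k _ => by rw [hdiv]; ring
      _ ≤ κ * τ ^ b * (A * τ ^ (c - b)) := by
          gcongr
          exact hlow τ hτ S (fun k hk => (hS k).1 hk)
      _ = _ := by rw [← hy]; ring
  have hsplit : ∑ k ∈ S, ((Nat.card {j : ℕ | lam j < τ / mu k} : ℝ) -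
      C₁ / n₁ * (τ / mu k) ^ a) = ((∑ k ∈ S, Nat.card {j : ℕ | lam j < τ / mu k} : ℕ) : ℝ) -
      C₁ / n₁ * (∑ k ∈ S, mu k ^ (-a)) * τ ^ a := by
    rw [Finset.sum_sub_distrib, Nat.cast_sum, Finset.mul_sum, Finset.sum_mul]
    congr 1
    exact Finset.sum_congr rfl fun k _ => by rw [hdiv]; ring
  rw [hsplit] at hmain
  have ht2 : C₁ / n₁ * (∑' k : ((S : Set ℕ)ᶜ : Set ℕ), mu k ^ (-a)) * τ ^ a ≤
      C₁ / n₁ * B * τ ^ c := by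
    calc _ ≤ C₁ / n₁ * (B * τ ^ (c - a)) * τ ^ a := by gcongr
      _ = _ := by rw [← hx]; ring
  have ht3 : 0 ≤ C₁ / n₁ * (∑' k : ((S : Set ℕ)ᶜ : Set ℕ), mu k ^ (-a)) * τ ^ a := by
    positivity
  rw [Real.norm_eq_abs, Real.norm_eq_abs, abs_of_pos (Real.rpow_pos_of_pos hτ c)]
  rw [abs_le] at hmain ⊢
  constructor <;> linarith [hmain.1, hmain.2]
end

section
/- Let r ≥ 1 be an integer and, for j = 1,…,r, let n_j ≥ 1 be integers, m_j > 0 reals, and let (μ^j_k)_{k∈ℕ} be sequences having Weyl counting data (n_j, m_j) with μ^j_k > 1 for all k. Set p = max_{1≤j≤r} n_j/m_j and s = #{j : n_j/m_j = p}. Then F(τ) = Σ_{(k₁,…,k_r)∈ℕ^r : μ¹_{k₁}···μ^r_{k_r} < τ} (μ¹_{k₁}···μ^r_{k_r})^{−p} satisfies F(τ) = O((log τ)^s) as τ → +∞. -/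
open Filter Topology Asymptotics

lemma weyl_single {n : ℕ} {m p : ℝ} {μ : ℕ → ℝ} (hm : 0 < m) (h : WeylData n m μ)
    (hp0 : 0 ≤ p) :
    ∃ K : ℝ, 0 < K ∧ ∀ τ : ℝ, {k | μ k < τ}.Finite ∧
      ∀ S : Finset ℕ, (∀ k ∈ S, μ k < τ) →
        ∑ k ∈ S, μ k ^ (-p) ≤
          K * ∑ a ∈ Finset.Icc 1 ⌊τ ^ (1 / m)⌋₊, (a : ℝ) ^ ((n : ℝ) - 1 - m * p) := by
  obtain ⟨h1, K, hK, hc⟩ := h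
  refine ⟨K, hK, fun τ => ?_⟩
  have hpos : ∀ k, 0 < μ k := fun k => lt_of_lt_of_le one_pos (h1 k)
  have hroot : ∀ k, 1 ≤ μ k ^ (1 / m) := fun k =>
    Real.one_le_rpow (h1 k) (by positivity)
  have hfl : ∀ k, 1 ≤ ⌊μ k ^ (1 / m)⌋₊ := fun k => by
    rw [Nat.one_le_floor_iff]; exact hroot k
  have hflle : ∀ k, (⌊μ k ^ (1 / m)⌋₊ : ℝ) ≤ μ k ^ (1 / m) := fun k =>
    Nat.floor_le (by linarith [hroot k])
  have hmaps : ∀ k, μ k < τ →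
      ⌊μ k ^ (1 / m)⌋₊ ∈ Finset.Icc 1 ⌊τ ^ (1 / m)⌋₊ := fun k hk => by
    rw [Finset.mem_Icc]
    exact ⟨hfl k, Nat.floor_mono
      (Real.rpow_le_rpow (hpos k).le hk.le (by positivity))⟩
  have hfib : ∀ k a, ⌊μ k ^ (1 / m)⌋₊ = a →
      (a : ℝ) ≤ μ k ^ (1 / m) ∧ μ k ^ (1 / m) ≤ (a : ℝ) + 1 := by
    rintro k a rfl
    exact ⟨hflle k, (Nat.lt_floor_add_one _).le⟩
  constructor
  · refine Set.Finite.subset (Set.Finite.biUnion (Finset.Icc 1 ⌊τ ^ (1 / m)⌋₊).finite_toSet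
      (t := fun a => {k : ℕ | (a : ℝ) ≤ μ k ^ (1 / m) ∧ μ k ^ (1 / m) ≤ (a : ℝ) + 1}) ?_) ?_
    · intro a ha
      have : 1 ≤ a := (Finset.mem_Icc.1 (Finset.mem_coe.1 ha)).1
      exact (hc a (by exact_mod_cast this)).1
    · intro k hk
      exact Set.mem_biUnion (Finset.mem_coe.2 (hmaps k hk)) (hfib k _ rfl)
  · intro S hS
    rw [← Finset.sum_fiberwise_of_maps_to (fun k hk => hmaps k (hS k hk)), Finset.mul_sum]
    refine Finset.sum_le_sum fun a ha => ?_
    have ha1 : 1 ≤ a := (Finset.mem_Icc.1 ha).1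
    have ha1' : (1 : ℝ) ≤ a := by exact_mod_cast ha1
    have ha0 : (0 : ℝ) < a := by linarith
    obtain ⟨hf, hcard⟩ := hc a ha1'
    have hterm : ∀ k ∈ S.filter (fun k => ⌊μ k ^ (1 / m)⌋₊ = a),
        μ k ^ (-p) ≤ (a : ℝ) ^ (-(m * p)) := by
      intro k hk
      have hk2 := (hfib k a (Finset.mem_filter.1 hk).2).1
      have : μ k ^ (-p) = (μ k ^ (1 / m)) ^ (-(m * p)) := by
        rw [← Real.rpow_mul (hpos k).le]
        congr 1
        field_simp
      rw [this]
      exact Real.rpow_le_rpow_of_nonpos ha0 hk2 (by have := mul_nonneg hm.le hp0; linarith)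
    refine (Finset.sum_le_card_nsmul _ _ _ hterm).trans ?_
    have hcle : ((S.filter (fun k => ⌊μ k ^ (1 / m)⌋₊ = a)).card : ℝ) ≤
        K * (a : ℝ) ^ ((n : ℝ) - 1) := by
      refine le_trans ?_ hcard
      rw [Nat.card_coe_set_eq]
      rw [← Set.ncard_coe_finset]
      refine Nat.cast_le.2 (Set.ncard_le_ncard ?_ hf)
      intro k hk
      exact hfib k a (Finset.mem_filter.1 (Finset.mem_coe.1 hk)).2
    rw [nsmul_eq_mul]
    calc _ ≤ K * (a : ℝ) ^ ((n : ℝ) - 1) * (a : ℝ) ^ (-(m * p)) := by gcongr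
      _ = _ := by rw [mul_assoc, ← Real.rpow_add ha0, sub_eq_add_neg _ (m * p)]

lemma weyl_single_bound {n : ℕ} {m p : ℝ} {μ : ℕ → ℝ} (hm : 0 < m) (h : WeylData n m μ)
    (hp : (n : ℝ) / m ≤ p) :
    ∃ C : ℝ, 0 < C ∧ ∀ τ : ℝ, Real.exp 1 ≤ τ → {k | μ k < τ}.Finite ∧
      ∀ S : Finset ℕ, (∀ k ∈ S, μ k < τ) →
        ∑ k ∈ S, μ k ^ (-p) ≤ C * (if (n : ℝ) / m = p then Real.log τ else 1) := by
  have hp0 : 0 ≤ p := le_trans (by positivity) hp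
  obtain ⟨K, hK, hh⟩ := weyl_single hm h hp0
  by_cases hc : (n : ℝ) / m = p
  · refine ⟨K * (1 + 1 / m), by positivity, fun τ hτ => ⟨(hh τ).1, fun S hS => ?_⟩⟩
    refine ((hh τ).2 S hS).trans ?_
    rw [if_pos hc, mul_assoc]
    refine mul_le_mul_of_nonneg_left ?_ hK.le
    have hτ0 : 0 < τ := (Real.exp_pos 1).trans_le hτ
    have hlog : 1 ≤ Real.log τ := (Real.le_log_iff_exp_le hτ0).2 hτ
    have hτ1 : 1 ≤ τ := by have := Real.add_one_le_exp (1 : ℝ); linarith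
    have e : (n : ℝ) - 1 - m * p = -1 := by rw [← hc]; field_simp; ring
    have h1 : ∑ a ∈ Finset.Icc 1 ⌊τ ^ (1 / m)⌋₊, (a : ℝ) ^ ((n : ℝ) - 1 - m * p) =
        (harmonic ⌊τ ^ (1 / m)⌋₊ : ℝ) := by
      rw [harmonic_eq_sum_Icc, e]
      push_cast
      exact Finset.sum_congr rfl fun a _ => Real.rpow_neg_one _
    rw [h1]
    have h2 := harmonic_floor_le_one_add_log (τ ^ (1 / m)) (Real.one_le_rpow hτ1 (by positivity))
    rw [Real.log_rpow hτ0] at h2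
    nlinarith
  · have hlt : (n : ℝ) / m < p := lt_of_le_of_ne hp hc
    rw [div_lt_iff₀ hm] at hlt
    have hsum : Summable (fun a : ℕ => (a : ℝ) ^ ((n : ℝ) - 1 - m * p)) :=
      Real.summable_nat_rpow.2 (by linarith)
    have hnn : ∀ a : ℕ, 0 ≤ (a : ℝ) ^ ((n : ℝ) - 1 - m * p) := fun a => by positivity
    refine ⟨K * (∑' a : ℕ, (a : ℝ) ^ ((n : ℝ) - 1 - m * p) + 1), ?_,
      fun τ hτ => ⟨(hh τ).1, fun S hS => ?_⟩⟩
    · have := tsum_nonneg (L := .unconditional ℕ) hnn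
      positivity
    · refine ((hh τ).2 S hS).trans ?_
      rw [if_neg hc, mul_one]
      refine mul_le_mul_of_nonneg_left ?_ hK.le
      have := hsum.sum_le_tsum (Finset.Icc 1 ⌊τ ^ (1 / m)⌋₊) (fun a _ => hnn a)
      linarith


theorem multi_factor_sum_critical (r : ℕ) (hr : 1 ≤ r)
    (n : Fin r → ℕ) (m : Fin r → ℝ) (μ : Fin r → ℕ → ℝ)
    (hn : ∀ j, 1 ≤ n j) (hm : ∀ j, 0 < m j)
    (hμ : ∀ j, WeylData (n j) (m j) (μ j)) (hμ1 : ∀ j k, 1 < μ j k)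
    (p : ℝ) (s : ℕ)
    (hple : ∀ j, (n j : ℝ) / m j ≤ p) (hpmem : ∃ j, (n j : ℝ) / m j = p)
    (hs : s = Nat.card {j : Fin r | (n j : ℝ) / m j = p}) :
    (fun τ : ℝ => ∑' t : {t : Fin r → ℕ | (∏ j, μ j (t j)) < τ},
        (∏ j, μ j (t.1 j)) ^ (-p)) =O[atTop]
      (fun τ : ℝ => Real.log τ ^ s) := by

  choose C hC hb using fun j => weyl_single_bound (hm j) (hμ j) (hple j)
  have hpos : ∀ j k, 0 < μ j k := fun j k => one_pos.trans (hμ1 j k)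
  refine IsBigO.of_bound (∏ j, C j) ?_
  filter_upwards [eventually_ge_atTop (Real.exp 1)] with τ hτ
  have hτ0 : 0 < τ := (Real.exp_pos 1).trans_le hτ
  have hlog : 1 ≤ Real.log τ := (Real.le_log_iff_exp_le hτ0).2 hτ
  have hnn : ∀ t : Fin r → ℕ, 0 ≤ (∏ j, μ j (t j)) ^ (-p) := fun t =>
    Real.rpow_nonneg (Finset.prod_nonneg fun j _ => (hpos j _).le) _
  rw [Real.norm_of_nonneg (tsum_nonneg (fun t : {t : Fin r → ℕ | (∏ j, μ j (t j)) < τ} => hnn t.1)), Real.norm_of_nonneg (by positivity)]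
  have hlogs : Real.log τ ^ s = ∏ j, (if (n j : ℝ) / m j = p then Real.log τ else 1) := by
    rw [Finset.prod_ite, Finset.prod_const, Finset.prod_const_one, mul_one, hs,
      Nat.card_eq_fintype_card, ← Set.toFinset_card]
    congr 2
    ext j
    simp
  rw [hlogs, ← Finset.prod_mul_distrib]
  refine Real.tsum_le_of_sum_le (fun t => hnn t.1) fun u => ?_
  have hfin : ∀ j, {k | μ j k < τ}.Finite := fun j => (hb j τ hτ).1
  have hle : ∀ j (t : Fin r → ℕ), μ j (t j) ≤ ∏ i, μ i (t i) := fun j t => by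
    rw [← Finset.mul_prod_erase _ _ (Finset.mem_univ j)]
    refine le_mul_of_one_le_right (hpos j _).le ?_
    exact Finset.prod_induction (s := Finset.univ.erase j) (fun i => μ i (t i))
      (fun x : ℝ => 1 ≤ x) (fun a b ha hb => one_le_mul_of_one_le_of_one_le ha hb) le_rfl
      fun i _ => (hμ1 i _).le
  calc ∑ t ∈ u, (∏ j, μ j (t.1 j)) ^ (-p)
      = ∑ t ∈ u.map (Function.Embedding.subtype _), (∏ j, μ j (t j)) ^ (-p) := by
        rw [Finset.sum_map]; rfl
    _ ≤ ∑ t ∈ Fintype.piFinset fun j => (hfin j).toFinset, (∏ j, μ j (t j)) ^ (-p) := by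
        refine Finset.sum_le_sum_of_subset_of_nonneg ?_ fun t _ _ => hnn t
        intro t ht
        obtain ⟨x, hx, rfl⟩ := Finset.mem_map.1 ht
        rw [Fintype.mem_piFinset]
        intro j
        rw [Set.Finite.mem_toFinset]
        exact lt_of_le_of_lt (hle j _) x.2
    _ = ∏ j, ∑ k ∈ (hfin j).toFinset, μ j k ^ (-p) := by
        rw [Finset.prod_univ_sum]
        exact Finset.sum_congr rfl fun t _ =>
          (Real.finsetProd_rpow _ _ (fun j _ => (hpos j _).le) _).symm
    _ ≤ _ := by
        refine Finset.prod_le_prod (fun j _ => Finset.sum_nonneg fun k _ =>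
          Real.rpow_nonneg (hpos j k).le _) fun j _ => ?_
        exact (hb j τ hτ).2 _ fun k hk => by simpa using hk
end

section
/- Let r ≥ 1 be an integer and, for j = 1,…,r, let n_j ≥ 1 be integers, m_j > 0 reals, and let (μ^j_k)_{k∈ℕ} be sequences having Weyl counting data (n_j, m_j) with μ^j_k > 1 for all k. Set p = max_{1≤j≤r} n_j/m_j and s = #{j : n_j/m_j = p}. Then for every real c > p each series ζ_j(c) = Σ_{k∈ℕ} (μ^j_k)^{−c} converges, and ∏_{j=1}^r ζ_j(c) − F(τ, c) = O(τ^{p−c}·(log τ)^{s−1}) as τ → +∞, where F(τ, c) = Σ_{(k₁,…,k_r)∈ℕ^r : μ¹_{k₁}···μ^r_{k_r} < τ} (μ¹_{k₁}···μ^r_{k_r})^{−c}. -/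
open Filter Topology Asymptotics

lemma prod_tsum_enn (r : ℕ) : ∀ f : Fin r → ℕ → ENNReal,
    ∑' t : Fin r → ℕ, ∏ j, f j (t j) = ∏ j, ∑' k, f j k := by
  induction r with
  | zero => intro f; simp
  | succ r ih =>
    intro f
    rw [← (Fin.consEquiv (fun _ : Fin (r+1) => ℕ)).tsum_eq, ENNReal.tsum_prod']
    simp only [Fin.consEquiv_apply, Fin.prod_univ_succ, Fin.cons_zero, Fin.cons_succ]
    simp_rw [ENNReal.tsum_mul_left, ih, ENNReal.tsum_mul_right]

lemma single_level (n : ℕ) (m : ℝ) (μ : ℕ → ℝ) (hn : 1 ≤ n) (hm : 0 < m)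
    (h : WeylData n m μ) (c : ℝ) (hc : 0 ≤ c) :
    ∃ C : ℝ, 0 < C ∧ ∀ a : ℕ,
      ∑' k, (if ⌊Real.log (μ k)⌋₊ = a then ENNReal.ofReal (μ k ^ (-c)) else 0) ≤
        ENNReal.ofReal (C * Real.exp (((n : ℝ) / m - c) * a)) := by
  obtain ⟨h1, K, hK, hW⟩ := h
  refine ⟨K * Real.exp ((n : ℝ) / m), by positivity, fun a => ?_⟩
  set Q := ⌊Real.exp ((a + 1) / m)⌋₊ with hQ
  let W : ℕ → Set ℕ := fun i => {k : ℕ | (i : ℝ) ≤ μ k ^ (1 / m) ∧ μ k ^ (1 / m) ≤ i + 1}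
  have hWf : ∀ i ∈ Finset.Icc 1 Q, (W i).Finite := fun i hi =>
    (hW i (by exact_mod_cast (Finset.mem_Icc.1 hi).1)).1
  have hWc : ∀ i ∈ Finset.Icc 1 Q, ((W i).ncard : ℝ) ≤ K * (Q : ℝ) ^ (n - 1) := fun i hi => by
    have hi' := Finset.mem_Icc.1 hi
    refine (hW i (by exact_mod_cast hi'.1)).2.trans ?_
    have : ((n : ℝ) - 1) = ((n - 1 : ℕ) : ℝ) := by push_cast [hn]; ring
    rw [this, Real.rpow_natCast]
    have : (i : ℝ) ≤ Q := by exact_mod_cast hi'.2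
    gcongr
  let S : Set ℕ := {k | ⌊Real.log (μ k)⌋₊ = a}
  have hS : S ⊆ ⋃ i ∈ Finset.Icc 1 Q, W i := by
    intro k hk
    have hk' : ⌊Real.log (μ k)⌋₊ = a := hk
    have hpos : 0 < μ k := by linarith [h1 k]
    have hl : Real.log (μ k) < a + 1 := by
      rw [← hk']; exact Nat.lt_floor_add_one _
    have hx1 : 1 ≤ μ k ^ (1 / m) := Real.one_le_rpow (h1 k) (by positivity)
    have hx2 : μ k ^ (1 / m) ≤ Real.exp ((a + 1) / m) := by
      rw [Real.rpow_def_of_pos hpos]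
      apply Real.exp_le_exp.2
      rw [mul_one_div]
      gcongr
    simp only [Set.mem_iUnion]
    refine ⟨⌊μ k ^ (1 / m)⌋₊, Finset.mem_Icc.2 ⟨Nat.le_floor (by exact_mod_cast hx1),
      Nat.floor_mono hx2⟩, Nat.floor_le (by linarith), (Nat.lt_floor_add_one _).le⟩
  have hUf : (⋃ i ∈ Finset.Icc 1 Q, W i).Finite := Set.Finite.biUnion (Finset.finite_toSet _) hWf
  have hSf : S.Finite := hUf.subset hS
  have hcard : (S.ncard : ℝ) ≤ K * Real.exp ((n : ℝ) / m) * Real.exp ((n : ℝ) / m * a) := by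
    have e1 : S.ncard ≤ ∑ i ∈ Finset.Icc 1 Q, (W i).ncard :=
      (Set.ncard_le_ncard hS hUf).trans (Finset.set_ncard_biUnion_le _ _)
    have e2 : (S.ncard : ℝ) ≤ ∑ i ∈ Finset.Icc 1 Q, K * (Q : ℝ) ^ (n - 1) :=
      le_trans (by exact_mod_cast e1) (Finset.sum_le_sum hWc)
    have e3 : ∑ i ∈ Finset.Icc 1 Q, K * (Q : ℝ) ^ (n - 1) = K * (Q : ℝ) ^ n := by
      rw [Finset.sum_const, Nat.card_Icc]
      obtain ⟨n', rfl⟩ : ∃ n', n = n' + 1 := ⟨n - 1, by omega⟩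
      simp [pow_succ]; ring
    have e4 : (Q : ℝ) ≤ Real.exp ((a + 1) / m) := Nat.floor_le (Real.exp_pos _).le
    calc (S.ncard : ℝ) ≤ K * (Q : ℝ) ^ n := e2.trans e3.le
      _ ≤ K * (Real.exp ((a + 1) / m)) ^ n := by gcongr
      _ = _ := by
        rw [← Real.exp_nat_mul, mul_assoc, ← Real.exp_add]
        congr 2; field_simp; ring
  have hle : ∀ k, (if ⌊Real.log (μ k)⌋₊ = a then ENNReal.ofReal (μ k ^ (-c)) else 0) ≤
      if k ∈ hSf.toFinset then ENNReal.ofReal (Real.exp (-c * a)) else 0 := by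
    intro k
    have hpos : 0 < μ k := by linarith [h1 k]
    by_cases hk : ⌊Real.log (μ k)⌋₊ = a
    · have : k ∈ hSf.toFinset := by simpa [S] using hk
      rw [if_pos hk, if_pos this]
      apply ENNReal.ofReal_le_ofReal
      rw [Real.rpow_def_of_pos hpos]
      apply Real.exp_le_exp.2
      have : (a : ℝ) ≤ Real.log (μ k) := by
        rw [← hk]; exact Nat.floor_le (Real.log_nonneg (h1 k))
      nlinarith
    · rw [if_neg hk]; exact zero_le
  refine (ENNReal.tsum_le_tsum hle).trans ?_
  rw [tsum_eq_sum (s := hSf.toFinset) (fun k hk => if_neg hk),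
    Finset.sum_congr rfl (fun k hk => if_pos hk), Finset.sum_const, nsmul_eq_mul,
    ← ENNReal.ofReal_natCast, ← ENNReal.ofReal_mul (by positivity),
    ← Set.ncard_eq_toFinset_card S hSf]
  apply ENNReal.ofReal_le_ofReal
  calc (S.ncard : ℝ) * Real.exp (-c * a)
      ≤ (K * Real.exp ((n : ℝ) / m) * Real.exp ((n : ℝ) / m * a)) * Real.exp (-c * a) := by gcongr
    _ = _ := by rw [mul_assoc _ (Real.exp _), ← Real.exp_add]; congr 2; ring

/-- level decomposition -/
lemma level_decomp (r : ℕ) (w : Fin r → ℕ → ENNReal) (lev : Fin r → ℕ → ℕ)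
    (G : (Fin r → ℕ) → ENNReal) :
    ∑' t : Fin r → ℕ, G (fun j => lev j (t j)) * ∏ j, w j (t j) =
      ∑' a : Fin r → ℕ, G a * ∏ j, ∑' k, (if lev j k = a j then w j k else 0) := by
  simp_rw [← prod_tsum_enn, ← ENNReal.tsum_mul_left]
  rw [ENNReal.tsum_comm]
  refine tsum_congr fun t => ?_
  rw [tsum_eq_single (fun j => lev j (t j))]
  · simp
  · intro a ha
    obtain ⟨j, hj⟩ := Function.ne_iff.1 ha
    rw [Finset.prod_eq_zero (Finset.mem_univ j) (if_neg (Ne.symm hj)), mul_zero]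

lemma antidiag_bound (r : ℕ) (θ : Fin r → ℝ) (h0 : ∀ j, 0 ≤ θ j) (h1 : ∀ j, θ j ≤ 1)
    (j0 : Fin r) (hj0 : θ j0 = 1) :
    ∃ D : ℝ, 0 < D ∧ ∀ N : ℕ, ∑ a ∈ Finset.piAntidiag Finset.univ N, ∏ j, θ j ^ a j ≤
      D * ((N : ℝ) + 1) ^ (Nat.card {j | θ j = 1} - 1) := by
  classical
  refine ⟨∏ j, (if θ j = 1 then 1 else (1 - θ j)⁻¹), ?_, fun N => ?_⟩
  · refine Finset.prod_pos fun j _ => ?_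
    split_ifs with h
    · exact one_pos
    · have := lt_of_le_of_ne (h1 j) h
      exact inv_pos.2 (by linarith)
  let u : (Fin r → ℕ) → (Fin r → ℕ) := fun a => Function.update a j0 0
  let B : Fin r → Finset ℕ := fun j => if j = j0 then {0} else Finset.range (N + 1)
  have hinj : Set.InjOn u (Finset.piAntidiag Finset.univ N : Finset (Fin r → ℕ)) := by
    intro a ha b hb hab
    simp only [Finset.mem_coe, Finset.mem_piAntidiag] at ha hb
    have hne : ∀ j, j ≠ j0 → a j = b j := fun j hj => by
      have := congrFun hab j
      simpa [u, hj] using this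
    have hs := ha.1.trans hb.1.symm
    rw [← Finset.add_sum_erase _ a (Finset.mem_univ j0),
      ← Finset.add_sum_erase _ b (Finset.mem_univ j0),
      Finset.sum_congr rfl (fun j hj => hne j (Finset.ne_of_mem_erase hj))] at hs
    have hs0 : a j0 = b j0 := Nat.add_right_cancel hs
    funext j
    by_cases hj : j = j0
    · subst hj; exact hs0
    · exact hne j hj
  have hsub : (Finset.piAntidiag Finset.univ N).image u ⊆ Fintype.piFinset B := by
    intro b hb
    obtain ⟨a, ha, rfl⟩ := Finset.mem_image.1 hb
    rw [Finset.mem_piAntidiag] at ha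
    rw [Fintype.mem_piFinset]
    intro j
    by_cases hj : j = j0
    · subst hj; simp [u, B]
    · have : a j ≤ N := ha.1 ▸ Finset.single_le_sum (fun i _ => Nat.zero_le _) (Finset.mem_univ j)
      simp [u, B, hj]; omega
  have hval : ∀ a, ∏ j, θ j ^ a j = ∏ j, θ j ^ (u a j) := by
    intro a
    refine Finset.prod_congr rfl fun j _ => ?_
    by_cases hj : j = j0
    · subst hj; simp [hj0]
    · simp [u, hj]
  have hfac : ∀ j, ∑ i ∈ B j, θ j ^ i ≤ (if θ j = 1 then 1 else (1 - θ j)⁻¹) *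
      (if j ∈ ({j | θ j = 1} : Finset (Fin r)).erase j0 then ((N : ℝ) + 1) else 1) := by
    intro j
    by_cases hj : j = j0
    · subst hj; simp [B, hj0]
    · by_cases ht : θ j = 1
      · simp [B, hj, ht]
      · have := lt_of_le_of_ne (h1 j) ht
        simp only [B, hj, ht, if_false, Finset.mem_erase, Finset.mem_filter, and_false, mul_one]
        rw [← tsum_geometric_of_lt_one (h0 j) this]
        exact (summable_geometric_of_lt_one (h0 j) this).sum_le_tsum _
          (fun i _ => pow_nonneg (h0 j) i)
  calc ∑ a ∈ Finset.piAntidiag Finset.univ N, ∏ j, θ j ^ a j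
      = ∑ b ∈ (Finset.piAntidiag Finset.univ N).image u, ∏ j, θ j ^ b j := by
        rw [Finset.sum_image hinj]; exact Finset.sum_congr rfl fun a _ => hval a
    _ ≤ ∑ b ∈ Fintype.piFinset B, ∏ j, θ j ^ b j :=
        Finset.sum_le_sum_of_subset_of_nonneg hsub
          fun b _ _ => Finset.prod_nonneg fun j _ => pow_nonneg (h0 j) _
    _ = ∏ j, ∑ i ∈ B j, θ j ^ i := (Finset.prod_univ_sum B fun j i => θ j ^ i).symm
    _ ≤ ∏ j, ((if θ j = 1 then 1 else (1 - θ j)⁻¹) *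
      (if j ∈ ({j | θ j = 1} : Finset (Fin r)).erase j0 then ((N : ℝ) + 1) else 1)) :=
        Finset.prod_le_prod (fun j _ => Finset.sum_nonneg fun i _ => pow_nonneg (h0 j) _)
          fun j _ => hfac j
    _ = _ := by
        rw [Finset.prod_mul_distrib]
        congr 1
        rw [Finset.prod_ite_mem, Finset.univ_inter, Finset.prod_const,
          Finset.card_erase_of_mem (by simpa using hj0)]
        congr 2
        simp [Nat.card_eq_fintype_card, Fintype.card_subtype]

lemma level_tail (r : ℕ) (q : Fin r → ℝ) (p c : ℝ) (hq : ∀ j, q j ≤ p) (hpc : p < c)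
    (j0 : Fin r) (hj0 : q j0 = p) :
    ∃ D : ℝ, 0 < D ∧ ∀ M : ℕ,
      ∑' a : Fin r → ℕ, (if M ≤ ∑ j, a j then (1 : ENNReal) else 0) *
        ENNReal.ofReal (∏ j, Real.exp ((q j - c) * a j)) ≤
      ENNReal.ofReal (D * (Real.exp ((p - c) * M) *
        ((M : ℝ) + 1) ^ (Nat.card {j | q j = p} - 1))) := by
  classical
  obtain ⟨D, hD, hb⟩ := antidiag_bound r (fun j => Real.exp (q j - p)) (fun j => (Real.exp_pos _).le)
    (fun j => Real.exp_le_one_iff.2 (by linarith [hq j])) j0 (by simp [hj0])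
  have hset : {j | Real.exp (q j - p) = 1} = {j | q j = p} := by
    ext j; simp [sub_eq_zero]
  rw [hset] at hb
  set e := Nat.card {j | q j = p} - 1
  set ρ := Real.exp (p - c) with hρ
  have hρ1 : ρ < 1 := by rw [hρ, ← Real.exp_zero]; exact Real.exp_lt_exp.2 (by linarith)
  have hρ0 : 0 < ρ := Real.exp_pos _
  have hsum : Summable (fun i : ℕ => ρ ^ i * ((i : ℝ) + 1) ^ e) := by
    have h1 := summable_pow_mul_geometric_of_norm_lt_one e (r := ρ)
      (by rw [Real.norm_of_nonneg hρ0.le]; exact hρ1)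
    have h2 := ((summable_nat_add_iff 1).2 h1).mul_left ρ⁻¹
    refine h2.congr fun i => ?_
    push_cast; rw [pow_succ]; field_simp
  set E := ∑' i : ℕ, ρ ^ i * ((i : ℝ) + 1) ^ e
  have hE : 0 < E := hsum.tsum_pos (fun i => by positivity) 0 (by simp)
  refine ⟨D * E, by positivity, fun M => ?_⟩
  have hN : ∀ N : ℕ, ∑ a ∈ Finset.piAntidiag (Finset.univ : Finset (Fin r)) N,
      ENNReal.ofReal (∏ j, Real.exp ((q j - c) * a j)) ≤
      ENNReal.ofReal (D * (ρ ^ N * ((N : ℝ) + 1) ^ e)) := by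
    intro N
    rw [← ENNReal.ofReal_sum_of_nonneg (fun a _ => by positivity)]
    apply ENNReal.ofReal_le_ofReal
    have : ∀ a ∈ Finset.piAntidiag (Finset.univ : Finset (Fin r)) N,
        ∏ j, Real.exp ((q j - c) * a j) = ρ ^ N * ∏ j, Real.exp (q j - p) ^ a j := by
      intro a ha
      rw [← (Finset.mem_piAntidiag.1 ha).1, ← Finset.prod_pow_eq_pow_sum, ← Finset.prod_mul_distrib]
      refine Finset.prod_congr rfl fun j _ => ?_
      rw [hρ, ← mul_pow, ← Real.exp_add, ← Real.exp_nat_mul]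
      congr 1; ring
    rw [Finset.sum_congr rfl this, ← Finset.mul_sum]
    calc _ ≤ ρ ^ N * (D * ((N : ℝ) + 1) ^ e) := by gcongr; exact hb N
      _ = _ := by ring
  -- regroup by the total
  have hgroup : ∑' a : Fin r → ℕ, (if M ≤ ∑ j, a j then (1 : ENNReal) else 0) *
        ENNReal.ofReal (∏ j, Real.exp ((q j - c) * a j)) =
      ∑' N : ℕ, (if M ≤ N then (1 : ENNReal) else 0) *
        ∑ a ∈ Finset.piAntidiag (Finset.univ : Finset (Fin r)) N,
          ENNReal.ofReal (∏ j, Real.exp ((q j - c) * a j)) := by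
    have : ∀ N : ℕ, ∑ a ∈ Finset.piAntidiag (Finset.univ : Finset (Fin r)) N,
          ENNReal.ofReal (∏ j, Real.exp ((q j - c) * a j)) =
        ∑' a : Fin r → ℕ, if ∑ j, a j = N then
          ENNReal.ofReal (∏ j, Real.exp ((q j - c) * a j)) else 0 := by
      intro N
      rw [tsum_eq_sum (s := Finset.piAntidiag (Finset.univ : Finset (Fin r)) N)]
      · refine Finset.sum_congr rfl fun a ha => ?_
        rw [if_pos (Finset.mem_piAntidiag.1 ha).1]
      · intro a ha
        rw [if_neg]
        intro h
        exact ha (Finset.mem_piAntidiag.2 ⟨h, fun _ _ => Finset.mem_univ _⟩)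
    simp_rw [this, ← ENNReal.tsum_mul_left]
    rw [ENNReal.tsum_comm]
    refine tsum_congr fun a => ?_
    rw [tsum_eq_single (∑ j, a j)]
    · simp
    · intro N hN; simp [Ne.symm hN]
  rw [hgroup]
  calc _ ≤ ∑' N : ℕ, (if M ≤ N then (1 : ENNReal) else 0) *
          ENNReal.ofReal (D * (ρ ^ N * ((N : ℝ) + 1) ^ e)) :=
        ENNReal.tsum_le_tsum fun N => by gcongr; exact hN N
    _ = ∑' i : ℕ, ENNReal.ofReal (D * (ρ ^ (i + M) * (((i + M : ℕ) : ℝ) + 1) ^ e)) := by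
        rw [← Summable.sum_add_tsum_nat_add' (k := M) ENNReal.summable, Finset.sum_eq_zero, zero_add]
        · refine tsum_congr fun i => ?_
          simp
        · intro i hi
          simp [Finset.mem_range.1 hi]
    _ ≤ ∑' i : ℕ, ENNReal.ofReal (D * (ρ ^ M * ((M : ℝ) + 1) ^ e) *
          (ρ ^ i * ((i : ℝ) + 1) ^ e)) := by
        refine ENNReal.tsum_le_tsum fun i => ENNReal.ofReal_le_ofReal ?_
        have : (((i + M : ℕ) : ℝ) + 1) ^ e ≤ (((M : ℝ) + 1) * ((i : ℝ) + 1)) ^ e := by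
          apply pow_le_pow_left₀ (by positivity)
          push_cast
          nlinarith [mul_nonneg (Nat.cast_nonneg (α := ℝ) i) (Nat.cast_nonneg (α := ℝ) M)]
        calc _ ≤ D * (ρ ^ (i + M) * (((M : ℝ) + 1) * ((i : ℝ) + 1)) ^ e) := by gcongr
          _ = _ := by rw [pow_add, mul_pow]; ring
    _ = ENNReal.ofReal (D * (ρ ^ M * ((M : ℝ) + 1) ^ e) * E) := by
        rw [← ENNReal.ofReal_tsum_of_nonneg (fun i => by positivity) (hsum.mul_left _), tsum_mul_left]
    _ = _ := by
        congr 1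
        rw [hρ, ← Real.exp_nat_mul, mul_comm (M : ℝ)]; ring

lemma tsum_ne_top_of_levels (w : ℕ → ENNReal) (lev : ℕ → ℕ) (C d : ℝ) (hC : 0 ≤ C) (hd : d < 0)
    (h : ∀ a : ℕ, ∑' k, (if lev k = a then w k else 0) ≤
      ENNReal.ofReal (C * Real.exp (d * a))) : ∑' k, w k ≠ ⊤ := by
  have e : ∑' k, w k = ∑' a, ∑' k, (if lev k = a then w k else 0) := by
    rw [ENNReal.tsum_comm]
    exact tsum_congr fun k => (tsum_ite_eq' (lev k) (fun _ => w k)).symm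
  have hs : Summable (fun a : ℕ => C * Real.exp (d * a)) := by
    refine Summable.mul_left _ ?_
    refine (summable_geometric_of_lt_one (Real.exp_pos d).le
      (by rw [← Real.exp_zero]; exact Real.exp_lt_exp.2 hd)).congr fun a => ?_
    rw [← Real.exp_nat_mul, mul_comm]
  rw [e]
  refine ne_top_of_le_ne_top ?_ (ENNReal.tsum_le_tsum h)
  rw [← ENNReal.ofReal_tsum_of_nonneg (fun a => by positivity) hs]
  exact ENNReal.ofReal_ne_top

theorem multi_factor_sum_supercritical (r : ℕ) (hr : 1 ≤ r)
    (n : Fin r → ℕ) (m : Fin r → ℝ) (μ : Fin r → ℕ → ℝ)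
    (hn : ∀ j, 1 ≤ n j) (hm : ∀ j, 0 < m j)
    (hμ : ∀ j, WeylData (n j) (m j) (μ j)) (hμ1 : ∀ j k, 1 < μ j k)
    (p : ℝ) (s : ℕ)
    (hple : ∀ j, (n j : ℝ) / m j ≤ p) (hpmem : ∃ j, (n j : ℝ) / m j = p)
    (hs : s = Nat.card {j : Fin r | (n j : ℝ) / m j = p})
    (c : ℝ) (hc : p < c) :
    (∀ j, Summable (fun k : ℕ => μ j k ^ (-c))) ∧
    (fun τ : ℝ => (∏ j, ∑' k : ℕ, μ j k ^ (-c)) -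
        ∑' t : {t : Fin r → ℕ | (∏ j, μ j (t j)) < τ},
          (∏ j, μ j (t.1 j)) ^ (-c)) =O[atTop]
      (fun τ : ℝ => τ ^ (p - c) * Real.log τ ^ (s - 1)) := by
  classical
  obtain ⟨j0, hj0⟩ := hpmem
  have hp0 : 0 ≤ p := by
    rw [← hj0]; exact div_nonneg (Nat.cast_nonneg _) (hm j0).le
  have hc0 : 0 ≤ c := by linarith
  have hpos : ∀ j k, 0 < μ j k := fun j k => by linarith [hμ1 j k]
  choose C hC hA using fun j => single_level (n j) (m j) (μ j) (hn j) (hm j) (hμ j) c hc0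
  have hfin : ∀ j, ∑' k, ENNReal.ofReal (μ j k ^ (-c)) ≠ ⊤ := fun j =>
    tsum_ne_top_of_levels _ (fun k => ⌊Real.log (μ j k)⌋₊) (C j) ((n j : ℝ) / m j - c) (hC j).le
      (by linarith [hple j]) (hA j)
  have hsumm : ∀ j, Summable (fun k : ℕ => μ j k ^ (-c)) := fun j => by
    refine (ENNReal.summable_toReal (hfin j)).congr fun k => ?_
    exact ENNReal.toReal_ofReal (Real.rpow_nonneg (hpos j k).le _)
  refine ⟨hsumm, ?_⟩
  have hPpos : ∀ t : Fin r → ℕ, 0 < ∏ j, μ j (t j) := fun t =>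
    Finset.prod_pos fun j _ => hpos j _
  set g : (Fin r → ℕ) → ℝ := fun t => (∏ j, μ j (t j)) ^ (-c) with hg
  have hg0 : ∀ t, 0 ≤ g t := fun t => Real.rpow_nonneg (hPpos t).le _
  have hgp : ∀ t, ENNReal.ofReal (g t) = ∏ j, ENNReal.ofReal (μ j (t j) ^ (-c)) := fun t => by
    rw [← ENNReal.ofReal_prod_of_nonneg (fun j _ => Real.rpow_nonneg (hpos j _).le _), hg]
    dsimp only
    rw [Real.finsetProd_rpow _ _ (fun j _ => (hpos j _).le)]
  have htot : ∑' t, ENNReal.ofReal (g t) = ∏ j, ∑' k, ENNReal.ofReal (μ j k ^ (-c)) := by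
    rw [← prod_tsum_enn]; exact tsum_congr hgp
  have htotfin : ∑' t, ENNReal.ofReal (g t) ≠ ⊤ := by
    rw [htot]; exact ENNReal.prod_ne_top fun j _ => hfin j
  have hgs : Summable g :=
    (ENNReal.summable_toReal htotfin).congr fun t => ENNReal.toReal_ofReal (hg0 t)
  have hprod : ∏ j, ∑' k : ℕ, μ j k ^ (-c) = ∑' t, g t := by
    have h1 := congrArg ENNReal.toReal htot
    rw [ENNReal.toReal_prod, ← ENNReal.ofReal_tsum_of_nonneg hg0 hgs,
      ENNReal.toReal_ofReal (tsum_nonneg hg0)] at h1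
    rw [h1]
    refine Finset.prod_congr rfl fun j _ => ?_
    rw [← ENNReal.ofReal_tsum_of_nonneg (fun k => Real.rpow_nonneg (hpos j k).le _) (hsumm j),
      ENNReal.toReal_ofReal (tsum_nonneg fun k => Real.rpow_nonneg (hpos j k).le _)]
  obtain ⟨D, hD, hT⟩ := level_tail r (fun j => (n j : ℝ) / m j) p c hple hc j0 hj0
  rw [← hs] at hT
  have hCpos : 0 < ∏ j, C j := Finset.prod_pos fun j _ => hC j
  refine IsBigO.of_bound ((∏ j, C j) * D * Real.exp ((c - p) * (r + 1)) * 2 ^ (s - 1)) ?_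
  filter_upwards [eventually_ge_atTop (Real.exp 1)] with τ hτ
  have hτ0 : 0 < τ := (Real.exp_pos 1).trans_le hτ
  have hlog : 1 ≤ Real.log τ := (Real.le_log_iff_exp_le hτ0).2 hτ
  set M := ⌊Real.log τ⌋₊ - r with hM
  set S : Set (Fin r → ℕ) := {t | (∏ j, μ j (t j)) < τ} with hS
  have hdiff : (∏ j, ∑' k : ℕ, μ j k ^ (-c)) - ∑' t : S, g t = ∑' t : ↑Sᶜ, g t := by
    rw [hprod, ← hgs.tsum_subtype_add_tsum_subtype_compl S]; ring
  have hlev : ∀ t ∈ Sᶜ, M ≤ ∑ j, ⌊Real.log (μ j (t j))⌋₊ := by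
    intro t ht
    have ht' : τ ≤ ∏ j, μ j (t j) := by simpa [hS] using ht
    have h1 : Real.log τ ≤ ∑ j, Real.log (μ j (t j)) := by
      rw [← Real.log_prod (fun j _ => (hpos j _).ne')]
      exact Real.log_le_log hτ0 ht'
    have h2 : ∑ j, Real.log (μ j (t j)) ≤ ∑ j, ((⌊Real.log (μ j (t j))⌋₊ : ℝ) + 1) :=
      Finset.sum_le_sum fun j _ => (Nat.lt_floor_add_one _).le
    have h3 : (⌊Real.log τ⌋₊ : ℝ) ≤ ((∑ j, ⌊Real.log (μ j (t j))⌋₊ + r : ℕ) : ℝ) := by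
      refine (Nat.floor_le (by linarith)).trans (h1.trans (h2.trans (le_of_eq ?_)))
      simp [Finset.sum_add_distrib]
    have h4 : ⌊Real.log τ⌋₊ ≤ ∑ j, ⌊Real.log (μ j (t j))⌋₊ + r := by exact_mod_cast h3
    omega
  have htail : ENNReal.ofReal (∑' t : ↑Sᶜ, g t) ≤
      ENNReal.ofReal ((∏ j, C j) * (D * (Real.exp ((p - c) * M) * ((M : ℝ) + 1) ^ (s - 1)))) := by
    rw [ENNReal.ofReal_tsum_of_nonneg (fun t => hg0 _) (hgs.subtype _),
      tsum_subtype Sᶜ (fun t => ENNReal.ofReal (g t))]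
    calc ∑' t, Sᶜ.indicator (fun t => ENNReal.ofReal (g t)) t
        ≤ ∑' t : Fin r → ℕ, (if M ≤ ∑ j, ⌊Real.log (μ j (t j))⌋₊ then (1 : ENNReal) else 0) *
            ∏ j, ENNReal.ofReal (μ j (t j) ^ (-c)) := by
          refine ENNReal.tsum_le_tsum fun t => ?_
          by_cases ht : t ∈ Sᶜ
          · rw [Set.indicator_of_mem ht, if_pos (hlev t ht), one_mul, hgp]
          · rw [Set.indicator_of_notMem ht]; exact zero_le
      _ = ∑' a : Fin r → ℕ, (if M ≤ ∑ j, a j then (1 : ENNReal) else 0) *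
            ∏ j, ∑' k, (if ⌊Real.log (μ j k)⌋₊ = a j then ENNReal.ofReal (μ j k ^ (-c)) else 0) :=
          level_decomp r (fun j k => ENNReal.ofReal (μ j k ^ (-c)))
            (fun j k => ⌊Real.log (μ j k)⌋₊) (fun a => if M ≤ ∑ j, a j then 1 else 0)
      _ ≤ ∑' a : Fin r → ℕ, (if M ≤ ∑ j, a j then (1 : ENNReal) else 0) *
            ∏ j, ENNReal.ofReal (C j * Real.exp (((n j : ℝ) / m j - c) * a j)) :=
          ENNReal.tsum_le_tsum fun a =>
            mul_le_mul_right (Finset.prod_le_prod' fun j _ => hA j (a j)) _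
      _ = ENNReal.ofReal (∏ j, C j) *
            ∑' a : Fin r → ℕ, (if M ≤ ∑ j, a j then (1 : ENNReal) else 0) *
              ENNReal.ofReal (∏ j, Real.exp (((n j : ℝ) / m j - c) * a j)) := by
          rw [← ENNReal.tsum_mul_left]
          refine tsum_congr fun a => ?_
          rw [← ENNReal.ofReal_prod_of_nonneg
            (fun j _ => mul_nonneg (hC j).le (Real.exp_pos _).le), Finset.prod_mul_distrib,
            ENNReal.ofReal_mul hCpos.le]
          ring
      _ ≤ ENNReal.ofReal (∏ j, C j) *
            ENNReal.ofReal (D * (Real.exp ((p - c) * M) * ((M : ℝ) + 1) ^ (s - 1))) :=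
          mul_le_mul_right (hT M) _
      _ = _ := (ENNReal.ofReal_mul hCpos.le).symm
  have htail' := (ENNReal.ofReal_le_ofReal_iff (by positivity)).1 htail
  have hM1 : (M : ℝ) + 1 ≤ 2 * Real.log τ := by
    have : (M : ℝ) ≤ ⌊Real.log τ⌋₊ := by exact_mod_cast Nat.sub_le _ _
    linarith [Nat.floor_le (show 0 ≤ Real.log τ by linarith)]
  have hM2 : Real.log τ - (r + 1) ≤ M := by
    have h1 : ⌊Real.log τ⌋₊ ≤ M + r := by omega
    have h2 : (⌊Real.log τ⌋₊ : ℝ) ≤ M + r := by exact_mod_cast h1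
    linarith [Nat.lt_floor_add_one (Real.log τ)]
  have hexp : Real.exp ((p - c) * M) ≤ Real.exp ((c - p) * (r + 1)) * τ ^ (p - c) := by
    rw [Real.rpow_def_of_pos hτ0, ← Real.exp_add]
    apply Real.exp_le_exp.2
    nlinarith
  have hlog0 : 0 ≤ Real.log τ := by linarith
  rw [hdiff, Real.norm_of_nonneg (tsum_nonneg fun t => hg0 _), Real.norm_of_nonneg (by positivity)]
  calc _ ≤ _ := htail'
    _ ≤ (∏ j, C j) * (D * ((Real.exp ((c - p) * (r + 1)) * τ ^ (p - c)) *
          (2 * Real.log τ) ^ (s - 1))) := by gcongr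
    _ = _ := by rw [mul_pow]; ring
end

section
/- Let r ≥ 2 be an integer, n_j ≥ 1 integers and m_j > 0 reals for j = 1,…,r, and suppose there is an index l with n_l/m_l > n_j/m_j for all j ≠ l. Let the sequence (μ^l_k)_{k∈ℕ} satisfy a sharp Weyl law with dimension n_l, order m_l and leading constant C_l > 0, and for j ≠ l let (μ^j_k)_{k∈ℕ} have Weyl counting data (n_j, m_j) with μ^j_k > 1 for all k. Set p = max_{j≠l} n_j/m_j and assume p < (n_l−1)/m_l. Then each series ζ_j = Σ_{k∈ℕ} (μ^j_k)^{−n_l/m_l} (j ≠ l) converges and N(τ) = #{(k₁,…,k_r) ∈ ℕ^r : μ¹_{k₁}···μ^r_{k_r} < τ} satisfies N(τ) = (C_l/n_l)·(∏_{j≠l} ζ_j)·τ^{n_l/m_l} + O(τ^{(n_l−1)/m_l}) as τ → +∞. -/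
open Filter Topology Asymptotics

theorem weylData_summable {n : ℕ} {m : ℝ} {μ : ℕ → ℝ} (hm : 0 < m)
    (h : WeylData n m μ) (s : ℝ) (hs : (n : ℝ) / m < s) :
    Summable (fun k : ℕ => μ k ^ (-s)) := by
  obtain ⟨h1, K, hK, hw⟩ := h
  have hsm : (n : ℝ) < s * m := (div_lt_iff₀ hm).1 hs
  have hspos : 0 < s * m := lt_of_le_of_lt (Nat.cast_nonneg n) hsm
  have hsum : Summable (fun i : ℕ => K * (i : ℝ) ^ ((n : ℝ) - 1 - s * m)) :=
    (Real.summable_nat_rpow.2 (by linarith)).mul_left K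
  have hν1 : ∀ k, 1 ≤ μ k ^ (1 / m) := fun k =>
    Real.one_le_rpow (h1 k) (by positivity)
  have hν : ∀ k, μ k ^ (-s) = (μ k ^ (1 / m)) ^ (-(s * m)) := by
    intro k
    rw [← Real.rpow_mul (by linarith [h1 k])]
    congr 1
    field_simp
  refine summable_of_sum_le (c := ∑' i : ℕ, K * (i : ℝ) ^ ((n : ℝ) - 1 - s * m))
    (fun k => Real.rpow_nonneg (by linarith [h1 k]) _) ?_
  intro F
  classical
  let g : ℕ → ℕ := fun k => ⌊μ k ^ (1 / m)⌋₊
  rw [← Finset.sum_fiberwise_of_maps_to (t := F.image g) (g := g)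
    (fun k hk => Finset.mem_image_of_mem g hk)]
  refine le_trans (Finset.sum_le_sum (fun i hi => ?_))
    (hsum.sum_le_tsum (F.image g) (fun i _ => by positivity))
  have hi1 : (1 : ℝ) ≤ i := by
    obtain ⟨k, _, rfl⟩ := Finset.mem_image.1 hi
    have : 1 ≤ g k := Nat.le_floor (by simpa using hν1 k)
    exact_mod_cast this
  have hi0 : (0 : ℝ) < i := by linarith
  obtain ⟨hfin, hcard⟩ := hw i hi1
  have hsub : ((F.filter (fun k => g k = i) : Finset ℕ) : Set ℕ) ⊆
      {k : ℕ | (i : ℝ) ≤ μ k ^ (1 / m) ∧ μ k ^ (1 / m) ≤ i + 1} := by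
    intro k hk
    have hk' : g k = i := by
      have := (Finset.mem_filter.1 (Finset.mem_coe.1 hk)).2
      exact this
    constructor
    · rw [← hk']
      exact Nat.floor_le (by linarith [hν1 k])
    · rw [← hk']
      exact (Nat.lt_floor_add_one _).le
  have hc : ((F.filter (fun k => g k = i)).card : ℝ) ≤ K * (i : ℝ) ^ ((n : ℝ) - 1) := by
    refine le_trans ?_ hcard
    have h2 := Set.ncard_le_ncard hsub hfin
    rw [Set.ncard_coe_finset] at h2
    exact_mod_cast h2
  calc ∑ k ∈ F.filter (fun k => g k = i), μ k ^ (-s)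
      ≤ ∑ k ∈ F.filter (fun k => g k = i), (i : ℝ) ^ (-(s * m)) := by
        refine Finset.sum_le_sum (fun k hk => ?_)
        rw [hν k]
        exact Real.rpow_le_rpow_of_nonpos hi0 (hsub hk).1 (by linarith)
    _ = ((F.filter (fun k => g k = i)).card : ℝ) * (i : ℝ) ^ (-(s * m)) := by
        rw [Finset.sum_const, nsmul_eq_mul]
    _ ≤ K * (i : ℝ) ^ ((n : ℝ) - 1) * (i : ℝ) ^ (-(s * m)) := by gcongr
    _ = K * (i : ℝ) ^ ((n : ℝ) - 1 - s * m) := by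
        rw [mul_assoc, ← Real.rpow_add hi0, sub_eq_add_neg _ (s * m)]

theorem hasSum_pi_prod : ∀ (s : ℕ) (f : Fin s → ℕ → ℝ), (∀ i k, 0 ≤ f i k) →
    (∀ i, Summable (f i)) →
    HasSum (fun t : Fin s → ℕ => ∏ i, f i (t i)) (∏ i, ∑' k, f i k) := by
  intro s
  induction s with
  | zero =>
    intro f _ _
    simp
  | succ s ih =>
    intro f h0 hs
    have h1 := ih (fun i => f i.succ) (fun i k => h0 _ _) (fun i => hs _)
    have h3 : Summable (fun x : ℕ × (Fin s → ℕ) => f 0 x.1 * ∏ i : Fin s, f i.succ (x.2 i)) :=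
      Summable.mul_of_nonneg (f := f 0) (g := fun t : Fin s → ℕ => ∏ i : Fin s, f i.succ (t i))
        (hs 0) h1.summable
        (fun k => h0 0 k) (fun t => Finset.prod_nonneg (fun i _ => h0 _ _))
    have h2 := (hs 0).hasSum.mul h1 h3
    rw [Fin.prod_univ_succ, ← (Fin.consEquiv (fun _ : Fin (s + 1) => ℕ)).hasSum_iff]
    have h4 : (fun t : Fin (s + 1) → ℕ => ∏ i, f i (t i)) ∘
        (Fin.consEquiv (fun _ : Fin (s + 1) => ℕ)) =
        fun x : ℕ × (Fin s → ℕ) => f 0 x.1 * ∏ i : Fin s, f i.succ (x.2 i) := by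
      funext x
      simp [Fin.prod_univ_succ]
    rw [h4]
    exact h2

theorem sigma_subtype_ext {α : Type} {Q : α → Set ℕ} (x y : Σ u : α, Q u)
    (h1 : x.1 = y.1) (h2 : x.2.1 = y.2.1) : x = y := by
  obtain ⟨u, k, hk⟩ := x
  obtain ⟨v, k', hk'⟩ := y
  simp only at h1 h2
  subst h1 h2
  rfl

/-- The counting set splits as a sum over the other factors. -/
def splitEquiv (s : ℕ) (μ : Fin (s + 1) → ℕ → ℝ) (l : Fin (s + 1)) (hμ1 : ∀ j k, 1 < μ j k)
    (τ : ℝ) :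
    {t : Fin (s + 1) → ℕ | (∏ j, μ j (t j)) < τ} ≃
      Σ u : Fin s → ℕ, {k : ℕ | μ l k < τ / ∏ i, μ (l.succAbove i) (u i)} where
  toFun t := ⟨fun i => t.1 (l.succAbove i), t.1 l, by
    have h := t.2
    simp only [Set.mem_ofPred_eq, Fin.prod_univ_succAbove _ l] at h
    have hP : 0 < ∏ i, μ (l.succAbove i) (t.1 (l.succAbove i)) :=
      Finset.prod_pos (fun i _ => zero_lt_one.trans (hμ1 _ _))
    exact (lt_div_iff₀ hP).2 h⟩
  invFun x := ⟨l.insertNth x.2.1 x.1, by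
    have h := x.2.2
    have hP : 0 < ∏ i, μ (l.succAbove i) (x.1 i) :=
      Finset.prod_pos (fun i _ => zero_lt_one.trans (hμ1 _ _))
    simpa [Fin.prod_univ_succAbove _ l] using (lt_div_iff₀ hP).1 h⟩
  left_inv t := by
    apply Subtype.ext
    exact Fin.insertNth_self_removeNth l t.1
  right_inv x := by
    apply sigma_subtype_ext
    · funext i
      simp
    · simp

theorem tensor_weyl_r_factors_case_one (r : ℕ) (hr : 2 ≤ r)
    (n : Fin r → ℕ) (m : Fin r → ℝ) (μ : Fin r → ℕ → ℝ)
    (l : Fin r) (C : ℝ) (hC : 0 < C)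
    (hn : ∀ j, 1 ≤ n j) (hm : ∀ j, 0 < m j)
    (hdom : ∀ j, j ≠ l → (n j : ℝ) / m j < (n l : ℝ) / m l)
    (hl : SharpWeyl (n l) (m l) C (μ l))
    (hμ : ∀ j, j ≠ l → WeylData (n j) (m j) (μ j)) (hμ1 : ∀ j k, 1 < μ j k)
    (p : ℝ) (hple : ∀ j, j ≠ l → (n j : ℝ) / m j ≤ p)
    (hpmem : ∃ j, j ≠ l ∧ (n j : ℝ) / m j = p)
    (hcase : p < ((n l : ℝ) - 1) / m l) :
    (∀ j, j ≠ l → Summable (fun k : ℕ => μ j k ^ (-((n l : ℝ) / m l)))) ∧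
    (fun τ : ℝ => (Nat.card {t : Fin r → ℕ | (∏ j, μ j (t j)) < τ} : ℝ) -
        C / n l * (∏ j ∈ Finset.univ.erase l, ∑' k : ℕ, μ j k ^ (-((n l : ℝ) / m l))) *
          τ ^ ((n l : ℝ) / m l)) =O[atTop]
      (fun τ : ℝ => τ ^ (((n l : ℝ) - 1) / m l)) := by
  obtain ⟨j0, hj0, hj0p⟩ := hpmem
  have hp0 : 0 ≤ p := by
    rw [← hj0p]
    exact div_nonneg (Nat.cast_nonneg _) (hm j0).le
  have hml := hm l
  have hba : ((n l : ℝ) - 1) / m l ≤ (n l : ℝ) / m l := by gcongr; linarith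
  refine ⟨fun j hj => weylData_summable (hm j) (hμ j hj) _ (hdom j hj), ?_⟩
  obtain ⟨_, hlfin, κ, hκ, hκb⟩ := hl
  obtain ⟨s, rfl⟩ : ∃ s, r = s + 1 := ⟨r - 1, by omega⟩
  set a : ℝ := (n l : ℝ) / m l with ha
  set b : ℝ := ((n l : ℝ) - 1) / m l with hb
  have hCn : 0 ≤ C / n l := by positivity
  have hμ0 : ∀ j k, 0 < μ j k := fun j k => zero_lt_one.trans (hμ1 j k)
  have hprod : ∏ j ∈ Finset.univ.erase l, ∑' k : ℕ, μ j k ^ (-a) =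
      ∏ i : Fin s, ∑' k : ℕ, μ (l.succAbove i) k ^ (-a) := by
    have : (Finset.univ.erase l : Finset (Fin (s + 1))) =
        Finset.univ.map l.succAboveEmb := by
      ext j
      simp [Fin.exists_succAbove_eq_iff]
    rw [this, Finset.prod_map]
    rfl
  rw [hprod]
  set P : (Fin s → ℕ) → ℝ := fun u => ∏ i, μ (l.succAbove i) (u i) with hPdef
  have hP : ∀ u, 0 < P u := fun u => Finset.prod_pos (fun i _ => hμ0 _ _)
  have hPsum : ∀ q : ℝ, p < q → HasSum (fun u => P u ^ (-q))
      (∏ i : Fin s, ∑' k : ℕ, μ (l.succAbove i) k ^ (-q)) := by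
    intro q hq
    have := hasSum_pi_prod s (fun i k => μ (l.succAbove i) k ^ (-q))
      (fun i k => Real.rpow_nonneg (hμ0 _ _).le _)
      (fun i => weylData_summable (hm _) (hμ _ (Fin.succAbove_ne l i)) q
        (lt_of_le_of_lt (hple _ (Fin.succAbove_ne l i)) hq))
    convert this using 2 with u
    exact (Real.finsetProd_rpow _ _ (fun i _ => (hμ0 _ _).le) _).symm
  have hSa := hPsum a (lt_of_lt_of_le hcase hba)
  have hSb := hPsum b hcase
  set Za := ∏ i : Fin s, ∑' k : ℕ, μ (l.succAbove i) k ^ (-a)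
  set Zb := ∏ i : Fin s, ∑' k : ℕ, μ (l.succAbove i) k ^ (-b)
  -- uniform Weyl bound for all positive parameters
  have hunif : ∀ σ : ℝ, 0 < σ →
      |(Nat.card {j : ℕ | μ l j < σ} : ℝ) - C / n l * σ ^ a| ≤ (κ + C / n l) * σ ^ b := by
    intro σ hσ
    have hσb : 0 ≤ σ ^ b := Real.rpow_nonneg hσ.le _
    rcases lt_or_ge 1 σ with h | h
    · refine (hκb σ h).trans ?_
      have : 0 ≤ C / n l * σ ^ b := mul_nonneg hCn hσb
      linarith
    · have he : {j : ℕ | μ l j < σ} = ∅ := by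
        ext j
        simp only [Set.mem_ofPred_eq, Set.mem_empty_iff_false, iff_false, not_lt]
        exact h.trans (hμ1 l j).le
      rw [he]
      have h3 : σ ^ a ≤ σ ^ b := Real.rpow_le_rpow_of_exponent_ge hσ h hba
      have h4 : 0 ≤ σ ^ a := Real.rpow_nonneg hσ.le _
      simp only [Nat.card_eq_fintype_card, Fintype.card_eq_zero, Nat.cast_zero, zero_sub, abs_neg]
      rw [abs_of_nonneg (mul_nonneg hCn h4)]
      have h5 := mul_le_mul_of_nonneg_left h3 hCn
      have h6 : 0 ≤ κ * σ ^ b := mul_nonneg hκ.le hσb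
      linarith
  refine IsBigO.of_bound ((κ + C / n l) * Zb) ?_
  filter_upwards [eventually_gt_atTop 0] with τ hτ
  have hdiv : ∀ (q : ℝ) u, (τ / P u) ^ q = τ ^ q * P u ^ (-q) := by
    intro q u
    rw [Real.div_rpow hτ.le (hP u).le, Real.rpow_neg (hP u).le, div_eq_mul_inv]
  have hA : HasSum (fun u => C / n l * (τ / P u) ^ a) (C / n l * Za * τ ^ a) := by
    have h8 := hSa.mul_left (C / n l * τ ^ a)
    have h9 : (fun u => C / n l * (τ / P u) ^ a) =
        fun u => C / n l * τ ^ a * P u ^ (-a) := by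
      funext u
      rw [hdiv]; ring
    have h10 : C / n l * Za * τ ^ a = C / n l * τ ^ a * Za := by ring
    rw [h9, h10]
    exact h8
  have hB : HasSum (fun u => (κ + C / n l) * (τ / P u) ^ b) ((κ + C / n l) * Zb * τ ^ b) := by
    have h8 := hSb.mul_left ((κ + C / n l) * τ ^ b)
    have h9 : (fun u => (κ + C / n l) * (τ / P u) ^ b) =
        fun u => (κ + C / n l) * τ ^ b * P u ^ (-b) := by
      funext u
      rw [hdiv]; ring
    have h10 : (κ + C / n l) * Zb * τ ^ b = (κ + C / n l) * τ ^ b * Zb := by ring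
    rw [h9, h10]
    exact h8
  set c : (Fin s → ℕ) → ℝ := fun u => (Nat.card {k : ℕ | μ l k < τ / P u} : ℝ) with hc
  have hbound : ∀ u, ‖c u - C / n l * (τ / P u) ^ a‖ ≤ (κ + C / n l) * (τ / P u) ^ b :=
    fun u => hunif _ (div_pos hτ (hP u))
  have hdsum : Summable (fun u => c u - C / n l * (τ / P u) ^ a) :=
    Summable.of_norm_bounded hB.summable hbound
  have hcsum : Summable c := by
    have := hdsum.add hA.summable
    simpa using this
  have hcount : (Nat.card {t : Fin (s + 1) → ℕ | (∏ j, μ j (t j)) < τ} : ℝ) = ∑' u, c u := by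
    rw [Nat.card_congr (splitEquiv s μ l hμ1 τ)]
    have hfib : ∀ u, ∑' _ : {k : ℕ | μ l k < τ / P u}, (1 : ℝ) = c u := by
      intro u
      rw [tsum_const, nsmul_eq_mul, mul_one]
    have hS : Summable (fun _ : (Σ u : Fin s → ℕ, {k : ℕ | μ l k < τ / P u}) => (1 : ℝ)) := by
      rw [summable_sigma_of_nonneg (fun _ => zero_le_one)]
      refine ⟨fun u => ?_, ?_⟩
      · have : Finite {k : ℕ | μ l k < τ / P u} := hlfin _
        exact Summable.of_finite
      · simpa only [hfib] using hcsum
    have h7 := hS.tsum_sigma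
    simp only [hfib] at h7
    rw [← h7, tsum_const, nsmul_eq_mul, mul_one]
  have hfinal : ‖∑' u, (c u - C / n l * (τ / P u) ^ a)‖ ≤ (κ + C / n l) * Zb * τ ^ b :=
    tsum_of_norm_bounded hB hbound
  rw [hcsum.tsum_sub hA.summable, hA.tsum_eq] at hfinal
  rw [hcount, Real.norm_of_nonneg (Real.rpow_nonneg hτ.le b)]
  exact hfinal
end

section
/- Let r ≥ 2 be an integer, n_j ≥ 1 integers and m_j > 0 reals for j = 1,…,r, and suppose there is an index l with n_l/m_l > n_j/m_j for all j ≠ l. Let the sequence (μ^l_k)_{k∈ℕ} satisfy a sharp Weyl law with dimension n_l, order m_l and leading constant C_l > 0, and for j ≠ l let (μ^j_k)_{k∈ℕ} have Weyl counting data (n_j, m_j) with μ^j_k > 1 for all k. Set p = max_{j≠l} n_j/m_j and s = #{j ≠ l : n_j/m_j = p}, and assume p = (n_l−1)/m_l. Then each series ζ_j = Σ_{k∈ℕ} (μ^j_k)^{−n_l/m_l} (j ≠ l) converges and N(τ) = #{(k₁,…,k_r) ∈ ℕ^r : μ¹_{k₁}···μ^r_{k_r} < τ} satisfies N(τ) =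 (C_l/n_l)·(∏_{j≠l} ζ_j)·τ^{n_l/m_l} + O(τ^{(n_l−1)/m_l}·(log τ)^s) as τ → +∞. -/
open Filter Topology Asymptotics

/-- Polynomial counting bound of exponent `a`, in finset form. -/
def CountBd (a : ℝ) (ν : ℕ → ℝ) : Prop :=
  (∀ k, 1 < ν k) ∧ (∀ τ : ℝ, {k : ℕ | ν k < τ}.Finite) ∧
  ∃ K : ℝ, 0 < K ∧ ∀ τ : ℝ, 1 ≤ τ → ∀ S : Finset ℕ, (∀ k ∈ S, ν k < τ) →
    (S.card : ℝ) ≤ K * τ ^ a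

lemma WeylData.countBd {n : ℕ} {m : ℝ} {μ : ℕ → ℝ} (hn : 1 ≤ n) (hm : 0 < m)
    (h : WeylData n m μ) (h1 : ∀ k, 1 < μ k) : CountBd ((n : ℝ) / m) μ := by
  obtain ⟨-, K, hK, hb⟩ := h
  set B : ℕ → Set ℕ := fun i =>
    {k : ℕ | ((i : ℝ) + 1) ≤ μ k ^ (1 / m) ∧ μ k ^ (1 / m) ≤ ((i : ℝ) + 1) + 1} with hB
  have hBf : ∀ i, (B i).Finite := fun i => (hb (i + 1) (by linarith [(Nat.cast_nonneg i : (0:ℝ) ≤ i)])).1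
  have hBc : ∀ i, ((B i).ncard : ℝ) ≤ K * ((i : ℝ) + 1) ^ ((n : ℝ) - 1) := fun i =>
    (hb (i + 1) (by linarith [(Nat.cast_nonneg i : (0:ℝ) ≤ i)])).2
  -- covering
  have cov : ∀ τ : ℝ, 1 ≤ τ → ∀ k, μ k < τ →
      ∃ i ∈ Finset.range ⌊τ ^ (1 / m)⌋₊, k ∈ B i := by
    intro τ hτ k hk
    have hx1 : 1 ≤ μ k ^ (1 / m) := Real.one_le_rpow (h1 k).le (by positivity)
    have hxt : μ k ^ (1 / m) ≤ τ ^ (1 / m) :=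
      Real.rpow_le_rpow (by linarith [h1 k]) hk.le (by positivity)
    have hf1 : 1 ≤ ⌊μ k ^ (1 / m)⌋₊ := Nat.one_le_floor_iff _ |>.2 hx1
    have hff := Nat.floor_le_floor hxt
    refine ⟨⌊μ k ^ (1 / m)⌋₊ - 1, by simp only [Finset.mem_range]; omega, ?_⟩
    have h3 := Nat.floor_le (by linarith : 0 ≤ μ k ^ (1 / m))
    have h4 := Nat.lt_floor_add_one (μ k ^ (1 / m))
    simp only [hB, Set.mem_ofPred_eq]
    push_cast [hf1]
    constructor <;> linarith
  refine ⟨h1, ?_, K, hK, ?_⟩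
  · intro τ
    have : {k : ℕ | μ k < τ} ⊆ ⋃ i ∈ Finset.range ⌊(max τ 1) ^ (1 / m)⌋₊, B i := by
      intro k hk
      obtain ⟨i, hi, hk'⟩ := cov (max τ 1) (le_max_right _ _) k (lt_of_lt_of_le hk (le_max_left _ _))
      simp only [Set.mem_iUnion]
      exact ⟨i, hi, hk'⟩
    exact Set.Finite.subset (Set.Finite.biUnion (Finset.finite_toSet _) fun i _ => hBf i) this
  · intro τ hτ S hS
    set L := ⌊τ ^ (1 / m)⌋₊ with hL
    have hsub : S ⊆ (Finset.range L).biUnion fun i => (hBf i).toFinset := by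
      intro k hk
      obtain ⟨i, hi, hk'⟩ := cov τ hτ k (hS k hk)
      simp only [Finset.mem_biUnion, Set.Finite.mem_toFinset]
      exact ⟨i, hi, hk'⟩
    have hc : S.card ≤ ∑ i ∈ Finset.range L, (B i).ncard := by
      refine (Finset.card_le_card hsub).trans (Finset.card_biUnion_le.trans ?_)
      refine Finset.sum_le_sum fun i _ => ?_
      rw [Set.ncard_eq_toFinset_card _ (hBf i)]
    have hT : (1 : ℝ) ≤ τ ^ (1 / m) := Real.one_le_rpow hτ (by positivity)
    have hLT : (L : ℝ) ≤ τ ^ (1 / m) := Nat.floor_le (by linarith)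
    have hn' : (1 : ℝ) ≤ n := by exact_mod_cast hn
    calc (S.card : ℝ) ≤ ∑ i ∈ Finset.range L, ((B i).ncard : ℝ) := by exact_mod_cast hc
      _ ≤ ∑ i ∈ Finset.range L, K * (τ ^ (1 / m)) ^ ((n : ℝ) - 1) := by
        refine Finset.sum_le_sum fun i hi => (hBc i).trans ?_
        have : (i : ℝ) + 1 ≤ L := by
          have := Finset.mem_range.1 hi
          exact_mod_cast this
        gcongr
        · linarith
      _ = L * (K * (τ ^ (1 / m)) ^ ((n : ℝ) - 1)) := by simp
      _ ≤ τ ^ (1 / m) * (K * (τ ^ (1 / m)) ^ ((n : ℝ) - 1)) := by gcongr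
      _ = K * τ ^ ((n : ℝ) / m) := by
        have h0 : 0 < τ := by linarith
        rw [← Real.rpow_mul h0.le, mul_left_comm, ← Real.rpow_add h0]
        congr 2
        field_simp
        ring

lemma block_sum {a b K x : ℝ} {ν : ℕ → ℝ} (ha : 0 ≤ a) (hb : 0 ≤ b) (hx : 1 ≤ x)
    (hK : ∀ τ : ℝ, 1 ≤ τ → ∀ S : Finset ℕ, (∀ k ∈ S, ν k < τ) → (S.card : ℝ) ≤ K * τ ^ a)
    (I : ℕ) : ∀ S : Finset ℕ, (∀ k ∈ S, x ≤ ν k ∧ ν k < x * 2 ^ I) →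
      ∑ k ∈ S, ν k ^ (-b) ≤ K * 2 ^ a * ∑ i ∈ Finset.range I, (x * 2 ^ i) ^ (a - b) := by
  induction I with
  | zero =>
    intro S hS
    have : S = ∅ := by
      refine Finset.eq_empty_of_forall_notMem fun k hk => ?_
      have := hS k hk
      simp at this
      linarith
    simp [this]
  | succ I ih =>
    intro S hS
    rw [← Finset.sum_filter_add_sum_filter_not S (fun k => ν k < x * 2 ^ I),
      Finset.sum_range_succ, mul_add]
    have hy : 1 ≤ x * 2 ^ I := by
      have : (1 : ℝ) ≤ 2 ^ I := one_le_pow₀ (by norm_num)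
      nlinarith
    have hy0 : 0 < x * 2 ^ I := by linarith
    refine add_le_add (ih _ fun k hk => ?_) ?_
    · rw [Finset.mem_filter] at hk
      exact ⟨(hS k hk.1).1, hk.2⟩
    · have hc := hK (x * 2 ^ I * 2) (by linarith) (S.filter fun k => ¬ ν k < x * 2 ^ I) (by
        intro k hk
        rw [Finset.mem_filter] at hk
        have := (hS k hk.1).2
        rw [pow_succ, ← mul_assoc] at this
        exact this)
      calc _ ≤ ∑ k ∈ S.filter (fun k => ¬ ν k < x * 2 ^ I), (x * 2 ^ I) ^ (-b) := by
            refine Finset.sum_le_sum fun k hk => ?_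
            rw [Finset.mem_filter, not_lt] at hk
            exact Real.rpow_le_rpow_of_nonpos hy0 hk.2 (by linarith)
        _ = (S.filter fun k => ¬ ν k < x * 2 ^ I).card * (x * 2 ^ I) ^ (-b) := by simp
        _ ≤ K * (x * 2 ^ I * 2) ^ a * (x * 2 ^ I) ^ (-b) := by gcongr
        _ = _ := by
          rw [Real.mul_rpow hy0.le (by norm_num), sub_eq_add_neg, Real.rpow_add hy0]
          ring

lemma CountBd.tail {a b : ℝ} {ν : ℕ → ℝ} (h : CountBd a ν) (ha : 0 ≤ a) (hab : a < b) :
    ∃ K : ℝ, 0 < K ∧ ∀ x : ℝ, 1 ≤ x → ∀ S : Finset ℕ, (∀ k ∈ S, x ≤ ν k) →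
      ∑ k ∈ S, ν k ^ (-b) ≤ K * x ^ (a - b) := by
  obtain ⟨h1, -, K, hK0, hK⟩ := h
  have hq0 : (0 : ℝ) < 2 ^ (a - b) := by positivity
  have hq1 : (2 : ℝ) ^ (a - b) < 1 := Real.rpow_lt_one_of_one_lt_of_neg (by norm_num) (by linarith)
  have hq2 : 0 < 1 - (2 : ℝ) ^ (a - b) := by linarith
  refine ⟨K * 2 ^ a * (1 - 2 ^ (a - b))⁻¹, by positivity, fun x hx S hS => ?_⟩
  obtain ⟨I, hI⟩ := pow_unbounded_of_one_lt (∑ k ∈ S, ν k) (by norm_num : (1 : ℝ) < 2)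
  have hlt : ∀ k ∈ S, ν k < x * 2 ^ I := by
    intro k hk
    have h2 : ν k ≤ ∑ k ∈ S, ν k :=
      Finset.single_le_sum (f := ν) (fun i _ => by linarith [h1 i]) hk
    have : (0 : ℝ) < 2 ^ I := by positivity
    nlinarith
  refine (block_sum ha (by linarith) hx hK I S fun k hk => ⟨hS k hk, hlt k hk⟩).trans ?_
  have : ∑ i ∈ Finset.range I, (x * 2 ^ i) ^ (a - b)
      = x ^ (a - b) * ∑ i ∈ Finset.range I, ((2 : ℝ) ^ (a - b)) ^ i := by
    rw [Finset.mul_sum]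
    refine Finset.sum_congr rfl fun i _ => ?_
    rw [Real.mul_rpow (by linarith) (by positivity), ← Real.rpow_natCast, ← Real.rpow_natCast,
      ← Real.rpow_mul (by norm_num), ← Real.rpow_mul (by norm_num), mul_comm (i : ℝ)]
  rw [this]
  have hg : ∑ i ∈ Finset.range I, ((2 : ℝ) ^ (a - b)) ^ i ≤ (1 - 2 ^ (a - b))⁻¹ := by
    rw [← tsum_geometric_of_lt_one hq0.le hq1]
    exact (summable_geometric_of_lt_one hq0.le hq1).sum_le_tsum _ (fun i _ => by positivity)
  have hx0 : 0 < x ^ (a - b) := Real.rpow_pos_of_pos (by linarith) _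
  calc _ ≤ K * 2 ^ a * (x ^ (a - b) * (1 - 2 ^ (a - b))⁻¹) := by gcongr
    _ = _ := by ring

lemma CountBd.summable {a b : ℝ} {ν : ℕ → ℝ} (h : CountBd a ν) (ha : 0 ≤ a) (hab : a < b) :
    Summable fun k => ν k ^ (-b) := by
  obtain ⟨K, hK, hb⟩ := h.tail ha hab
  refine summable_of_sum_le (c := K * 1 ^ (a - b)) (fun k => ?_) fun S => ?_
  · exact Real.rpow_nonneg (by linarith [h.1 k]) _
  · exact hb 1 le_rfl S fun k _ => (h.1 k).le

lemma CountBd.log_sum {a p : ℝ} {ν : ℕ → ℝ} (h : CountBd a ν) (ha : 0 ≤ a) (hap : a ≤ p) :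
    ∃ K : ℝ, 0 < K ∧ ∀ τ : ℝ, 1 < τ → ∀ S : Finset ℕ, (∀ k ∈ S, ν k < τ) →
      ∑ k ∈ S, ν k ^ (-p) ≤ K * (1 + Real.log τ) ^ (if a = p then 1 else 0) := by
  rcases hap.lt_or_eq with hlt | rfl
  · obtain ⟨K, hK, hb⟩ := h.tail ha hlt
    refine ⟨K, hK, fun τ hτ S hS => ?_⟩
    simpa [hlt.ne] using hb 1 le_rfl S fun k _ => (h.1 k).le
  · obtain ⟨h1, -, K, hK0, hK⟩ := h
    refine ⟨K * 2 ^ a * 2, by positivity, fun τ hτ S hS => ?_⟩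
    have hl : 0 < Real.log τ := Real.log_pos hτ
    have hl2 := Real.log_two_gt_d9
    have hIlt := Nat.ceil_lt_add_one (a := Real.log τ / Real.log 2) (by positivity)
    have hIle := Nat.le_ceil (Real.log τ / Real.log 2)
    set I := ⌈Real.log τ / Real.log 2⌉₊ with hI
    have hτI : τ ≤ 2 ^ I := by
      rw [div_le_iff₀ (by linarith)] at hIle
      rw [← Real.log_le_log_iff (by linarith) (by positivity), Real.log_pow]
      exact hIle
    have hI2 : (I : ℝ) ≤ 2 * (1 + Real.log τ) := by
      have : Real.log τ / Real.log 2 ≤ 2 * Real.log τ := by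
        rw [div_le_iff₀ (by linarith)]; nlinarith
      linarith
    have := block_sum ha ha le_rfl hK I S fun k hk =>
      ⟨(h1 k).le, by rw [one_mul]; exact (hS k hk).trans_le hτI⟩
    simp only [sub_self, Real.rpow_zero, Finset.sum_const, Finset.card_range, nsmul_eq_mul,
      mul_one] at this
    simp only [if_true, pow_one]
    calc _ ≤ _ := this
      _ ≤ K * 2 ^ a * (2 * (1 + Real.log τ)) := by gcongr
      _ = _ := by ring

/-- Two-term Weyl asymptotics with a logarithmic error for weights on an index type. -/
def LogWeyl {A : Type} (w : A → ℝ) (q p c : ℝ) (s : ℕ) : Prop :=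
  (∀ x, 1 < w x) ∧ (∀ τ : ℝ, {x : A | w x < τ}.Finite) ∧
  ∃ κ : ℝ, 0 < κ ∧ ∀ τ : ℝ, 1 < τ →
    |(Nat.card {x : A | w x < τ} : ℝ) - c * τ ^ q| ≤ κ * (τ ^ p * (1 + Real.log τ) ^ s)

lemma LogWeyl.equiv {A B : Type} {w : A → ℝ} {v : B → ℝ} {q p c : ℝ} {s : ℕ}
    (h : LogWeyl w q p c s) (e : B ≃ A) (hv : ∀ y, v y = w (e y)) : LogWeyl v q p c s := by
  obtain rfl : v = w ∘ e := funext hv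
  obtain ⟨h1, hf, κ, hκ, hb⟩ := h
  refine ⟨fun y => h1 _, fun τ => (hf τ).preimage e.injective.injOn, κ, hκ, fun τ hτ => ?_⟩
  have : Nat.card {y : B | (w ∘ e) y < τ} = Nat.card {x : A | w x < τ} :=
    Nat.card_congr (e.subtypeEquiv fun y => Iff.rfl)
  rw [this]
  exact hb τ hτ

lemma LogWeyl.step {A : Type} {w : A → ℝ} {q p c a : ℝ} {s : ℕ} {ν : ℕ → ℝ}
    (h : LogWeyl w q p c s) (hc : 0 ≤ c) (hν : CountBd a ν) (ha : 0 ≤ a) (hap : a ≤ p)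
    (hpq : p < q) :
    LogWeyl (fun x : A × ℕ => w x.1 * ν x.2) q p (c * ∑' k, ν k ^ (-q))
      (s + if a = p then 1 else 0) := by
  obtain ⟨h1, hf, κ, hκ, hb⟩ := h
  obtain ⟨K₁, hK₁, hlog⟩ := hν.log_sum ha hap
  obtain ⟨K₂, hK₂, htail⟩ := hν.tail ha (hap.trans_lt hpq)
  have hsum := hν.summable ha (hap.trans_lt hpq)
  have hν1 := hν.1
  have hν0 : ∀ k, 0 < ν k := fun k => by linarith [hν1 k]
  have hνf := hν.2.1
  have hmem : ∀ τ : ℝ, ∀ x : A × ℕ, w x.1 * ν x.2 < τ → ν x.2 < τ := by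
    intro τ x hx
    nlinarith [h1 x.1, hν0 x.2]
  refine ⟨fun x => ?_, fun τ => ?_, κ * K₁ + c * K₂, by positivity, fun τ hτ => ?_⟩
  · nlinarith [h1 x.1, hν1 x.2]
  · refine Set.Finite.subset ((hf τ).prod (hνf τ)) fun x hx => ⟨?_, hmem τ x hx⟩
    simp only [Set.mem_ofPred_eq] at hx ⊢
    nlinarith [h1 x.1, hν1 x.2]
  · have hτ0 : 0 < τ := by linarith
    have hl : 0 < Real.log τ := Real.log_pos hτ
    set F := (hνf τ).toFinset with hF
    have hFm : ∀ k, k ∈ F ↔ ν k < τ := fun k => by simp [hF]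
    -- the counting identity
    have hcard : Nat.card {x : A × ℕ | w x.1 * ν x.2 < τ}
        = ∑ k ∈ F, Nat.card {x : A | w x < τ / ν k} := by
      have e : {x : A × ℕ | w x.1 * ν x.2 < τ} ≃
          (Σ k : F, {x : A | w x < τ / ν k}) :=
        { toFun := fun x => ⟨⟨x.1.2, (hFm _).2 (hmem τ x.1 x.2)⟩,
            ⟨x.1.1, (lt_div_iff₀ (hν0 _)).2 x.2⟩⟩
          invFun := fun y => ⟨(y.2.1, y.1.1), (lt_div_iff₀ (hν0 _)).1 y.2.2⟩
          left_inv := fun x => rfl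
          right_inv := fun y => rfl }
      have : ∀ k : F, Finite {x : A | w x < τ / ν k} := fun k => (hf _).to_subtype
      rw [Nat.card_congr e, Nat.card_sigma, Finset.sum_coe_sort F
        (fun k => Nat.card {x : A | w x < τ / ν k})]
    have hsplit := hsum.sum_add_tsum_compl (s := F)
    set T := ∑' k : ↑((F : Set ℕ)ᶜ), ν k ^ (-q) with hT
    have hT0 : 0 ≤ T := tsum_nonneg fun k => Real.rpow_nonneg (hν0 _).le _
    have hTle : T ≤ K₂ * τ ^ (a - q) := by
      refine (hsum.subtype _).tsum_le_of_sum_le fun S => ?_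
      have := htail τ hτ.le (S.map (Function.Embedding.subtype _)) (by
        intro k hk
        simp only [Finset.mem_map, Function.Embedding.coe_subtype] at hk
        obtain ⟨y, -, rfl⟩ := hk
        have := y.2
        simp only [Set.mem_compl_iff, Finset.mem_coe, hFm, not_lt] at this
        exact this)
      rw [Finset.sum_map] at this
      exact this
    have hpow : ∀ k, (τ / ν k) ^ q = τ ^ q * ν k ^ (-q) := fun k => by
      rw [Real.div_rpow hτ0.le (hν0 k).le, Real.rpow_neg (hν0 k).le, div_eq_mul_inv]
    have hpowp : ∀ k, (τ / ν k) ^ p = τ ^ p * ν k ^ (-p) := fun k => by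
      rw [Real.div_rpow hτ0.le (hν0 k).le, Real.rpow_neg (hν0 k).le, div_eq_mul_inv]
    have key : (Nat.card {x : A × ℕ | w x.1 * ν x.2 < τ} : ℝ) - c * (∑' k, ν k ^ (-q)) * τ ^ q
        = ∑ k ∈ F, ((Nat.card {x : A | w x < τ / ν k} : ℝ) - c * (τ / ν k) ^ q)
          - c * (T * τ ^ q) := by
      rw [hcard, ← hsplit, Finset.sum_sub_distrib]
      simp only [hpow]
      rw [← Finset.mul_sum, ← Finset.mul_sum]
      push_cast
      ring
    rw [key]
    set R := τ ^ p * (1 + Real.log τ) ^ (s + if a = p then 1 else 0) with hR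
    have hone : (1 : ℝ) ≤ (1 + Real.log τ) ^ (s + if a = p then 1 else 0) :=
      one_le_pow₀ (by linarith)
    have hA : |∑ k ∈ F, ((Nat.card {x : A | w x < τ / ν k} : ℝ) - c * (τ / ν k) ^ q)|
        ≤ κ * K₁ * R := by
      calc _ ≤ ∑ k ∈ F, |(Nat.card {x : A | w x < τ / ν k} : ℝ) - c * (τ / ν k) ^ q| :=
            Finset.abs_sum_le_sum_abs _ _
        _ ≤ ∑ k ∈ F, κ * (τ ^ p * (1 + Real.log τ) ^ s) * ν k ^ (-p) := by
            refine Finset.sum_le_sum fun k hk => ?_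
            have hgt : 1 < τ / ν k := (one_lt_div (hν0 k)).2 ((hFm k).1 hk)
            refine (hb _ hgt).trans ?_
            have hl1 : 0 < Real.log (τ / ν k) := Real.log_pos hgt
            have hl2 : Real.log (τ / ν k) ≤ Real.log τ := by
              refine Real.log_le_log (by linarith) (div_le_self hτ0.le (hν1 k).le)
            have hn0 : 0 ≤ ν k ^ (-p) := Real.rpow_nonneg (hν0 k).le _
            rw [hpowp]
            calc _ ≤ κ * (τ ^ p * ν k ^ (-p) * (1 + Real.log τ) ^ s) := by gcongr
              _ = _ := by ring
        _ = κ * (τ ^ p * (1 + Real.log τ) ^ s) * ∑ k ∈ F, ν k ^ (-p) := by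
            rw [Finset.mul_sum]
        _ ≤ κ * (τ ^ p * (1 + Real.log τ) ^ s) *
            (K₁ * (1 + Real.log τ) ^ (if a = p then 1 else 0)) := by
            gcongr
            exact hlog τ hτ F fun k hk => (hFm k).1 hk
        _ = _ := by rw [hR, pow_add]; ring
    have hB : |c * (T * τ ^ q)| ≤ c * K₂ * R := by
      rw [abs_of_nonneg (by positivity)]
      calc c * (T * τ ^ q) ≤ c * (K₂ * τ ^ (a - q) * τ ^ q) := by gcongr
        _ = c * K₂ * τ ^ a := by
            rw [mul_assoc K₂, ← Real.rpow_add hτ0, sub_add_cancel]; ring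
        _ ≤ c * K₂ * τ ^ p := by
            gcongr
            exact hτ.le
        _ ≤ c * K₂ * R := by
            gcongr
            rw [hR]
            exact le_mul_of_one_le_right (by positivity) hone
    calc _ ≤ _ := abs_sub _ _
      _ ≤ κ * K₁ * R + c * K₂ * R := add_le_add hA hB
      _ = _ := by ring

lemma LogWeyl.pi {w : ℕ → ℝ} {q p c : ℝ} (hc : 0 ≤ c) (h : LogWeyl w q p c 0) (hpq : p < q)
    (d : ℕ) : ∀ (a : Fin d → ℝ) (ν : Fin d → ℕ → ℝ), (∀ i, CountBd (a i) (ν i)) →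
      (∀ i, 0 ≤ a i) → (∀ i, a i ≤ p) →
      LogWeyl (fun x : ℕ × (Fin d → ℕ) => w x.1 * ∏ i, ν i (x.2 i)) q p
        (c * ∏ i, ∑' k, ν i k ^ (-q)) (∑ i, if a i = p then 1 else 0) := by
  induction d with
  | zero =>
    intro a ν _ _ _
    simp only [Finset.univ_eq_empty, Finset.prod_empty, Finset.sum_empty, mul_one]
    exact h.equiv (Equiv.prodUnique ℕ (Fin 0 → ℕ)) fun y => rfl
  | succ d ih =>
    intro a ν hν ha hap
    have h0 := ih (fun i => a i.succ) (fun i => ν i.succ) (fun i => hν _) (fun i => ha _)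
      (fun i => hap _)
    have hnn : 0 ≤ c * ∏ i : Fin d, ∑' k, ν i.succ k ^ (-q) := by
      refine mul_nonneg hc (Finset.prod_nonneg fun i _ => tsum_nonneg fun k => ?_)
      exact Real.rpow_nonneg (by linarith [(hν i.succ).1 k]) _
    have h2 := (h0.step hnn (hν 0) (ha 0) (hap 0) hpq).equiv
      (B := ℕ × (Fin (d + 1) → ℕ)) (v := fun x => w x.1 * ∏ i, ν i (x.2 i))
      { toFun := fun x => ((x.1, fun i => x.2 i.succ), x.2 0)
        invFun := fun y => (y.1.1, Fin.cons y.2 y.1.2)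
        left_inv := fun x => by
          refine Prod.ext rfl ?_
          exact Fin.cons_self_tail x.2
        right_inv := fun y => by simp }
      (fun y => by
        simp only [Equiv.coe_fn_mk]
        rw [Fin.prod_univ_succ]
        ring)
    rw [Fin.prod_univ_succ, Fin.sum_univ_succ, add_comm (if a 0 = p then 1 else 0),
      mul_comm (∑' k, ν 0 k ^ (-q)), ← mul_assoc]
    exact h2

theorem tensor_weyl_r_factors_case_two (r : ℕ) (hr : 2 ≤ r)
    (n : Fin r → ℕ) (m : Fin r → ℝ) (μ : Fin r → ℕ → ℝ)
    (l : Fin r) (C : ℝ) (hC : 0 < C)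
    (hn : ∀ j, 1 ≤ n j) (hm : ∀ j, 0 < m j)
    (hdom : ∀ j, j ≠ l → (n j : ℝ) / m j < (n l : ℝ) / m l)
    (hl : SharpWeyl (n l) (m l) C (μ l))
    (hμ : ∀ j, j ≠ l → WeylData (n j) (m j) (μ j)) (hμ1 : ∀ j k, 1 < μ j k)
    (p : ℝ) (hple : ∀ j, j ≠ l → (n j : ℝ) / m j ≤ p)
    (hpmem : ∃ j, j ≠ l ∧ (n j : ℝ) / m j = p)
    (s : ℕ) (hs : s = Nat.card {j : Fin r | j ≠ l ∧ (n j : ℝ) / m j = p})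
    (hcase : p = ((n l : ℝ) - 1) / m l) :
    (∀ j, j ≠ l → Summable (fun k : ℕ => μ j k ^ (-((n l : ℝ) / m l)))) ∧
    (fun τ : ℝ => (Nat.card {t : Fin r → ℕ | (∏ j, μ j (t j)) < τ} : ℝ) -
        C / n l * (∏ j ∈ Finset.univ.erase l, ∑' k : ℕ, μ j k ^ (-((n l : ℝ) / m l))) *
          τ ^ ((n l : ℝ) / m l)) =O[atTop]
      (fun τ : ℝ => τ ^ (((n l : ℝ) - 1) / m l) * Real.log τ ^ s) := by
  have hcb : ∀ j, j ≠ l → CountBd ((n j : ℝ) / m j) (μ j) := fun j hj =>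
    (hμ j hj).countBd (hn j) (hm j) (hμ1 j)
  have ha0 : ∀ j, 0 ≤ (n j : ℝ) / m j := fun j => div_nonneg (Nat.cast_nonneg _) (hm j).le
  refine ⟨fun j hj => (hcb j hj).summable (ha0 j) (hdom j hj), ?_⟩
  rw [← hcase]
  have hpq : p < (n l : ℝ) / m l := by
    rw [hcase]
    exact div_lt_div_of_pos_right (by linarith) (hm l)
  have hbase : LogWeyl (μ l) ((n l : ℝ) / m l) p (C / n l) 0 := by
    obtain ⟨h1, hf, κ, hκ, hb⟩ := hl
    refine ⟨h1, hf, κ, hκ, fun τ hτ => ?_⟩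
    rw [pow_zero, mul_one, hcase]
    exact hb τ hτ
  obtain ⟨d, rfl⟩ : ∃ d, r = d + 1 := ⟨r - 1, by omega⟩
  have hmain := hbase.pi (div_nonneg hC.le (Nat.cast_nonneg _)) hpq d
    (fun i => (n (l.succAbove i) : ℝ) / m (l.succAbove i)) (fun i => μ (l.succAbove i))
    (fun i => hcb _ (Fin.succAbove_ne l i)) (fun i => ha0 _)
    (fun i => hple _ (Fin.succAbove_ne l i))
  have hmain2 := hmain.equiv (v := fun t : Fin (d + 1) → ℕ => ∏ j, μ j (t j))
    (Fin.insertNthEquiv (fun _ => ℕ) l).symm (fun t => by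
      rw [Fin.prod_univ_succAbove _ l]
      rfl)
  have hprod : ∏ j ∈ Finset.univ.erase l, ∑' k : ℕ, μ j k ^ (-((n l : ℝ) / m l))
      = ∏ i, ∑' k : ℕ, μ (l.succAbove i) k ^ (-((n l : ℝ) / m l)) := by
    rw [← Finset.compl_singleton, ← Fin.image_succAbove_univ,
      Finset.prod_image (Fin.succAbove_right_injective.injOn)]
  have hsum : s = ∑ i : Fin d,
      if (n (l.succAbove i) : ℝ) / m (l.succAbove i) = p then 1 else 0 := by
    rw [hs]
    have hset : {j : Fin (d + 1) | j ≠ l ∧ (n j : ℝ) / m j = p} =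
        (((Finset.univ.erase l).filter fun j => (n j : ℝ) / m j = p : Finset (Fin (d + 1))) :
          Set (Fin (d + 1))) := by
      ext j; simp
    rw [hset, Nat.card_coe_set_eq, Set.ncard_coe_finset, Finset.card_filter,
      ← Finset.compl_singleton, ← Fin.image_succAbove_univ,
      Finset.sum_image (Fin.succAbove_right_injective.injOn)]
  rw [hprod]
  rw [← hsum] at hmain2
  obtain ⟨-, -, κ, hκ, hb⟩ := hmain2
  refine IsBigO.of_bound (κ * 2 ^ s) ?_
  filter_upwards [eventually_ge_atTop (Real.exp 1)] with τ hτ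
  have hτ1 : 1 < τ := lt_of_lt_of_le (by simp) hτ
  have hlog : 1 ≤ Real.log τ := by
    rw [Real.le_log_iff_exp_le (by linarith)]; exact hτ
  have hτp : 0 ≤ τ ^ p := Real.rpow_nonneg (by linarith) _
  rw [Real.norm_eq_abs, Real.norm_of_nonneg (by positivity)]
  calc _ ≤ _ := hb τ hτ1
    _ ≤ κ * (τ ^ p * (2 * Real.log τ) ^ s) := by
      gcongr
      linarith
    _ = _ := by rw [mul_pow]; ring
end

section
/- Let r ≥ 2 be an integer, n_j ≥ 1 integers and m_j > 0 reals for j = 1,…,r, and suppose there is an index l with n_l/m_l > n_j/m_j for all j ≠ l. Let the sequence (μ^l_k)_{k∈ℕ} satisfy a sharp Weyl law with dimension n_l, order m_l and leading constant C_l > 0, and for j ≠ l let (μ^j_k)_{k∈ℕ} have Weyl counting data (n_j, m_j) with μ^j_k > 1 for all k. Set p = max_{j≠l} n_j/m_j and s = #{j ≠ l : n_j/m_j = p}, and assume p > (n_l−1)/m_l. Then each series ζ_j = Σ_{k∈ℕ} (μ^j_k)^{−n_l/m_l} (j ≠ l) converges and N(τ) = #{(k₁,…,k_r) ∈ ℕ^r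 : μ¹_{k₁}···μ^r_{k_r} < τ} satisfies N(τ) = (C_l/n_l)·(∏_{j≠l} ζ_j)·τ^{n_l/m_l} + O(τ^{p}·(log τ)^{s−1}) as τ → +∞. -/
open Filter Topology Asymptotics

open scoped ENNReal

theorem tsum_pi_prod_aux {ι : Type} [Fintype ι] :
    ∀ F : ι → ℕ → ℝ≥0∞, ∑' t : ι → ℕ, ∏ i, F i (t i) = ∏ i, ∑' k, F i k := by
  refine Fintype.induction_empty_option
    (P := fun ι _ => ∀ F : ι → ℕ → ℝ≥0∞, ∑' t : ι → ℕ, ∏ i, F i (t i) = ∏ i, ∑' k, F i k)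
    ?_ ?_ ?_ ι
  · intro α β _ e h F
    let _ := Fintype.ofEquiv β e.symm
    have h1 := h (fun i => F (e i))
    rw [← (Equiv.arrowCongr e (Equiv.refl ℕ)).tsum_eq (fun t : β → ℕ => ∏ i, F i (t i))]
    rw [← e.prod_comp (fun i => ∑' k, F i k)]
    rw [← h1]
    refine tsum_congr fun t => ?_
    rw [← e.prod_comp]
    simp
  · intro F
    simp
  · intro α _ h F
    rw [Fintype.prod_option, ← h, ← Equiv.piOptionEquivProd.symm.tsum_eq, ENNReal.tsum_prod']
    simp only [Fintype.prod_option]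
    rw [← ENNReal.tsum_mul_right]
    refine tsum_congr fun k => ?_
    rw [← ENNReal.tsum_mul_left]
    refine tsum_congr fun t => ?_
    simp [Equiv.piOptionEquivProd]

theorem count_aux {n : ℕ} {m : ℝ} {μ : ℕ → ℝ} (hn : 1 ≤ n) (hm : 0 < m)
    (h : WeylData n m μ) (h1 : ∀ k, 1 < μ k) :
    ∃ D : ℝ, 0 < D ∧ ∀ τ : ℝ, 0 < τ →
      ((Set.encard {k | μ k < τ} : ℕ∞) : ℝ≥0∞) ≤ ENNReal.ofReal (D * τ ^ ((n : ℝ) / m)) := by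
  obtain ⟨-, K, hK, hc⟩ := h
  refine ⟨K, hK, fun τ hτ => ?_⟩
  rcases le_or_gt τ 1 with hτ1 | hτ1
  · have : {k | μ k < τ} = ∅ := by
      ext k
      simp only [Set.mem_ofPred_eq, Set.mem_empty_iff_false, iff_false, not_lt]
      linarith [h1 k]
    simp [this]
  set x := τ ^ (1 / m) with hx
  have hx1 : 1 < x := Real.one_lt_rpow hτ1 (by positivity)
  let A : ℕ → Set ℕ := fun i => {k : ℕ | ((i : ℝ)) ≤ μ k ^ (1 / m) ∧ μ k ^ (1 / m) ≤ (i : ℝ) + 1}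
  have hsub : {k | μ k < τ} ⊆ ⋃ i ∈ Finset.Icc 1 ⌊x⌋₊, A i := by
    intro k hk
    have hk1 : 1 < μ k ^ (1 / m) := Real.one_lt_rpow (h1 k) (by positivity)
    have hk2 : μ k ^ (1 / m) < x :=
      Real.rpow_lt_rpow (by linarith [h1 k]) hk (by positivity)
    simp only [Set.mem_iUnion]
    refine ⟨⌊μ k ^ (1 / m)⌋₊, ?_, ?_, ?_⟩
    · rw [Finset.mem_Icc]
      exact ⟨Nat.le_floor (by simpa using hk1.le), Nat.floor_le_floor hk2.le⟩
    · exact Nat.floor_le (by positivity)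
    · exact (Nat.lt_floor_add_one _).le
  have hfin : ∀ i ∈ Finset.Icc 1 ⌊x⌋₊, (A i).Finite := fun i hi =>
    (hc i (by exact_mod_cast (Finset.mem_Icc.1 hi).1)).1
  have hUfin : (⋃ i ∈ Finset.Icc 1 ⌊x⌋₊, A i).Finite := Set.Finite.biUnion (Finset.finite_toSet _) hfin
  have hSfin := hUfin.subset hsub
  have hcard : (Set.ncard {k | μ k < τ} : ℝ) ≤ K * τ ^ ((n : ℝ) / m) := by
    have e1 : Set.ncard {k | μ k < τ} ≤ ∑ i ∈ Finset.Icc 1 ⌊x⌋₊, (A i).ncard :=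
      (Set.ncard_le_ncard hsub hUfin).trans (Finset.set_ncard_biUnion_le _ _)
    have e2 : ∀ i ∈ Finset.Icc 1 ⌊x⌋₊, ((A i).ncard : ℝ) ≤ K * x ^ ((n : ℝ) - 1) := by
      intro i hi
      have hi' := Finset.mem_Icc.1 hi
      have hi1 : (1 : ℝ) ≤ i := by exact_mod_cast hi'.1
      refine ((hc i hi1).2).trans ?_
      have : (i : ℝ) ≤ x := (Nat.le_floor_iff (by linarith)).1 hi'.2
      have hn' : (1 : ℝ) ≤ n := by exact_mod_cast hn
      gcongr
    calc (Set.ncard {k | μ k < τ} : ℝ) ≤ ∑ i ∈ Finset.Icc 1 ⌊x⌋₊, ((A i).ncard : ℝ) := by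
          exact_mod_cast e1
      _ ≤ ∑ i ∈ Finset.Icc 1 ⌊x⌋₊, K * x ^ ((n : ℝ) - 1) := Finset.sum_le_sum e2
      _ = ⌊x⌋₊ * (K * x ^ ((n : ℝ) - 1)) := by simp
      _ ≤ x * (K * x ^ ((n : ℝ) - 1)) := by
          gcongr
          exact Nat.floor_le (by linarith)
      _ = K * x ^ (n : ℝ) := by
          rw [Real.rpow_sub_one (by linarith)]
          field_simp
      _ = K * τ ^ ((n : ℝ) / m) := by
          rw [hx, ← Real.rpow_mul hτ.le]
          congr 2
          ring
  rw [← hSfin.cast_ncard_eq]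
  rw [ENat.toENNReal_coe, ← ENNReal.ofReal_natCast]
  exact ENNReal.ofReal_le_ofReal hcard

theorem block_aux {γ : Type} {μ : ℕ → ℝ} {D q : ℝ}
    (hF : ∀ τ : ℝ, 0 < τ →
      ((Set.encard {k | μ k < τ} : ℕ∞) : ℝ≥0∞) ≤ ENNReal.ofReal (D * τ ^ q))
    (blk : ℕ → γ) (U : γ → ℝ) (hU : ∀ i, 0 < U i) (hblk : ∀ k, μ k < U (blk k))
    (φ : ℕ → ℝ≥0∞) (c : γ → ℝ≥0∞) (hc : ∀ k, φ k ≤ c (blk k)) :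
    ∑' k, φ k ≤ ∑' i, c i * ENNReal.ofReal (D * U i ^ q) := by
  rw [← ENNReal.tsum_fiberwise φ blk]
  refine ENNReal.tsum_le_tsum fun i => ?_
  calc ∑' k : (blk ⁻¹' {i}), φ k ≤ ∑' k : (blk ⁻¹' {i}), c i := by
        refine ENNReal.tsum_le_tsum fun k => ?_
        have := hc k
        rwa [show blk k = i from k.2] at this
    _ = c i * ((blk ⁻¹' {i}).encard : ℕ∞) := by
        rw [ENNReal.tsum_set_const, mul_comm]
    _ ≤ c i * ENNReal.ofReal (D * U i ^ q) := by
        gcongr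
        refine le_trans ?_ (hF _ (hU i))
        have : blk ⁻¹' {i} ⊆ {k | μ k < U i} := by
          intro k hk
          have := hblk k
          rwa [show blk k = i from hk] at this
        exact_mod_cast Set.encard_le_encard this

theorem zeta_aux {μ : ℕ → ℝ} {D q : ℝ} (hD : 0 < D) (h1 : ∀ k, 1 < μ k)
    (hF : ∀ τ : ℝ, 0 < τ →
      ((Set.encard {k | μ k < τ} : ℕ∞) : ℝ≥0∞) ≤ ENNReal.ofReal (D * τ ^ q))
    {σ : ℝ} (hσ : q < σ) (hσ0 : 0 ≤ σ) :
    ∑' k, ENNReal.ofReal (μ k ^ (-σ)) ≤ ENNReal.ofReal (D * Real.exp q * (1 + 1 / (σ - q))) := by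
  have hb := block_aux (γ := ℕ) hF (fun k => ⌊Real.log (μ k)⌋₊) (fun i => Real.exp (i + 1))
    (fun i => Real.exp_pos _) (fun k => by
      have : 0 < μ k := by linarith [h1 k]
      rw [← Real.log_lt_iff_lt_exp this]
      exact Nat.lt_floor_add_one _)
    (fun k => ENNReal.ofReal (μ k ^ (-σ))) (fun i => ENNReal.ofReal (Real.exp (-σ * i)))
    (fun k => by
      have : 0 < μ k := by linarith [h1 k]
      apply ENNReal.ofReal_le_ofReal
      rw [Real.rpow_def_of_pos this, Real.exp_le_exp]
      have := Nat.floor_le (Real.log_nonneg (h1 k).le)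
      nlinarith)
  refine hb.trans ?_
  have hr : Real.exp (-(σ - q)) < 1 := by rw [Real.exp_lt_one_iff]; linarith
  have e : ∀ i : ℕ, ENNReal.ofReal (Real.exp (-σ * i)) * ENNReal.ofReal (D * Real.exp (i + 1) ^ q)
      = ENNReal.ofReal (D * Real.exp q * Real.exp (-(σ - q)) ^ i) := by
    intro i
    rw [← ENNReal.ofReal_mul (Real.exp_pos _).le]
    congr 1
    rw [← Real.exp_mul, ← Real.exp_nat_mul]
    rw [show Real.exp (-σ * i) * (D * Real.exp ((i + 1) * q)) =
      D * (Real.exp (-σ * i) * Real.exp ((i + 1) * q)) by ring, mul_assoc, ← Real.exp_add,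
      ← Real.exp_add]
    congr 2
    ring
  simp_rw [e]
  rw [← ENNReal.ofReal_tsum_of_nonneg (fun i => by positivity)
    ((summable_geometric_of_lt_one (Real.exp_pos _).le hr).mul_left _)]
  apply ENNReal.ofReal_le_ofReal
  rw [tsum_mul_left, tsum_geometric_of_lt_one (Real.exp_pos _).le hr]
  gcongr
  have hδ : 0 < σ - q := by linarith
  have h2 := Real.add_one_le_exp (σ - q)
  have h3 : Real.exp (-(σ - q)) ≤ 1 / (σ - q + 1) := by
    rw [Real.exp_neg, ← one_div]
    gcongr
  have h4 : (σ - q) / (σ - q + 1) ≤ 1 - Real.exp (-(σ - q)) := by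
    have : (σ - q) / (σ - q + 1) = 1 - 1 / (σ - q + 1) := by field_simp; ring
    linarith
  calc (1 - Real.exp (-(σ - q)))⁻¹ ≤ ((σ - q) / (σ - q + 1))⁻¹ := by
        gcongr
    _ = 1 + 1 / (σ - q) := by field_simp

/-- the error majorant -/
noncomputable def gErr (a b x : ℝ) : ℝ := if 1 < x then x ^ b else x ^ a

theorem gErr_aux {μ : ℕ → ℝ} {D q : ℝ} (hD : 0 < D) (h1 : ∀ k, 1 < μ k)
    (hF : ∀ τ : ℝ, 0 < τ →
      ((Set.encard {k | μ k < τ} : ℕ∞) : ℝ≥0∞) ≤ ENNReal.ofReal (D * τ ^ q))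
    {a b : ℝ} (hb0 : 0 ≤ b) (hb : b < q) (ha : q < a) :
    ∃ E : ℝ, 0 < E ∧ ∀ y : ℝ, 0 < y →
      ∑' k, ENNReal.ofReal (gErr a b (y / μ k)) ≤ ENNReal.ofReal (E * y ^ q) := by
  let s : ℤ → ℝ := fun i => if 0 ≤ i then Real.exp (-(a - q) * i) else Real.exp ((q - b) * i)
  have hs0 : ∀ i, 0 < s i := by
    intro i
    simp only [s]
    split_ifs <;> positivity
  have hsum : Summable s := by
    have key : ∀ c : ℝ, 0 < c → Summable (fun i : ℕ => Real.exp (-c * i)) := by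
      intro c hc
      have := summable_geometric_of_lt_one (Real.exp_pos (-c)).le
        (by rw [Real.exp_lt_one_iff]; linarith)
      refine this.congr fun i => ?_
      rw [← Real.exp_nat_mul]; congr 1; ring
    refine Summable.of_nat_of_neg_add_one ?_ ?_
    · refine (key (a - q) (by linarith)).congr fun i => ?_
      simp [s]
    · refine ((key (q - b) (by linarith)).mul_left (Real.exp (-(q-b)))).congr fun i => ?_
      have : ¬ (0 : ℤ) ≤ -((i : ℤ) + 1) := by omega
      simp only [s, this, if_false]
      rw [← Real.exp_add]
      congr 1
      push_cast
      ring
  refine ⟨D * Real.exp q * ∑' i, s i,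
    mul_pos (by positivity) (hsum.tsum_pos (fun i => (hs0 i).le) 0 (hs0 0)), fun y hy => ?_⟩
  have hμ0 : ∀ k, 0 < μ k := fun k => by linarith [h1 k]
  have hbl := block_aux (γ := ℤ) hF (fun k => ⌊Real.log (μ k / y)⌋)
    (fun i => y * Real.exp (i + 1))
    (fun i => by positivity) (fun k => by
      have h0 : 0 < μ k / y := div_pos (hμ0 k) hy
      rw [← div_lt_iff₀' hy, ← Real.log_lt_iff_lt_exp h0]
      exact Int.lt_floor_add_one _)
    (fun k => ENNReal.ofReal (gErr a b (y / μ k)))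
    (fun i => ENNReal.ofReal (Real.exp (-q * i) * s i))
    (fun k => by
      have h0 : 0 < μ k / y := div_pos (hμ0 k) hy
      have h0' : 0 < y / μ k := div_pos hy (hμ0 k)
      apply ENNReal.ofReal_le_ofReal
      have hlog : Real.log (y / μ k) = - Real.log (μ k / y) := by
        rw [← Real.log_inv, inv_div]
      have hfl := Int.floor_le (Real.log (μ k / y))
      have hiff : 0 ≤ ⌊Real.log (μ k / y)⌋ ↔ ¬ 1 < y / μ k := by
        rw [Int.floor_nonneg, not_lt, ← Real.log_nonpos_iff h0'.le, hlog]
        constructor <;> intro h <;> linarith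
      simp only [s, gErr]
      by_cases hc : 1 < y / μ k
      · rw [if_pos hc, if_neg (by rw [hiff]; simpa using hc), Real.rpow_def_of_pos h0',
          ← Real.exp_add, Real.exp_le_exp, hlog]
        nlinarith
      · rw [if_neg hc, if_pos (by rw [hiff]; exact hc), Real.rpow_def_of_pos h0',
          ← Real.exp_add, Real.exp_le_exp, hlog]
        nlinarith)
  refine hbl.trans (le_of_eq ?_)
  have e : ∀ i : ℤ, ENNReal.ofReal (Real.exp (-q * i) * s i) *
      ENNReal.ofReal (D * (y * Real.exp (i + 1)) ^ q)
      = ENNReal.ofReal (D * Real.exp q * y ^ q * s i) := by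
    intro i
    rw [← ENNReal.ofReal_mul (mul_pos (Real.exp_pos _) (hs0 i)).le]
    congr 1
    rw [Real.mul_rpow hy.le (Real.exp_pos _).le, ← Real.exp_mul]
    have : Real.exp q = Real.exp (-q * i) * Real.exp ((i + 1) * q) := by
      rw [← Real.exp_add]; congr 1; ring
    rw [this]; ring
  simp_rw [e]
  rw [← ENNReal.ofReal_tsum_of_nonneg (fun i => by have := hs0 i; positivity) (hsum.mul_left _),
    tsum_mul_left]
  congr 1
  ring

theorem combine_aux {μ : ℕ → ℝ} {D q : ℝ} (hD : 0 < D) (h1 : ∀ k, 1 < μ k)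
    (hF : ∀ τ : ℝ, 0 < τ →
      ((Set.encard {k | μ k < τ} : ℕ∞) : ℝ≥0∞) ≤ ENNReal.ofReal (D * τ ^ q))
    {a b : ℝ} (hb0 : 0 ≤ b) (hb : b < q) (ha : q < a) :
    ∃ E : ℝ, 0 < E ∧ ∀ σ : ℝ, q ≤ σ → σ ≤ a → ∀ y : ℝ, 0 < y →
      ∑' k, ENNReal.ofReal (gErr a b (y / μ k)) ≤ ENNReal.ofReal (E * y ^ σ) := by
  obtain ⟨E, hE, hEb⟩ := gErr_aux hD h1 hF hb0 hb ha
  have hZ := zeta_aux hD h1 hF ha (by linarith)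
  set Z := D * Real.exp q * (1 + 1 / (a - q)) with hZdef
  have haq : 0 < a - q := by linarith
  have hZ0 : 0 < Z := by positivity
  refine ⟨E + Z, by positivity, fun σ hσ hσa y hy => ?_⟩
  rcases le_or_gt y 1 with hy1 | hy1
  · have e : ∀ k, ENNReal.ofReal (gErr a b (y / μ k)) =
        ENNReal.ofReal (y ^ a) * ENNReal.ofReal (μ k ^ (-a)) := by
      intro k
      have h0 : 0 < μ k := by linarith [h1 k]
      have : ¬ 1 < y / μ k := by
        rw [not_lt, div_le_one h0]
        linarith [h1 k]
      rw [gErr, if_neg this, ← ENNReal.ofReal_mul (by positivity), Real.div_rpow hy.le h0.le,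
        Real.rpow_neg h0.le]
      rfl
    simp_rw [e]
    rw [ENNReal.tsum_mul_left]
    calc ENNReal.ofReal (y ^ a) * ∑' k, ENNReal.ofReal (μ k ^ (-a))
        ≤ ENNReal.ofReal (y ^ a) * ENNReal.ofReal Z := by gcongr
      _ = ENNReal.ofReal (Z * y ^ a) := by rw [← ENNReal.ofReal_mul (by positivity), mul_comm]
      _ ≤ _ := by
        apply ENNReal.ofReal_le_ofReal
        have : y ^ a ≤ y ^ σ := Real.rpow_le_rpow_of_exponent_ge hy hy1 hσa
        gcongr
        linarith
  · refine (hEb y hy).trans (ENNReal.ofReal_le_ofReal ?_)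
    have : y ^ q ≤ y ^ σ := Real.rpow_le_rpow_of_exponent_le hy1.le hσ
    gcongr
    linarith

theorem errsum_aux {ι : Type} [Fintype ι] [DecidableEq ι] {μ : ι → ℕ → ℝ} {D q : ι → ℝ}
    (hD : ∀ j, 0 < D j) (h1 : ∀ j k, 1 < μ j k)
    (hF : ∀ j, ∀ τ : ℝ, 0 < τ →
      ((Set.encard {k | μ j k < τ} : ℕ∞) : ℝ≥0∞) ≤ ENNReal.ofReal (D j * τ ^ (q j)))
    {a b p : ℝ} (hb0 : 0 ≤ b) (hb : b < p) (ha : p < a) (hq : ∀ j, q j ≤ p)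
    (j0 : ι) (hj0 : q j0 = p) :
    ∃ E : ℝ, 0 < E ∧ ∀ τ : ℝ, Real.exp 1 ≤ τ → Real.exp (1 / (a - p)) ≤ τ →
      ∑' t : ι → ℕ, ENNReal.ofReal (gErr a b (τ / ∏ j, μ j (t j))) ≤
        ENNReal.ofReal (E * (τ ^ p *
          Real.log τ ^ ((Finset.univ.filter (fun j => q j = p)).card - 1))) := by
  classical
  obtain ⟨E, hE, hEb⟩ := combine_aux (hD j0) (h1 j0) (hF j0) hb0 (hj0 ▸ hb) (hj0 ▸ ha)
  let G : ι → ℝ := fun j => D j * Real.exp (q j) * (if q j = p then 2 else 1 + 1 / (p - q j))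
  have hG : ∀ j, 0 < G j := by
    intro j
    simp only [G]
    have := hD j
    split_ifs with h
    · positivity
    · have : 0 < p - q j := by have := lt_of_le_of_ne (hq j) h; linarith
      positivity
  refine ⟨E * Real.exp 1 * ∏ j : {j // j ≠ j0}, G j, ?_, fun τ hτ1 hτ2 => ?_⟩
  · have : 0 < ∏ j : {j // j ≠ j0}, G j := Finset.prod_pos fun j _ => hG j
    positivity
  have hτ0 : 0 < τ := lt_of_lt_of_le (Real.exp_pos _) hτ1
  have hL1 : 1 ≤ Real.log τ := by rwa [Real.le_log_iff_exp_le hτ0]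
  have hL2 : 1 / (a - p) ≤ Real.log τ := by rwa [Real.le_log_iff_exp_le hτ0]
  set L := Real.log τ with hL
  have hL0 : 0 < L := by linarith
  set ε := 1 / L with hε
  have hε0 : 0 < ε := by positivity
  have hap : 0 < a - p := by linarith
  have hεa : ε ≤ a - p := by
    rw [hε, div_le_iff₀ hL0]
    rw [div_le_iff₀ hap] at hL2
    linarith
  have hτε : τ ^ (p + ε) = Real.exp 1 * τ ^ p := by
    rw [Real.rpow_add hτ0, Real.rpow_def_of_pos hτ0 ε, ← hL, hε]
    rw [mul_one_div_cancel hL0.ne']; ring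
  -- the zeta bounds
  have hz : ∀ j, ∑' k, ENNReal.ofReal (μ j k ^ (-(p + ε))) ≤
      ENNReal.ofReal (G j * (if q j = p then L else 1)) := by
    intro j
    have hqj := hq j
    refine (zeta_aux (hD j) (h1 j) (hF j) (σ := p + ε) (by linarith) (by linarith)).trans ?_
    apply ENNReal.ofReal_le_ofReal
    simp only [G]
    have := hD j
    split_ifs with h
    · rw [mul_assoc (D j * Real.exp (q j))]
      gcongr
      rw [h, add_sub_cancel_left, hε, one_div_one_div]
      linarith
    · have : 0 < p - q j := by have := lt_of_le_of_ne (hq j) h; linarith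
      rw [mul_one]
      gcongr
      linarith
  have hpow : ∏ j : {j // j ≠ j0}, (if q j = p then L else 1) =
      L ^ ((Finset.univ.filter (fun j => q j = p)).card - 1) := by
    have e1 : ∏ j : ι, (if q j = p then L else 1) =
        L ^ (Finset.univ.filter (fun j => q j = p)).card := by
      rw [Finset.prod_ite]; simp
    rw [Fintype.prod_eq_mul_prod_subtype_ne _ j0, if_pos hj0] at e1
    have hc : 0 < (Finset.univ.filter (fun j => q j = p)).card :=
      Finset.card_pos.2 ⟨j0, by simp [hj0]⟩
    obtain ⟨c, hc'⟩ := Nat.exists_eq_succ_of_ne_zero hc.ne'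
    rw [hc', Nat.succ_eq_add_one, pow_succ'] at e1
    rw [hc', Nat.succ_eq_add_one, Nat.add_sub_cancel]
    exact mul_left_cancel₀ hL0.ne' e1
  rw [← (Equiv.funSplitAt j0 ℕ).symm.tsum_eq, ENNReal.tsum_prod', ENNReal.tsum_comm]
  have hprod : ∀ (k : ℕ) (t : {j // j ≠ j0} → ℕ),
      ∏ j, μ j ((Equiv.funSplitAt j0 ℕ).symm (k, t) j) = (∏ j, μ j.1 (t j)) * μ j0 k := by
    intro k t
    rw [Fintype.prod_eq_mul_prod_subtype_ne _ j0, mul_comm]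
    congr 1
    · refine Finset.prod_congr rfl fun j _ => ?_
      simp [Equiv.funSplitAt, Equiv.piSplitAt, j.2]
    · simp [Equiv.funSplitAt, Equiv.piSplitAt]
  simp_rw [hprod, ← div_div]
  have hμ0 : ∀ j k, 0 < μ j k := fun j k => by linarith [h1 j k]
  calc ∑' (t : {j // j ≠ j0} → ℕ) (k : ℕ),
        ENNReal.ofReal (gErr a b (τ / (∏ j, μ j.1 (t j)) / μ j0 k))
      ≤ ∑' t : {j // j ≠ j0} → ℕ,
          ENNReal.ofReal (E * (τ / (∏ j, μ j.1 (t j))) ^ (p + ε)) := by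
        refine ENNReal.tsum_le_tsum fun t => ?_
        refine hEb (p + ε) (by linarith) (by linarith) _ ?_
        have : 0 < ∏ j, μ j.1 (t j) := Finset.prod_pos fun j _ => hμ0 _ _
        positivity
    _ = ∑' t : {j // j ≠ j0} → ℕ,
          ENNReal.ofReal (E * τ ^ (p + ε)) * ∏ j, ENNReal.ofReal (μ j.1 (t j) ^ (-(p + ε))) := by
        refine tsum_congr fun t => ?_
        rw [← ENNReal.ofReal_prod_of_nonneg (fun j _ => Real.rpow_nonneg (hμ0 _ _).le _),
          ← ENNReal.ofReal_mul (by positivity)]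
        congr 1
        rw [Real.finsetProd_rpow _ _ (fun j _ => (hμ0 _ _).le)]
        have : 0 < ∏ j, μ j.1 (t j) := Finset.prod_pos fun j _ => hμ0 _ _
        rw [Real.div_rpow hτ0.le this.le, Real.rpow_neg this.le]
        ring
    _ = ENNReal.ofReal (E * τ ^ (p + ε)) *
          ∏ j : {j // j ≠ j0}, ∑' k, ENNReal.ofReal (μ j.1 k ^ (-(p + ε))) := by
        rw [ENNReal.tsum_mul_left,
          tsum_pi_prod_aux (fun (j : {j // j ≠ j0}) k => ENNReal.ofReal (μ j.1 k ^ (-(p + ε))))]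
    _ ≤ ENNReal.ofReal (E * τ ^ (p + ε)) *
          ∏ j : {j // j ≠ j0}, ENNReal.ofReal (G j * (if q j = p then L else 1)) := by
        gcongr with j
        exact hz j
    _ = _ := by
        rw [← ENNReal.ofReal_prod_of_nonneg, ← ENNReal.ofReal_mul (by positivity)]
        · congr 1
          rw [Finset.prod_mul_distrib, hpow, hτε]
          ring
        · intro j _
          have := hG j
          split_ifs <;> positivity

theorem real_tsum_aux {α : Type} {f : α → ℝ} (hf : ∀ x, 0 ≤ f x) {B : ℝ} (hB : 0 ≤ B)
    (h : ∑' x, ENNReal.ofReal (f x) ≤ ENNReal.ofReal B) : Summable f ∧ ∑' x, f x ≤ B := by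
  have hs : Summable f := by
    have := ENNReal.summable_toReal (ne_top_of_le_ne_top ENNReal.ofReal_ne_top h)
    refine this.congr fun x => ENNReal.toReal_ofReal (hf x)
  refine ⟨hs, ?_⟩
  rw [← ENNReal.ofReal_tsum_of_nonneg hf hs] at h
  exact (ENNReal.ofReal_le_ofReal_iff hB).1 h

theorem indicator_aux {α : Type} {P : α → Prop} [DecidablePred P] :
    (Summable (fun x => if P x then (1 : ℝ) else 0) ↔ {x | P x}.Finite) ∧
    ∑' x, (if P x then (1 : ℝ) else 0) = Nat.card {x | P x} := by
  have key : Summable (fun x => if P x then (1 : ℝ) else 0) ↔ {x | P x}.Finite := by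
    constructor
    · intro h
      have h1 := h.tendsto_cofinite_zero.eventually (gt_mem_nhds (show (0 : ℝ) < 1 by norm_num))
      rw [Filter.eventually_cofinite] at h1
      refine h1.subset fun x hx => ?_
      have hx' : P x := hx
      simp [hx']
    · intro h
      refine summable_of_finite_support (h.subset fun x hx => ?_)
      by_contra hc
      have hc' : ¬ P x := hc
      simp [hc'] at hx
  refine ⟨key, ?_⟩
  by_cases h : {x | P x}.Finite
  · rw [tsum_eq_sum (s := h.toFinset) (fun x hx => by
      have : ¬ P x := by simpa using hx
      simp [this])]
    have : ∀ x ∈ h.toFinset, (if P x then (1 : ℝ) else 0) = 1 := fun x hx => by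
      have : P x := by simpa using hx
      simp [this]
    rw [Finset.sum_congr rfl this, Nat.card_eq_card_finite_toFinset h]
    simp
  · rw [tsum_eq_zero_of_not_summable (by rwa [key])]
    have : Infinite {x | P x} := Set.infinite_coe_iff.2 h
    rw [Nat.card_eq_zero_of_infinite]
    simp

theorem tensor_weyl_r_factors_case_three (r : ℕ) (hr : 2 ≤ r)
    (n : Fin r → ℕ) (m : Fin r → ℝ) (μ : Fin r → ℕ → ℝ)
    (l : Fin r) (C : ℝ) (hC : 0 < C)
    (hn : ∀ j, 1 ≤ n j) (hm : ∀ j, 0 < m j)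
    (hdom : ∀ j, j ≠ l → (n j : ℝ) / m j < (n l : ℝ) / m l)
    (hl : SharpWeyl (n l) (m l) C (μ l))
    (hμ : ∀ j, j ≠ l → WeylData (n j) (m j) (μ j)) (hμ1 : ∀ j k, 1 < μ j k)
    (p : ℝ) (hple : ∀ j, j ≠ l → (n j : ℝ) / m j ≤ p)
    (hpmem : ∃ j, j ≠ l ∧ (n j : ℝ) / m j = p)
    (s : ℕ) (hs : s = Nat.card {j : Fin r | j ≠ l ∧ (n j : ℝ) / m j = p})
    (hcase : ((n l : ℝ) - 1) / m l < p) :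
    (∀ j, j ≠ l → Summable (fun k : ℕ => μ j k ^ (-((n l : ℝ) / m l)))) ∧
    (fun τ : ℝ => (Nat.card {t : Fin r → ℕ | (∏ j, μ j (t j)) < τ} : ℝ) -
        C / n l * (∏ j ∈ Finset.univ.erase l, ∑' k : ℕ, μ j k ^ (-((n l : ℝ) / m l))) *
          τ ^ ((n l : ℝ) / m l)) =O[atTop]
      (fun τ : ℝ => τ ^ p * Real.log τ ^ (s - 1)) := by
  classical
  have hD' : ∀ j : {j // j ≠ l}, ∃ D : ℝ, 0 < D ∧ ∀ τ : ℝ, 0 < τ →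
      ((Set.encard {k | μ j k < τ} : ℕ∞) : ℝ≥0∞) ≤
        ENNReal.ofReal (D * τ ^ ((n j : ℝ) / m j)) :=
    fun j => count_aux (hn j) (hm j) (hμ j j.2) (hμ1 j)
  choose D hD hF using hD'
  obtain ⟨j0, hj0l, hj0⟩ := hpmem
  set a := (n l : ℝ) / m l with ha
  set b := ((n l : ℝ) - 1) / m l with hb
  have hnl : (1 : ℝ) ≤ n l := by exact_mod_cast hn l
  have hb0 : 0 ≤ b := div_nonneg (by linarith) (hm l).le
  have hpa : p < a := hj0 ▸ hdom j0 hj0l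
  have ha0 : 0 < a := by linarith
  have hμ0 : ∀ j k, 0 < μ j k := fun j k => by linarith [hμ1 j k]
  have hZsum : ∀ j : {j // j ≠ l}, Summable (fun k : ℕ => μ j k ^ (-a)) := by
    intro j
    have hqa : (n j : ℝ) / m j < a := hdom j j.2
    refine (real_tsum_aux (fun k => Real.rpow_nonneg (hμ0 _ _).le _) ?_
      (zeta_aux (hD j) (hμ1 j) (hF j) hqa ha0.le)).1
    have := hD j
    have : 0 < a - (n j : ℝ) / m j := by linarith
    positivity
  refine ⟨fun j hj => hZsum ⟨j, hj⟩, ?_⟩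
  let M : ({j // j ≠ l} → ℕ) → ℝ := fun t => ∏ j, μ j.1 (t j)
  have hM0 : ∀ t, 0 < M t := fun t => Finset.prod_pos fun j _ => hμ0 _ _
  -- the product of zetas
  have hMz : ∑' t, ENNReal.ofReal (M t ^ (-a)) =
      ENNReal.ofReal (∏ j : {j // j ≠ l}, ∑' k, μ j k ^ (-a)) := by
    rw [ENNReal.ofReal_prod_of_nonneg
      (fun j _ => tsum_nonneg fun k => Real.rpow_nonneg (hμ0 _ _).le _)]
    have e : ∀ j : {j // j ≠ l}, ENNReal.ofReal (∑' k, μ j k ^ (-a)) =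
        ∑' k, ENNReal.ofReal (μ j k ^ (-a)) := fun j =>
      ENNReal.ofReal_tsum_of_nonneg (fun k => Real.rpow_nonneg (hμ0 _ _).le _) (hZsum j)
    simp_rw [e]
    rw [← tsum_pi_prod_aux (fun (j : {j // j ≠ l}) k => ENNReal.ofReal (μ j k ^ (-a)))]
    refine tsum_congr fun t => ?_
    rw [← ENNReal.ofReal_prod_of_nonneg (fun j _ => Real.rpow_nonneg (hμ0 _ _).le _)]
    rw [Real.finsetProd_rpow _ _ (fun j _ => (hμ0 _ _).le)]
  have hMn : ∀ t, 0 ≤ M t ^ (-a) := fun t => Real.rpow_nonneg (hM0 t).le _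
  have hZn : 0 ≤ ∏ j : {j // j ≠ l}, ∑' k, μ j k ^ (-a) :=
    Finset.prod_nonneg (fun j _ => tsum_nonneg fun k => Real.rpow_nonneg (hμ0 _ _).le _)
  have hMs : Summable (fun t => M t ^ (-a)) := (real_tsum_aux hMn hZn hMz.le).1
  have hMt : ∑' t, M t ^ (-a) = ∏ j : {j // j ≠ l}, ∑' k, μ j k ^ (-a) := by
    rw [← ENNReal.ofReal_tsum_of_nonneg hMn hMs] at hMz
    exact (ENNReal.ofReal_eq_ofReal_iff (tsum_nonneg hMn) hZn).1 hMz
  have hprodeq : ∏ j ∈ Finset.univ.erase l, ∑' k, μ j k ^ (-a) = ∑' t, M t ^ (-a) := by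
    rw [hMt]
    exact Finset.prod_subtype _ (by simp) _
  rw [hprodeq]
  obtain ⟨-, hlfin, κ, hκ, hlb⟩ := hl
  set c := C / n l with hc
  have hc0 : 0 < c := by positivity
  obtain ⟨E, hE, hEb⟩ := errsum_aux (q := fun j : {j // j ≠ l} => (n j : ℝ) / m j) hD
    (fun j => hμ1 j) hF hb0 hcase hpa (fun j => hple j j.2) ⟨j0, hj0l⟩ hj0
  have hscard : (Finset.univ.filter
      (fun j : {j // j ≠ l} => (n j : ℝ) / m j = p)).card = s := by
    rw [hs, ← Fintype.card_subtype, ← Nat.card_eq_fintype_card]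
    exact Nat.card_congr (Equiv.subtypeSubtypeEquivSubtypeInter (fun j => j ≠ l) (fun j => (n j : ℝ) / m j = p))
  rw [hscard] at hEb
  refine Asymptotics.IsBigO.of_bound ((κ + c) * E) ?_
  filter_upwards [eventually_ge_atTop (Real.exp 1), eventually_ge_atTop (Real.exp (1 / (a - p)))]
    with τ hτ1 hτ2
  have hτ0 : 0 < τ := lt_of_lt_of_le (Real.exp_pos _) hτ1
  have hL1 : 1 ≤ Real.log τ := by rwa [Real.le_log_iff_exp_le hτ0]
  have hB0 : 0 ≤ τ ^ p * Real.log τ ^ (s - 1) := by positivity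
  rw [Real.norm_eq_abs, Real.norm_eq_abs, abs_of_nonneg hB0]
  have hx0 : ∀ t, 0 < τ / M t := fun t => div_pos hτ0 (hM0 t)
  have hg0 : ∀ t, 0 ≤ gErr a b (τ / M t) := by
    intro t
    have := (hx0 t).le
    unfold gErr
    split_ifs <;> positivity
  obtain ⟨hgs, hgt⟩ := real_tsum_aux hg0 (by positivity) (hEb τ hτ1 hτ2)
  let N : ({j // j ≠ l} → ℕ) → ℝ := fun t => (Nat.card {k | μ l k < τ / M t} : ℝ)
  have herr : ∀ t, ‖N t - c * (τ / M t) ^ a‖ ≤ (κ + c) * gErr a b (τ / M t) := by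
    intro t
    have hg := hg0 t
    rw [Real.norm_eq_abs]
    simp only [N]
    by_cases h : 1 < τ / M t
    · refine (hlb _ h).trans ?_
      have : gErr a b (τ / M t) = (τ / M t) ^ b := by rw [gErr, if_pos h]
      rw [← this]
      nlinarith
    · have he : {k | μ l k < τ / M t} = ∅ := by
        ext k
        have := hμ1 l k
        simp only [Set.mem_ofPred_eq, Set.mem_empty_iff_false, iff_false, not_lt]
        linarith
      have : gErr a b (τ / M t) = (τ / M t) ^ a := by rw [gErr, if_neg h]
      rw [he, ← this]
      simp only [Nat.card_of_isEmpty, Nat.cast_zero, zero_sub, abs_neg]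
      rw [abs_of_nonneg (by positivity)]
      nlinarith
  have hxa : ∀ t, c * (τ / M t) ^ a = c * τ ^ a * M t ^ (-a) := by
    intro t
    rw [Real.div_rpow hτ0.le (hM0 t).le, Real.rpow_neg (hM0 t).le]
    ring
  have hxs : Summable (fun t => c * (τ / M t) ^ a) := by
    simp_rw [hxa]
    exact hMs.mul_left _
  have hds : Summable (fun t => N t - c * (τ / M t) ^ a) :=
    Summable.of_norm_bounded (hgs.mul_left _) herr
  have hNs : Summable N := by
    refine (hds.add hxs).congr fun t => ?_
    ring
  -- counting
  have hcount : (Nat.card {t : Fin r → ℕ | (∏ j, μ j (t j)) < τ} : ℝ) = ∑' t, N t := by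
    rw [← (indicator_aux (P := fun t : Fin r → ℕ => (∏ j, μ j (t j)) < τ)).2]
    rw [← ((Equiv.prodComm _ _).trans (Equiv.funSplitAt l ℕ).symm).tsum_eq]
    have hprod : ∀ x : ({j // j ≠ l} → ℕ) × ℕ,
        ∏ j, μ j (((Equiv.prodComm _ _).trans (Equiv.funSplitAt l ℕ).symm) x j) =
          μ l x.2 * M x.1 := by
      rintro ⟨t, k⟩
      rw [Fintype.prod_eq_mul_prod_subtype_ne _ l]
      congr 1
      · simp [Equiv.funSplitAt, Equiv.piSplitAt]
      · refine Finset.prod_congr rfl fun j _ => ?_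
        simp [Equiv.funSplitAt, Equiv.piSplitAt, j.2]
    have hiff : ∀ x : ({j // j ≠ l} → ℕ) × ℕ, μ l x.2 * M x.1 < τ ↔ μ l x.2 < τ / M x.1 :=
      fun x => (lt_div_iff₀ (hM0 _)).symm
    simp_rw [hprod, hiff]
    have hfib : ∀ t, Summable (fun k => if μ l k < τ / M t then (1 : ℝ) else 0) := fun t =>
      indicator_aux.1.2 (hlfin _)
    have hfibt : ∀ t, ∑' k, (if μ l k < τ / M t then (1 : ℝ) else 0) = N t := fun t =>
      indicator_aux.2
    have hsum : Summable (fun x : ({j // j ≠ l} → ℕ) × ℕ =>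
        if μ l x.2 < τ / M x.1 then (1 : ℝ) else 0) := by
      rw [summable_prod_of_nonneg (fun x => by
        show (0 : ℝ) ≤ if _ then _ else _
        split_ifs <;> norm_num)]
      refine ⟨hfib, ?_⟩
      simp_rw [hfibt]
      exact hNs
    rw [hsum.tsum_prod' hfib]
    exact tsum_congr hfibt
  rw [hcount]
  have hfinal : ∑' t, N t - c * (∑' t, M t ^ (-a)) * τ ^ a =
      ∑' t, (N t - c * (τ / M t) ^ a) := by
    rw [hNs.tsum_sub hxs]
    simp_rw [hxa]
    rw [tsum_mul_left]
    ring
  rw [hfinal, ← Real.norm_eq_abs]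
  calc ‖∑' t, (N t - c * (τ / M t) ^ a)‖ ≤ ∑' t, (κ + c) * gErr a b (τ / M t) :=
        tsum_of_norm_bounded (hgs.mul_left _).hasSum herr
    _ = (κ + c) * ∑' t, gErr a b (τ / M t) := tsum_mul_left
    _ ≤ (κ + c) * (E * (τ ^ p * Real.log τ ^ (s - 1))) := by
        gcongr
    _ = _ := by ring
end
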